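/- Up to isotopy, there are exactly two non-trivial isotopy classes of unoriented, orientation-preserving simple closed curves on a Klein bottle; in particular, the simple closed curve on the Klein bottle ∂(S¹ ×̃ B²) which runs twice around the S¹ direction is unique up to isotopy. -/

import Mathlib

/-!
Statement 6 (Lickorish): up to (unoriented, ambient) isotopy there are exactly two
non-trivial isotopy classes of orientation-preserving (i.e. two-sided, annular
neighbourhood) simple closed curves on the Klein bottle; in particular the simple
closed curve on the Klein bottle `∂(S¹ ×̃ B²)` which runs twice around the `S¹`
direction is unique up to isotopy.

The Klein bottle is realised as the quotient of `ℝ × S¹` by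
`(t, z) ~ (t + 1, z⁻¹)` (note `z⁻¹ = conj z` on the unit circle); it is the boundary of
the solid Klein bottle `S¹ ×̃ B²`.  A simple closed curve is *orientation-preserving*
iff it has an annular neighbourhood, and *trivial* iff it bounds a disc.  "Running
(±)twice around the `S¹` direction" is expressed via lifts along the covering
`ℝ × S¹ → K`: the base coordinate of a lift advances by `±2` per loop.
-/

open Topology Metric Set

noncomputable section

/-- The gluing relation for the Klein bottle: `(t, z) ~ (t + n, z)` for even `n` and
`(t, z) ~ (t + n, z⁻¹)` (complex conjugation on the unit circle) for odd `n`. -/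
def kbRel : (ℝ × Circle) → (ℝ × Circle) → Prop :=
  fun p q => ∃ n : ℤ, q.1 = p.1 + n ∧ q.2 = (if Even n then p.2 else p.2⁻¹)

/-- The Klein bottle, the boundary of the solid Klein bottle `S¹ ×̃ B²`. -/
def KleinBottle : Type := Quot kbRel

instance : TopologicalSpace KleinBottle := by unfold KleinBottle; infer_instance

/-- `γ` runs `±d` times around the `S¹` direction of the Klein bottle: along the
covering `ℝ × S¹ → K`, some continuous lift of `γ` advances by `±d` in the base
coordinate as the parameter goes once around the circle. -/
def RunsAround (γ : Circle → KleinBottle) (d : ℤ) : Prop :=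
  ∃ (c : ℝ → ℝ) (u : ℝ → Circle), Continuous c ∧ Continuous u ∧
    (∀ s : ℝ, γ (Circle.exp s) = Quot.mk kbRel (c s, u s)) ∧
    (c (2 * Real.pi) - c 0 = d ∨ c (2 * Real.pi) - c 0 = -d)

/-- A simple closed curve is *orientation-preserving* (two-sided) iff it has an annular
neighbourhood. -/
def HasAnnularNbhd (γ : Circle → KleinBottle) : Prop :=
  ∃ e : Circle × ℝ → KleinBottle, IsEmbedding e ∧ ∀ u, e (u, 0) = γ u

/-- A simple closed curve is *trivial* iff it bounds an embedded disc. -/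
def BoundsDisc (γ : Circle → KleinBottle) : Prop :=
  ∃ d : (Metric.closedBall (0:ℂ) 1 : Set ℂ) → KleinBottle, IsEmbedding d ∧
    Set.range γ = d '' {z | ‖(z : ℂ)‖ = 1}

/-- Unoriented (ambient) isotopy of simple closed curves. -/
def CurveIsotopic (γ γ' : Circle → KleinBottle) : Prop :=
  ∃ F : ℝ → KleinBottle → KleinBottle,
    Continuous (fun q : ℝ × KleinBottle => F q.1 q.2) ∧
    (∀ t, IsHomeomorph (F t)) ∧ F 0 = id ∧
    F 1 '' (Set.range γ) = Set.range γ'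

open scoped Real
open Complex (I exp_add exp_int_mul exp_log continuous_exp exp_ne_zero abs_re_le_norm sub_re exp_eq_exp_iff_exists_int exp_sub norm_exp_ofReal_mul_I log_re norm_real continuous_re continuous_im abs_im_le_norm exp_pi_mul_I log_ofReal_mul I_ne_zero exp_int_mul_two_pi_mul_I log_exp norm_conj normSq_eq_norm_sq normSq_apply mul_conj add_im ofReal_im mul_im ofReal_re sub_im add_re conj_re conj_im two_pi_I_ne_zero ofReal_div continuous_conj exp_conj ofReal_mul continuous_ofReal norm_of_nonneg conj_ofReal equivRealProdCLM ofReal_exp)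
open Real (pi_pos pi_gt_three norm_eq_abs dist_eq two_pi_pos exp_pos log_mul)

def HL {α : Type*} [TopologicalSpace α] (X : Set α) (g : α → ℂ) : Prop :=
  ∃ l : α → ℂ, ContinuousOn l X ∧ ∀ z ∈ X, Complex.exp (l z) = g z

section logs
variable {α β : Type*} [TopologicalSpace α] [TopologicalSpace β] {X Y : Set α} {f g : α → ℂ}

theorem HL.mono (h : HL Y g) (hXY : X ⊆ Y) : HL X g := by
  obtain ⟨l, hl, h⟩ := h
  exact ⟨l, hl.mono hXY, fun z hz => h z (hXY hz)⟩

theorem HL.congr (h : HL X f) (hfg : ∀ z ∈ X, g z = f z) : HL X g := by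
  obtain ⟨l, hl, h⟩ := h
  exact ⟨l, hl, fun z hz => by rw [h z hz, hfg z hz]⟩

theorem HL.mul (hf : HL X f) (hg : HL X g) : HL X (fun z => f z * g z) := by
  obtain ⟨l, hl, h⟩ := hf
  obtain ⟨l', hl', h'⟩ := hg
  exact ⟨fun z => l z + l' z, hl.add hl', fun z hz => by rw [exp_add, h z hz, h' z hz]⟩

theorem HL.inv (hf : HL X f) : HL X (fun z => (f z)⁻¹) := by
  obtain ⟨l, hl, h⟩ := hf
  exact ⟨fun z => - l z, hl.neg, fun z hz => by rw [Complex.exp_neg, h z hz]⟩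

theorem HL.div (hf : HL X f) (hg : HL X g) : HL X (fun z => f z / g z) := by
  simpa only [div_eq_mul_inv] using hf.mul hg.inv

theorem HL.zpow (hf : HL X f) (n : ℤ) : HL X (fun z => (f z) ^ n) := by
  obtain ⟨l, hl, h⟩ := hf
  exact ⟨fun z => n * l z, continuousOn_const.mul hl, fun z hz => by rw [exp_int_mul, h z hz]⟩

theorem HL.comp {Z : Set β} {c : β → α} (hf : HL X f) (hc : ContinuousOn c Z) (hm : MapsTo c Z X) :
    HL Z (fun z => f (c z)) := by
  obtain ⟨l, hl, h⟩ := hf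
  exact ⟨fun z => l (c z), hl.comp hc hm, fun z hz => h _ (hm hz)⟩

theorem HL.const {c : ℂ} (hc : c ≠ 0) : HL X (fun _ => c) :=
  ⟨fun _ => Complex.log c, continuousOn_const, fun _ _ => exp_log hc⟩

theorem HL.exp {l : α → ℂ} (hl : ContinuousOn l X) : HL X (fun z => Complex.exp (l z)) :=
  ⟨l, hl, fun _ _ => rfl⟩

theorem HL.continuousOn (h : HL X f) : ContinuousOn f X := by
  obtain ⟨l, hl, h⟩ := h
  exact (continuous_exp.comp_continuousOn hl).congr fun z hz => (h z hz).symm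

theorem HL.ne_zero (h : HL X f) {x : α} (hx : x ∈ X) : f x ≠ 0 := by
  obtain ⟨l, hl, h⟩ := h
  rw [← h x hx]; exact exp_ne_zero _

theorem HL.of_slit (hf : ContinuousOn f X) (h : ∀ z ∈ X, f z ∈ Complex.slitPlane) : HL X f :=
  ⟨fun z => Complex.log (f z), hf.clog h, fun z hz =>
    exp_log (Complex.slitPlane_ne_zero (h z hz))⟩

theorem HL.of_near (hg : HL X g) (hf : ContinuousOn f X) (h : ∀ z ∈ X, ‖f z - g z‖ < ‖g z‖) :
    HL X f := by
  have h1 : HL X (fun z => f z / g z) := by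
    refine HL.of_slit (hf.div hg.continuousOn fun z hz => hg.ne_zero hz) fun z hz => ?_
    left
    have h0 := hg.ne_zero hz
    have : ‖f z / g z - 1‖ < 1 := by
      rw [div_sub_one h0, norm_div, div_lt_one (norm_pos_iff.2 h0)]
      exact h z hz
    have h2 := (abs_lt.1 ((abs_re_le_norm _).trans_lt this)).1
    simp only [sub_re, Complex.one_re] at h2
    linarith
  exact (h1.mul hg).congr fun z hz => by field_simp [hg.ne_zero hz]

theorem exp_eq_exp_dist {a b : ℂ} (h : Complex.exp a = Complex.exp b) (hd : ‖a - b‖ < 1) : a = b := by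
  obtain ⟨n, hn⟩ := exp_eq_exp_iff_exists_int.1 h
  rcases eq_or_ne n 0 with rfl | h0
  · simpa using hn
  · exfalso
    have : ‖a - b‖ = |(n : ℝ)| * (2 * π) := by
      rw [hn, add_sub_cancel_left, norm_mul, norm_mul, norm_mul]
      simp [abs_of_pos pi_pos]
    have h1 : (1 : ℝ) ≤ |(n : ℝ)| := by exact_mod_cast Int.one_le_abs h0
    nlinarith [pi_gt_three]

theorem log_diff_const (hX : IsPreconnected X) {l l' : α → ℂ} (hl : ContinuousOn l X)
    (hl' : ContinuousOn l' X) (h : ∀ z ∈ X, Complex.exp (l z) = Complex.exp (l' z)) :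
    ∃ n : ℤ, ∀ z ∈ X, l z = l' z + n * (2 * π * I) := by
  rcases X.eq_empty_or_nonempty with rfl | ⟨x0, hx0⟩
  · exact ⟨0, by simp⟩
  obtain ⟨n, hn⟩ := exp_eq_exp_iff_exists_int.1 (h x0 hx0)
  refine ⟨n, fun z hz => ?_⟩
  have hd : ContinuousOn (fun z => l z - l' z) X := hl.sub hl'
  have hpc : IsPreconnected ((fun z => l z - l' z) '' X) := hX.image _ hd
  have he : ∀ d ∈ (fun z => l z - l' z) '' X, Complex.exp d = Complex.exp (l x0 - l' x0) := by
    rintro _ ⟨w, hw, rfl⟩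
    simp only [exp_sub, h w hw, h x0 hx0, div_self (exp_ne_zero _)]
  have hsub : (fun z => l z - l' z) '' X ⊆ ball (l x0 - l' x0) (1/2) := by
    refine hpc.subset_of_closure_inter_subset isOpen_ball
      ⟨_, ⟨x0, hx0, rfl⟩, mem_ball_self (by norm_num)⟩ ?_
    rintro d ⟨hd1, hd2⟩
    have h3 := closure_ball_subset_closedBall hd1
    rw [mem_closedBall, dist_eq_norm] at h3
    rw [exp_eq_exp_dist (he d hd2) (by linarith)]
    exact mem_ball_self (by norm_num)
  have key : l z - l' z = l x0 - l' x0 := by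
    have h3 := hsub ⟨z, hz, rfl⟩
    rw [mem_ball, dist_eq_norm] at h3
    exact exp_eq_exp_dist (he _ ⟨z, hz, rfl⟩) (by linarith)
  rw [hn] at key
  linear_combination key

theorem HL.union (hX : IsClosed X) (hY : IsClosed Y) (hc : IsPreconnected (X ∩ Y)) (h1 : HL X g)
    (h2 : HL Y g) : HL (X ∪ Y) g := by
  classical
  obtain ⟨l, hl, h⟩ := h1
  obtain ⟨l', hl', h'⟩ := h2
  obtain ⟨n, hn⟩ := log_diff_const hc (hl.mono inter_subset_left) (hl'.mono inter_subset_right)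
    fun z hz => by rw [h z hz.1, h' z hz.2]
  set m : α → ℂ := fun z => l' z + n * (2 * π * I) with hm
  have hmc : ContinuousOn m Y := hl'.add continuousOn_const
  have hme : ∀ z ∈ Y, Complex.exp (m z) = g z := fun z hz => by
    rw [← h' z hz, hm]; exact exp_eq_exp_iff_exists_int.2 ⟨n, rfl⟩
  have e1 : EqOn (X.piecewise l m) l X := fun z hz => by simp [hz]
  have e2 : EqOn (X.piecewise l m) m Y := fun z hz => by
    by_cases hx : z ∈ X
    · simp [hx, hn z ⟨hx, hz⟩, hm]
    · simp [hx]
  refine ⟨X.piecewise l m, ContinuousOn.union_of_isClosed (hl.congr e1) (hmc.congr e2) hX hY, ?_⟩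
  rintro z (hz | hz)
  · rw [e1 hz, h z hz]
  · rw [e2 hz, hme z hz]

theorem HL.homotopy {H : ℝ → α → ℂ} (hc : ContinuousOn (fun p : ℝ × α => H p.1 p.2) (Icc 0 1 ×ˢ X))
    (h0 : ∀ t ∈ Icc (0:ℝ) 1, ∀ x ∈ X, H t x ≠ 0) (h : HL X (H 0)) : HL X (H 1) := by
  obtain ⟨l, hl, h⟩ := h
  have hmem : ∀ p : unitInterval × X, ((p.1 : ℝ), (p.2 : α)) ∈ Icc (0:ℝ) 1 ×ˢ X :=
    fun p => ⟨p.1.2, p.2.2⟩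
  let HH : C(unitInterval × X, {z : ℂ // z ≠ 0}) :=
    ⟨fun p => ⟨H p.1 p.2, h0 _ p.1.2 _ p.2.2⟩, by
      refine Continuous.subtype_mk ?_ _
      exact hc.comp_continuous (f := fun p : unitInterval × X => ((p.1 : ℝ), (p.2 : α)))
        (by fun_prop) hmem⟩
  let ff : C(X, ℂ) := ⟨fun x => l x, continuousOn_iff_continuous_domRestrict.1 hl⟩
  have H0 : ∀ a, HH (0, a) = (⟨Complex.exp (ff a), exp_ne_zero _⟩ : {z : ℂ // z ≠ 0}) := by
    intro a
    apply Subtype.ext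
    exact (h a a.2).symm
  let L := Complex.isCoveringMap_exp.liftHomotopy HH ff H0
  have hL : ∀ p, Complex.exp (L p) = H p.1 p.2 := fun p => by
    have := congrFun (Complex.isCoveringMap_exp.liftHomotopy_lifts HH ff H0) p
    exact congrArg Subtype.val this
  classical
  refine ⟨fun x => if hx : x ∈ X then L (1, ⟨x, hx⟩) else 0, ?_, ?_⟩
  · rw [continuousOn_iff_continuous_domRestrict]
    have : X.domRestrict (fun x => if hx : x ∈ X then L (1, ⟨x, hx⟩) else 0) = fun x => L (1, x) := by
      ext x; simp
    rw [this]; fun_prop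
  · intro x hx
    simp only [hx, dif_pos, hL]; simp

end logs

theorem HL.of_starConvex {E : Type*} [AddCommGroup E] [Module ℝ E] [TopologicalSpace E]
    [IsTopologicalAddGroup E] [ContinuousSMul ℝ E] {X : Set E} {g : E → ℂ} {x0 : E}
    (hx0 : x0 ∈ X) (hX : StarConvex ℝ x0 X)
    (hg : ContinuousOn g X) (h0 : ∀ x ∈ X, g x ≠ 0) : HL X g := by
  have hm : ∀ t ∈ Icc (0:ℝ) 1, ∀ x ∈ X, x0 + t • (x - x0) ∈ X := fun t ht x hx => by
    have := hX.add_smul_sub_mem hx ht.1 ht.2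
    exact this
  have := HL.homotopy (X := X) (H := fun t x => g (x0 + t • (x - x0))) ?_
    (fun t ht x hx => h0 _ (hm t ht x hx)) (by simpa using HL.const (h0 x0 hx0))
  · simpa using this
  · exact hg.comp (f := fun p : ℝ × E => x0 + p.1 • (p.2 - x0)) (by fun_prop)
      fun p hp => hm _ hp.1 _ hp.2

theorem HL.of_convex {E : Type*} [AddCommGroup E] [Module ℝ E] [TopologicalSpace E]
    [IsTopologicalAddGroup E] [ContinuousSMul ℝ E] {X : Set E} {g : E → ℂ} (hX : Convex ℝ X)
    (hg : ContinuousOn g X) (h0 : ∀ x ∈ X, g x ≠ 0) : HL X g := by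
  rcases X.eq_empty_or_nonempty with rfl | ⟨x0, hx0⟩
  · exact ⟨0, by simp, by simp⟩
  · exact HL.of_starConvex hx0 (hX hx0) hg h0

theorem continuousOn_inv_image {α β : Type*} [TopologicalSpace α] [TopologicalSpace β] [T2Space β]
    {S : Set α} {c : α → β} {d : β → α} (hS : IsCompact S) (hc : ContinuousOn c S)
    (hd : ∀ x ∈ S, d (c x) = x) : ContinuousOn d (c '' S) := by
  rw [continuousOn_iff_isClosed]
  intro t ht
  refine ⟨c '' (S ∩ t), ((hS.inter_right ht).image_of_continuousOn
    (hc.mono inter_subset_left)).isClosed, ?_⟩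
  ext y
  constructor
  · rintro ⟨hy, x, hx, rfl⟩
    rw [mem_preimage, hd x hx] at hy
    exact ⟨⟨x, ⟨hx, hy⟩, rfl⟩, ⟨x, hx, rfl⟩⟩
  · rintro ⟨⟨x, ⟨hx, hxt⟩, rfl⟩, hh⟩
    exact ⟨by rwa [mem_preimage, hd x hx], hh⟩

theorem HL.image {α β : Type*} [TopologicalSpace α] [TopologicalSpace β] [T2Space β]
    {S : Set α} {c : α → β} {g : β → ℂ} (hS : IsCompact S) (hc : ContinuousOn c S)
    (hi : InjOn c S) (h : HL S (fun x => g (c x))) : HL (c '' S) g := by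
  rcases S.eq_empty_or_nonempty with rfl | ⟨x0, hx0⟩
  · exact ⟨0, by simp, by simp⟩
  have : Nonempty α := ⟨x0⟩
  have hd : ∀ x ∈ S, Function.invFunOn c S (c x) = x := fun x hx => hi.leftInvOn_invFunOn hx
  have := h.comp (continuousOn_inv_image hS hc hd) (Z := c '' S) (by
    rintro _ ⟨x, hx, rfl⟩; rw [hd x hx]; exact hx)
  refine this.congr ?_
  rintro _ ⟨x, hx, rfl⟩
  simp only [hd x hx]

theorem not_HL_sphere {a : ℂ} {r : ℝ} (hr : 0 < r) {n : ℤ} (hn : n ≠ 0) :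
    ¬ HL (sphere a r) (fun z => (z - a) ^ n) := by
  intro h
  have h1 := h.comp (Z := (univ : Set ℝ)) (c := fun t : ℝ => a + r * Complex.exp (t * I))
    (by fun_prop) (fun t _ => by simp [norm_exp_ofReal_mul_I, abs_of_pos hr])
  obtain ⟨l, hl, hl'⟩ := h
  set c := fun t : ℝ => a + r * Complex.exp (t * I) with hc
  have hcs : ∀ t, c t ∈ sphere a r := fun t => by
    simp [hc, norm_exp_ofReal_mul_I, abs_of_pos hr]
  have hcc : Continuous c := by fun_prop
  have hrr : (r : ℂ) ≠ 0 := by exact_mod_cast hr.ne'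
  obtain ⟨m, hm⟩ := log_diff_const (X := (univ : Set ℝ)) isPreconnected_univ
    (l := fun t => l (c t)) (l' := fun t : ℝ => n * (Complex.log r + t * I))
    (hl.comp hcc.continuousOn fun t _ => hcs t) (by fun_prop) (fun t _ => by
      rw [hl' _ (hcs t), exp_int_mul, exp_add, exp_log hrr]
      simp [hc])
  have e : c (2 * π) = c 0 := by simp [hc, Complex.exp_two_pi_mul_I]
  have h2 := hm (2 * π) trivial
  have h3 := hm 0 trivial
  rw [e, h3] at h2
  have : (n : ℂ) * (2 * π * I) = 0 := by
    push_cast at h2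
    linear_combination -h2
  simp [Real.pi_ne_zero, hn] at this

theorem joinedIn_iff_comp {U : Set ℂ} (hU : IsOpen U) {p q : ℂ} (hp : p ∈ U) :
    JoinedIn U p q ↔ q ∈ connectedComponentIn U p := by
  constructor
  · intro h
    have h1 := (isPathConnected_pathComponentIn hp).isConnected.isPreconnected
    exact h1.subset_connectedComponentIn (mem_pathComponentIn_self hp) pathComponentIn_subset h
  · intro h
    have h1 : IsPathConnected (connectedComponentIn U p) :=
      hU.connectedComponentIn.isConnected_iff_isPathConnected.1
        (isConnected_connectedComponentIn_iff.2 hp)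
    exact (h1.joinedIn p (mem_connectedComponentIn hp) q h).mono (connectedComponentIn_subset _ _)

theorem frontier_comp_subset {X : Set ℂ} (hX : IsClosed X) (p : ℂ) :
    frontier (connectedComponentIn Xᶜ p) ⊆ X := by
  intro x hx
  by_contra hxX
  have ho : IsOpen (connectedComponentIn Xᶜ p) := hX.isOpen_compl.connectedComponentIn
  have ho' : IsOpen (connectedComponentIn Xᶜ x) := hX.isOpen_compl.connectedComponentIn
  rw [ho.frontier_eq] at hx
  obtain ⟨y, hy1, hy2⟩ := mem_closure_iff.1 hx.1 _ ho' (mem_connectedComponentIn hxX)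
  apply hx.2
  rw [connectedComponentIn_eq hy2, ← connectedComponentIn_eq hy1]
  exact mem_connectedComponentIn hxX

theorem isPreconnected_norm_gt {R : ℝ} (hR : 0 < R) : IsPreconnected {z : ℂ | R < ‖z‖} := by
  have : {z : ℂ | R < ‖z‖} = Complex.exp '' {w : ℂ | Real.log R < w.re} := by
    ext z
    constructor
    · intro hz
      have hz' : R < ‖z‖ := hz
      have h0 : z ≠ 0 := norm_pos_iff.1 (hR.trans hz')
      exact ⟨Complex.log z, by simpa [log_re] using Real.log_lt_log hR hz',
        exp_log h0⟩
    · rintro ⟨w, hw, rfl⟩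
      simp only [mem_ofPred_eq, Complex.norm_exp]
      exact (Real.log_lt_iff_lt_exp hR).1 hw
  rw [this]
  exact ((convex_halfSpace_re_gt _).isPreconnected).image _ continuous_exp.continuousOn

theorem comp_unbdd_eq {X : Set ℂ} (hX : Bornology.IsBounded X) {p q : ℂ}
    (hp : ¬ Bornology.IsBounded (connectedComponentIn Xᶜ p))
    (hq : ¬ Bornology.IsBounded (connectedComponentIn Xᶜ q)) :
    connectedComponentIn Xᶜ p = connectedComponentIn Xᶜ q := by
  obtain ⟨R, hR0, hR⟩ := hX.exists_pos_norm_le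
  have key : ∀ p, ¬ Bornology.IsBounded (connectedComponentIn Xᶜ p) →
      ∃ x ∈ connectedComponentIn Xᶜ p, R < ‖x‖ := by
    intro p hp
    by_contra! h
    exact hp (isBounded_iff_forall_norm_le.2 ⟨R, h⟩)
  obtain ⟨x, hx, hxR⟩ := key p hp
  obtain ⟨y, hy, hyR⟩ := key q hq
  have hs : {z : ℂ | R < ‖z‖} ⊆ Xᶜ := fun z hz hzX => (lt_irrefl _ (lt_of_lt_of_le hz (hR z hzX)))
  have := (isPreconnected_norm_gt hR0).subset_connectedComponentIn (x := x) hxR hs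
  rw [connectedComponentIn_eq hx, connectedComponentIn_eq hy]
  exact connectedComponentIn_eq (this hyR)

theorem HL.of_joined {X : Set ℂ} {p q : ℂ} (h : JoinedIn Xᶜ p q) :
    HL X (fun z => (z - p) / (z - q)) := by
  obtain ⟨γ, hγ⟩ := h.symm
  have h1 : ∀ t : ℝ, ∀ x ∈ X, x - γ.extend t ≠ 0 := by
    intro t x hx h
    rw [sub_eq_zero] at h
    have : γ.extend t ∈ Xᶜ := by
      have hm : γ.extend t ∈ range γ.extend := ⟨t, rfl⟩
      rw [Path.extend_range] at hm
      obtain ⟨s, hs⟩ := hm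
      rw [← hs]; exact hγ s
    exact this (h ▸ hx)
  have hq : ∀ x ∈ X, x - q ≠ 0 := fun x hx => by simpa using h1 0 x hx
  have := HL.homotopy (X := X) (H := fun t z => (z - γ.extend t) / (z - q)) ?_
    (fun t _ x hx => div_ne_zero (h1 t x hx) (hq x hx)) ?_
  · simpa using this
  · refine ContinuousOn.div (by fun_prop) (by fun_prop) ?_
    rintro ⟨t, x⟩ ⟨_, hx⟩
    exact hq x hx
  · refine (HL.const one_ne_zero).congr fun z hz => ?_
    simp [div_self (hq z hz)]

theorem HL.of_far {X : Set ℂ} {R : ℝ} (hX : ∀ z ∈ X, ‖z‖ ≤ R) {p : ℂ} (hp : R < ‖p‖) :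
    HL X (fun z => z - p) := by
  rcases X.eq_empty_or_nonempty with rfl | ⟨x, hx⟩
  · exact ⟨0, by simp, by simp⟩
  refine HL.of_near (g := fun _ => -p) (HL.const ?_) (by fun_prop) ?_
  · intro h
    have := hX x hx
    have h2 := norm_nonneg x
    rw [neg_eq_zero] at h; rw [h, norm_zero] at hp; linarith
  · intro z hz
    simpa using (hX z hz).trans_lt hp

theorem HL.of_unbdd {X : Set ℂ} (hX : IsCompact X) {p : ℂ}
    (hp : ¬ Bornology.IsBounded (connectedComponentIn Xᶜ p)) : HL X (fun z => z - p) := by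
  obtain ⟨R, hR0, hR⟩ := hX.isBounded.exists_pos_norm_le
  have : ∃ x ∈ connectedComponentIn Xᶜ p, R < ‖x‖ := by
    by_contra! h
    exact hp (isBounded_iff_forall_norm_le.2 ⟨R, h⟩)
  obtain ⟨q, hq, hqR⟩ := this
  have hpX : p ∈ Xᶜ := by
    by_contra h
    rw [connectedComponentIn_eq_empty h] at hq
    exact hq
  have h1 := HL.of_joined ((joinedIn_iff_comp hX.isClosed.isOpen_compl hpX).2 hq)
  have h2 := HL.of_far hR hqR
  exact (h1.mul h2).congr fun z hz => (div_mul_cancel₀ _ (h2.ne_zero hz)).symm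

theorem glue_HL {X W : Set ℂ} (hX : IsClosed X) (hWX : frontier W ⊆ X)
    {l g1 g2 : ℂ → ℂ} (hl : ContinuousOn l X) (h1 : ContinuousOn g1 (closure Wᶜ))
    (h1' : ∀ z ∉ W, g1 z ≠ 0) (h2 : ContinuousOn g2 (closure W)) (h2' : ∀ z ∈ W, g2 z ≠ 0)
    (hh : ∀ z ∈ frontier W, g1 z = g2 z * Complex.exp (l z)) : HL Wᶜ g1 := by
  classical
  obtain ⟨L, hL⟩ := ContinuousMap.exists_restrict_eq hX
    ⟨X.domRestrict l, continuousOn_iff_continuous_domRestrict.1 hl⟩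
  have hL' : ∀ z ∈ X, L z = l z := fun z hz => by
    have := DFunLike.congr_fun hL ⟨z, hz⟩
    simpa using! this
  set g : ℂ → ℂ := fun z => if z ∈ W then g2 z * Complex.exp (L z) else g1 z with hg
  have hgc : Continuous g := by
    refine continuous_if ?_ ?_ ?_
    · intro z hz
      have hz' : z ∈ frontier W := hz
      rw [hL' z (hWX hz'), hh z hz']
    · exact h2.mul (by fun_prop)
    · exact h1
  have hg0 : ∀ z ∈ (univ : Set ℂ), g z ≠ 0 := by
    intro z _
    simp only [hg]
    split_ifs with h
    · exact mul_ne_zero (h2' z h) (exp_ne_zero _)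
    · exact h1' z h
  refine ((HL.of_convex convex_univ hgc.continuousOn hg0).mono (subset_univ _)).congr ?_
  intro z hz
  have hz' : z ∉ W := hz
  simp [hg, hz']

theorem not_HL_compl {W : Set ℂ} (hW : Bornology.IsBounded W) {a : ℂ} {n : ℤ} (hn : n ≠ 0) :
    ¬ HL Wᶜ (fun z => (z - a) ^ n) := by
  intro h
  obtain ⟨R, hR⟩ := hW.subset_closedBall a
  refine not_HL_sphere (a := a) (r := max R 0 + 1) (by positivity) hn (h.mono ?_)
  intro z hz hzW
  have h1 := hR hzW
  rw [mem_sphere] at hz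
  rw [mem_closedBall, hz] at h1
  linarith [le_max_left R 0]

theorem eil_aux {X : Set ℂ} (hX : IsCompact X) {p q : ℂ} (hp : p ∉ X) (hq : q ∉ X)
    (hb : Bornology.IsBounded (connectedComponentIn Xᶜ p)) (hne : q ∉ connectedComponentIn Xᶜ p)
    (h : HL X (fun z => (z - p) / (z - q))) : False := by
  obtain ⟨l, hl, hl'⟩ := h
  have := glue_HL hX.isClosed (frontier_comp_subset hX.isClosed p) hl (g1 := fun z => z - p)
    (g2 := fun z => z - q) (by fun_prop) ?_ (by fun_prop) ?_ ?_
  · exact not_HL_compl hb (a := p) one_ne_zero (by simpa using this)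
  · intro z hz h
    rw [sub_eq_zero] at h
    exact hz (by rw [h]; exact mem_connectedComponentIn hp)
  · intro z hz h
    rw [sub_eq_zero] at h
    exact hne (h ▸ hz)
  · intro z hz
    have hzX := frontier_comp_subset hX.isClosed p hz
    rw [hl' z hzX, mul_div_cancel₀]
    intro h
    rw [sub_eq_zero] at h
    exact hq (h ▸ hzX)

theorem joined_of_HL {X : Set ℂ} (hX : IsCompact X) {p q : ℂ} (hp : p ∉ X) (hq : q ∉ X)
    (h : HL X (fun z => (z - p) / (z - q))) : JoinedIn Xᶜ p q := by
  rw [joinedIn_iff_comp hX.isClosed.isOpen_compl hp]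
  by_contra hne
  by_cases hb : Bornology.IsBounded (connectedComponentIn Xᶜ p)
  · exact eil_aux hX hp hq hb hne h
  by_cases hb' : Bornology.IsBounded (connectedComponentIn Xᶜ q)
  · refine eil_aux hX hq hp hb' ?_ (h.inv.congr fun z _ => by simp)
    intro hh
    apply hne
    rw [← connectedComponentIn_eq hh]
    exact mem_connectedComponentIn hq
  · apply hne
    rw [comp_unbdd_eq hX.isBounded hb hb']
    exact mem_connectedComponentIn hq

theorem bdd_of_not_HL {X : Set ℂ} (hX : IsCompact X) {p : ℂ} (h : ¬ HL X (fun z => z - p)) :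
    Bornology.IsBounded (connectedComponentIn Xᶜ p) := by
  by_contra hb
  exact h (HL.of_unbdd hX hb)

theorem unbdd_of_HL {X : Set ℂ} (hX : IsCompact X) {p : ℂ} (hp : p ∉ X)
    (h : HL X (fun z => z - p)) : ¬ Bornology.IsBounded (connectedComponentIn Xᶜ p) := by
  intro hb
  obtain ⟨R, hR⟩ := (hb.union hX.isBounded).subset_ball 0
  have hRX : ∀ z ∈ X, ‖z‖ ≤ R := fun z hz => by simpa using (mem_ball.1 (hR (Or.inr hz))).le
  have hR0 : 0 ≤ R := by
    have := (mem_ball.1 (hR (Or.inl (mem_connectedComponentIn hp))))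
    exact dist_nonneg.trans this.le
  have hq : R < ‖((R + 1 : ℝ) : ℂ)‖ := by
    rw [norm_real, norm_eq_abs]; exact (lt_add_one R).trans_le (le_abs_self _)
  have h2 := HL.of_far hRX hq
  refine eil_aux hX hp (fun hX' => ?_) hb (fun hX' => ?_) (h.div h2)
  · exact absurd (hRX _ hX') (not_le.2 hq)
  · have := (mem_ball.1 (hR (Or.inl hX')))
    rw [dist_zero_right] at this
    exact absurd this (not_lt.2 hq.le)

theorem janiszewski {X Y : Set ℂ} (hX : IsCompact X) (hY : IsCompact Y)
    (hc : IsPreconnected (X ∩ Y)) {p q : ℂ} (h1 : JoinedIn Xᶜ p q) (h2 : JoinedIn Yᶜ p q) :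
    JoinedIn (X ∪ Y)ᶜ p q := by
  refine joined_of_HL (hX.union hY) ?_ ?_ (HL.union hX.isClosed hY.isClosed hc
    (HL.of_joined h1) (HL.of_joined h2))
  · rintro (h | h)
    · exact h1.source_mem h
    · exact h2.source_mem h
  · rintro (h | h)
    · exact h1.target_mem h
    · exact h2.target_mem h

theorem exists_delta_near {α : Type*} [PseudoMetricSpace α] {K : Set α} (hK : IsCompact K)
    {φ : α → ℂ} (hφ : ContinuousOn φ K) (h0 : ∀ z ∈ K, φ z ≠ 0) :
    ∃ δ > 0, ∀ x ∈ K, ∀ y ∈ K, dist x y < δ → ‖φ x - φ y‖ < ‖φ y‖ := by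
  rcases K.eq_empty_or_nonempty with rfl | hne
  · exact ⟨1, one_pos, by simp⟩
  obtain ⟨z0, hz0, hmin⟩ := hK.exists_isMinOn hne hφ.norm
  have h1 : 0 < ‖φ z0‖ := norm_pos_iff.2 (h0 z0 hz0)
  obtain ⟨δ, hδ, h⟩ := Metric.uniformContinuousOn_iff.1 (hK.uniformContinuousOn_of_continuous hφ)
    _ h1
  refine ⟨δ, hδ, fun x hx y hy hxy => ?_⟩
  have := h x hx y hy hxy
  rw [dist_eq_norm] at this
  exact this.trans_le (hmin hy)

theorem HL_real {S : Set ℝ} (hS : IsCompact S) {g : ℝ → ℂ} (hg : ContinuousOn g S)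
    (h0 : ∀ y ∈ S, g y ≠ 0) : HL S g := by
  obtain ⟨δ, hδ, hnear⟩ := exists_delta_near hS hg h0
  obtain ⟨R, hR0, hR⟩ := hS.isBounded.exists_pos_norm_le
  have step : ∀ n : ℕ, HL (S ∩ Iic (-R - 1 + n * (δ / 2))) g := by
    intro n
    induction n with
    | zero =>
      have : S ∩ Iic (-R - 1 + (0 : ℕ) * (δ / 2)) = ∅ := by
        ext y
        simp only [mem_inter_iff, mem_Iic, mem_empty_iff_false, iff_false, not_and, not_le]
        intro hy
        have := (abs_le.1 (hR y hy)).1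
        simp; linarith
      rw [this]; exact ⟨0, by simp, by simp⟩
    | succ n ih =>
      set s := -R - 1 + n * (δ / 2) with hs
      have e : -R - 1 + (n + 1 : ℕ) * (δ / 2) = s + δ / 2 := by push_cast; ring
      rw [e]
      have h2 : HL (S ∩ Icc s (s + δ / 2)) g := by
        rcases (S ∩ Icc s (s + δ / 2)).eq_empty_or_nonempty with h | ⟨y0, hy0, hy0'⟩
        · rw [h]; exact ⟨0, by simp, by simp⟩
        · refine HL.of_near (HL.const (h0 y0 hy0)) (hg.mono inter_subset_left) ?_
          rintro y ⟨hy, hy'⟩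
          refine hnear y hy y0 hy0 ?_
          rw [dist_eq, abs_lt]
          constructor <;> linarith [hy'.1, hy'.2, hy0'.1, hy0'.2]
      have := HL.union (hS.isClosed.inter isClosed_Iic) (hS.isClosed.inter isClosed_Icc) ?_ ih h2
      · refine this.mono ?_
        rintro y ⟨hy, hy'⟩
        rcases le_total y s with h | h
        · exact Or.inl ⟨hy, h⟩
        · exact Or.inr ⟨hy, h, hy'⟩
      · apply Set.Subsingleton.isPreconnected
        rintro x ⟨⟨_, h1⟩, ⟨_, h2⟩⟩ y ⟨⟨_, h3⟩, ⟨_, h4⟩⟩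
        exact (le_antisymm h1 h2.1).trans (le_antisymm h4.1 h3)
  obtain ⟨n, hn⟩ := exists_nat_gt ((2 * R + 1) / (δ / 2))
  refine (step n).mono fun y hy => ⟨hy, ?_⟩
  have := (abs_le.1 (hR y hy)).2
  rw [div_lt_iff₀ (by positivity)] at hn
  simp only [mem_Iic]; linarith

theorem HL_strip {K : Set ℂ} (hK : IsCompact K) {φ : ℂ → ℂ} (hφ : ContinuousOn φ K)
    (h0 : ∀ z ∈ K, φ z ≠ 0) :
    ∃ δ > 0, ∀ c : ℝ, HL (K ∩ {z | c ≤ z.re ∧ z.re ≤ c + δ}) φ := by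
  rcases K.eq_empty_or_nonempty with rfl | hne
  · exact ⟨1, one_pos, fun c => ⟨0, by simp, by simp⟩⟩
  obtain ⟨z0, hz0, hmin⟩ := hK.exists_isMinOn hne hφ.norm
  have hη : 0 < ‖φ z0‖ := norm_pos_iff.2 (h0 z0 hz0)
  obtain ⟨Φ, hΦ⟩ := ContinuousMap.exists_restrict_eq hK.isClosed
    ⟨K.domRestrict φ, continuousOn_iff_continuous_domRestrict.1 hφ⟩
  have hΦ' : ∀ z ∈ K, Φ z = φ z := fun z hz => by
    have := DFunLike.congr_fun hΦ ⟨z, hz⟩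
    simpa using! this
  obtain ⟨R, hR0, hR⟩ := hK.isBounded.exists_pos_norm_le
  obtain ⟨δ, hδ, h⟩ := Metric.uniformContinuousOn_iff.1
    ((isCompact_closedBall (0:ℂ) (R + 1)).uniformContinuousOn_of_continuous Φ.continuous.continuousOn)
    _ (half_pos hη)
  refine ⟨min 1 (δ / 2), by positivity, fun c => ?_⟩
  set A := K ∩ {z | c ≤ z.re ∧ z.re ≤ c + min 1 (δ / 2)} with hA
  have hAc : IsCompact A := by
    refine hK.inter_right ?_
    exact (isClosed_le continuous_const continuous_re).inter
      (isClosed_le continuous_re continuous_const)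
  have key : ∀ z ∈ A, ‖φ z - Φ (c + z.im * I)‖ < ‖φ z0‖ / 2 := by
    rintro z ⟨hz, hz1, hz2⟩
    have hd : ‖z - (c + z.im * I)‖ = z.re - c := by
      have : z - (c + z.im * I) = ((z.re - c : ℝ) : ℂ) := by
        apply Complex.ext <;> simp
      rw [this, norm_real, norm_eq_abs, abs_of_nonneg (by linarith)]
    have := h z (by simpa using (hR z hz).trans (by linarith)) (c + z.im * I) ?_ ?_
    · rwa [hΦ' z hz, dist_eq_norm] at this
    · rw [mem_closedBall, dist_zero_right]
      calc ‖(c : ℂ) + z.im * I‖ = ‖z - (z - (c + z.im * I))‖ := by congr 1; ring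
        _ ≤ ‖z‖ + ‖z - (c + z.im * I)‖ := norm_sub_le _ _
        _ ≤ R + 1 := by
          rw [hd]; linarith [hR z hz, min_le_left (1:ℝ) (δ/2)]
    · rw [dist_eq_norm, hd]; linarith [min_le_right (1:ℝ) (δ/2)]
  have key2 : ∀ z ∈ A, ‖φ z0‖ / 2 < ‖Φ (c + z.im * I)‖ := by
    intro z hz
    have h1 := key z hz
    have h2 : ‖φ z0‖ ≤ ‖φ z‖ := hmin hz.1
    have h3 := norm_sub_norm_le (φ z) (Φ (c + z.im * I))
    linarith
  have h1 : HL (Complex.im '' A) (fun y : ℝ => Φ (c + y * I)) := by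
    refine HL_real (hAc.image continuous_im) (by fun_prop) ?_
    rintro _ ⟨z, hz, rfl⟩
    exact norm_pos_iff.1 ((half_pos hη).trans (key2 z hz))
  have h2 := h1.comp (Z := A) continuous_im.continuousOn (fun z hz => ⟨z, hz, rfl⟩)
  exact h2.of_near (hφ.mono inter_subset_left) fun z hz => (key z hz).trans (key2 z hz)

theorem line_glue {K K1 K2 : Set ℂ} {c : ℝ} (hK : IsCompact K)
    (hKp : ∀ p ∉ K, HL K (fun z => z - p)) (h1 : K1 ⊆ K) (h2 : K2 ⊆ K) (hc1 : IsClosed K1)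
    (hc2 : IsClosed K2) (hr1 : ∀ z ∈ K1, z.re ≤ c) (hr2 : ∀ z ∈ K2, c ≤ z.re)
    (hline : ∀ z ∈ K, z.re = c → z ∈ K1 ∧ z ∈ K2) {φ : ℂ → ℂ} (hφ1 : HL K1 φ) (hφ2 : HL K2 φ) :
    HL (K1 ∪ K2) φ := by
  classical
  obtain ⟨l1, hl1, he1⟩ := hφ1
  obtain ⟨l2, hl2, he2⟩ := hφ2
  set e : ℝ → ℂ := fun y => c + y * I with he
  have hec : Continuous e := by fun_prop
  set S : Set ℝ := e ⁻¹' K with hS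
  have hre : ∀ y, (e y).re = c := fun y => by simp [he]
  have him : ∀ y, (e y).im = y := fun y => by simp [he]
  have hS1 : ∀ y ∈ S, e y ∈ K1 := fun y hy => (hline _ hy (hre y)).1
  have hS2 : ∀ y ∈ S, e y ∈ K2 := fun y hy => (hline _ hy (hre y)).2
  obtain ⟨R, hR0, hR⟩ := hK.isBounded.exists_pos_norm_le
  have hSR : ∀ y ∈ S, |y| ≤ R := fun y hy => by
    have := (abs_im_le_norm (e y)).trans (hR _ hy)
    rwa [him] at this
  have hSc : IsCompact S := by
    refine Metric.isCompact_of_isClosed_isBounded (hK.isClosed.preimage hec) ?_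
    exact isBounded_iff_forall_norm_le.2 ⟨R, hSR⟩
  have hDc : ∀ l1 l2 : ℂ → ℂ, ContinuousOn l1 K1 → ContinuousOn l2 K2 →
      ContinuousOn (fun y => l1 (e y) - l2 (e y)) S := fun l1 l2 hl1 hl2 =>
    (hl1.comp hec.continuousOn hS1).sub (hl2.comp hec.continuousOn hS2)
  have hDe : ∀ l1 l2 : ℂ → ℂ, (∀ z ∈ K1, Complex.exp (l1 z) = φ z) →
      (∀ z ∈ K2, Complex.exp (l2 z) = φ z) → ∀ y ∈ S, Complex.exp (l1 (e y) - l2 (e y)) = 1 := by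
    intro l1 l2 h1 h2 y hy
    rw [exp_sub, h1 _ (hS1 y hy), ← h2 _ (hS2 y hy), div_self (exp_ne_zero _)]
  obtain ⟨δ, hδ, hunif⟩ := Metric.uniformContinuousOn_iff.1
    (hSc.uniformContinuousOn_of_continuous (hDc l1 l2 hl1 hl2)) 1 one_pos
  have step : ∀ n : ℕ, ∃ l1 l2 : ℂ → ℂ, ContinuousOn l1 K1 ∧ ContinuousOn l2 K2 ∧
      (∀ z ∈ K1, Complex.exp (l1 z) = φ z) ∧ (∀ z ∈ K2, Complex.exp (l2 z) = φ z) ∧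
      (∀ y ∈ S, y ≤ -R - 1 + n * (δ / 2) → l1 (e y) = l2 (e y)) ∧
      (∀ y ∈ S, ∀ y' ∈ S, -R - 1 + n * (δ / 2) < y → -R - 1 + n * (δ / 2) < y' → dist y y' < δ →
        l1 (e y) - l2 (e y) = l1 (e y') - l2 (e y')) := by
    intro n
    induction n with
    | zero =>
      refine ⟨l1, l2, hl1, hl2, he1, he2, fun y hy hle => ?_, fun y hy y' hy' _ _ hd => ?_⟩
      · exfalso
        have := (abs_le.1 (hSR y hy)).1
        simp at hle; linarith
      · have := hunif y hy y' hy' hd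
        rw [dist_eq_norm] at this
        exact exp_eq_exp_dist (by rw [hDe l1 l2 he1 he2 y hy, hDe l1 l2 he1 he2 y' hy']) this
    | succ n ih =>
      obtain ⟨m1, m2, hm1, hm2, hme1, hme2, hag, hloc⟩ := ih
      set s := -R - 1 + n * (δ / 2) with hs
      have e' : -R - 1 + (n + 1 : ℕ) * (δ / 2) = s + δ / 2 := by push_cast; ring
      rw [e']
      by_cases hbad : ∃ y1 ∈ S, s < y1 ∧ y1 ≤ s + δ / 2 ∧ m1 (e y1) ≠ m2 (e y1)
      swap
      · push Not at hbad
        refine ⟨m1, m2, hm1, hm2, hme1, hme2, fun y hy hle => ?_, fun y hy y' hy' h1 h2 hd => ?_⟩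
        · rcases le_or_gt y s with h | h
          · exact hag y hy h
          · exact hbad y hy h hle
        · exact hloc y hy y' hy' (by linarith) (by linarith) hd
      obtain ⟨y1, hy1S, hy1, hy1', hne⟩ := hbad
      obtain ⟨k, hk⟩ := Complex.exp_eq_one_iff.1 (hDe m1 m2 hme1 hme2 y1 hy1S)
      have hconst : ∀ y ∈ S, s < y → y ≤ s + δ / 2 →
          m1 (e y) - m2 (e y) = k * (2 * π * I) := by
        intro y hy h h'
        rw [← hk]
        refine hloc y hy y1 hy1S h hy1 ?_
        rw [dist_eq, abs_lt]; constructor <;> linarith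
      have hp : ∃ p, p ∉ S ∧ (∀ y ∈ S, y ≤ s → y < p) ∧ (∀ y ∈ S, s < y → p < y) := by
        by_cases hsS : s ∈ S
        swap
        · exact ⟨s, hsS, fun y hy h => lt_of_le_of_ne h fun h' => hsS (h' ▸ hy), fun y _ h => h⟩
        obtain ⟨ε, hε, hcont⟩ := Metric.continuousWithinAt_iff.1 (hDc m1 m2 hm1 hm2 s hsS) 1 one_pos
        have hno : ∀ y ∈ S, s < y → s + min ε (δ / 2) ≤ y := by
          intro y hy h
          by_contra! h'
          have h3 := hcont hy (by
            rw [dist_eq, abs_lt]; constructor <;> linarith [min_le_left ε (δ / 2)])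
          rw [dist_eq_norm] at h3
          have h4 := exp_eq_exp_dist (by
            rw [hDe m1 m2 hme1 hme2 y hy, hDe m1 m2 hme1 hme2 s hsS]) h3
          rw [hag s hsS le_rfl, sub_self, hconst y hy h (by linarith [min_le_right ε (δ / 2)])] at h4
          rw [h4] at hk
          exact hne (sub_eq_zero.1 hk)
        have hmpos : 0 < min ε (δ / 2) := by positivity
        refine ⟨s + min ε (δ / 2) / 2, fun h => ?_, fun y hy h => by linarith, fun y hy h => ?_⟩
        · have := hno _ h (by linarith); linarith
        · have := hno _ hy h; linarith
      obtain ⟨p, hpS, hp1, hp2⟩ := hp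
      obtain ⟨lam, hlam, hlame⟩ := hKp (e p) hpS
      set N1 : ℂ → ℂ := fun z => lam z - (Complex.log (-(z - e p)) + π * I) with hN1
      set N2 : ℂ → ℂ := fun z => lam z - Complex.log (z - e p) with hN2
      have hneK : ∀ z ∈ K, z - e p ≠ 0 := fun z hz h => hpS (by
        rw [sub_eq_zero] at h; rw [hS, mem_preimage, ← h]; exact hz)
      have hslit : ∀ z : ℂ, z ≠ 0 → 0 ≤ z.re → z ∈ Complex.slitPlane := by
        intro z hz hre
        rcases hre.lt_or_eq with h | h
        · exact Or.inl h
        · right; intro h'; exact hz (Complex.ext h.symm h')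
      have hN1c : ContinuousOn N1 K1 := by
        refine (hlam.mono h1).sub (ContinuousOn.add (ContinuousOn.clog (by fun_prop) ?_)
          continuousOn_const)
        intro z hz
        refine hslit _ (neg_ne_zero.2 (hneK z (h1 hz))) ?_
        have := hr1 z hz
        simp [hre]; linarith
      have hN2c : ContinuousOn N2 K2 := by
        refine (hlam.mono h2).sub (ContinuousOn.clog (by fun_prop) ?_)
        intro z hz
        refine hslit _ (hneK z (h2 hz)) ?_
        have := hr2 z hz
        simp [hre]; linarith
      have hN1e : ∀ z ∈ K1, Complex.exp (N1 z) = 1 := by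
        intro z hz
        have h0 := hneK z (h1 hz)
        simp only [hN1, exp_sub, exp_add, hlame z (h1 hz),
          exp_log (neg_ne_zero.2 h0), exp_pi_mul_I]
        field_simp
      have hN2e : ∀ z ∈ K2, Complex.exp (N2 z) = 1 := by
        intro z hz
        have h0 := hneK z (h2 hz)
        simp only [hN2, exp_sub, hlame z (h2 hz), exp_log h0, div_self h0]
      have hsub : ∀ y, e y - e p = (y - p : ℝ) * I := fun y => by
        simp only [he]; push_cast; ring
      have hNgt : ∀ y, p < y → N1 (e y) = N2 (e y) := by
        intro y hy
        have h3 : 0 < y - p := by linarith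
        simp only [hN1, hN2, hsub]
        rw [log_ofReal_mul h3 I_ne_zero, ← mul_neg,
          log_ofReal_mul h3 (neg_ne_zero.2 I_ne_zero), Complex.log_I,
          Complex.log_neg_I]
        ring
      have hNlt : ∀ y, y < p → N1 (e y) - N2 (e y) = - (2 * π * I) := by
        intro y hy
        have h3 : 0 < p - y := by linarith
        have h4 : ((y - p : ℝ) : ℂ) * I = (p - y : ℝ) * (- I) := by push_cast; ring
        have h5 : -(((y - p : ℝ) : ℂ) * I) = (p - y : ℝ) * I := by push_cast; ring
        simp only [hN1, hN2, hsub]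
        rw [h5, h4, log_ofReal_mul h3 I_ne_zero,
          log_ofReal_mul h3 (neg_ne_zero.2 I_ne_zero), Complex.log_I,
          Complex.log_neg_I]
        ring
      have hD' : ∀ y, s < y → y ∈ S → (m1 (e y) - k * N1 (e y) - k * (2 * π * I)) -
          (m2 (e y) - k * N2 (e y)) = m1 (e y) - m2 (e y) - k * (2 * π * I) := by
        intro y hy hyS
        rw [hNgt y (hp2 y hyS hy)]; ring
      refine ⟨fun z => m1 z - k * N1 z - k * (2 * π * I), fun z => m2 z - k * N2 z,
        (hm1.sub (continuousOn_const.mul hN1c)).sub continuousOn_const,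
        hm2.sub (continuousOn_const.mul hN2c), ?_, ?_, ?_, ?_⟩
      · intro z hz
        rw [exp_sub, exp_sub, hme1 z hz, exp_int_mul, hN1e z hz,
          exp_int_mul_two_pi_mul_I]
        simp
      · intro z hz
        rw [exp_sub, hme2 z hz, exp_int_mul, hN2e z hz]
        simp
      · intro y hy hle
        rcases le_or_gt y s with h | h
        · have h3 := hag y hy h
          have h4 := hNlt y (hp1 y hy h)
          linear_combination h3 - k * h4
        · have h3 := hconst y hy h hle
          have h4 := hNgt y (hp2 y hy h)
          linear_combination h3 - k * h4
      · intro y hy y' hy' h3 h4 hd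
        simp only
        rw [hD' y (by linarith) hy, hD' y' (by linarith) hy',
          hloc y hy y' hy' (by linarith) (by linarith) hd]
  obtain ⟨n, hn⟩ := exists_nat_gt ((2 * R + 1) / (δ / 2))
  obtain ⟨m1, m2, hm1, hm2, hme1, hme2, hag, -⟩ := step n
  rw [div_lt_iff₀ (by positivity)] at hn
  have hagree : ∀ z ∈ K1, z ∈ K2 → m1 z = m2 z := by
    intro z hz1 hz2
    have hzc : z.re = c := le_antisymm (hr1 z hz1) (hr2 z hz2)
    have hz : e z.im = z := by simp only [he]; apply Complex.ext <;> simp [hzc]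
    have hzS : z.im ∈ S := by rw [hS, mem_preimage, hz]; exact h1 hz1
    have := hag z.im hzS (by linarith [(abs_le.1 (hSR _ hzS)).2])
    rwa [hz] at this
  have e1 : EqOn (K1.piecewise m1 m2) m1 K1 := fun z hz => by simp [hz]
  have e2 : EqOn (K1.piecewise m1 m2) m2 K2 := fun z hz => by
    by_cases hx : z ∈ K1
    · simp [hx, hagree z hx hz]
    · simp [hx]
  refine ⟨_, ContinuousOn.union_of_isClosed (hm1.congr e1) (hm2.congr e2) hc1 hc2, ?_⟩
  rintro z (hz | hz)
  · rw [e1 hz, hme1 z hz]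
  · rw [e2 hz, hme2 z hz]

theorem borsuk {K : Set ℂ} (hK : IsCompact K) (hKp : ∀ p ∉ K, HL K (fun z => z - p)) {φ : ℂ → ℂ}
    (hφ : ContinuousOn φ K) (h0 : ∀ z ∈ K, φ z ≠ 0) : HL K φ := by
  obtain ⟨δ, hδ, hstrip⟩ := HL_strip hK hφ h0
  obtain ⟨R, hR0, hR⟩ := hK.isBounded.exists_pos_norm_le
  have cl1 : ∀ s : ℝ, IsClosed (K ∩ {z | z.re ≤ s}) := fun s =>
    hK.isClosed.inter (isClosed_le continuous_re continuous_const)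
  have step : ∀ n : ℕ, HL (K ∩ {z | z.re ≤ -R - 1 + n * δ}) φ := by
    intro n
    induction n with
    | zero =>
      have : K ∩ {z | z.re ≤ -R - 1 + (0 : ℕ) * δ} = ∅ := by
        ext y
        simp only [mem_inter_iff, mem_ofPred_eq, mem_empty_iff_false, iff_false, not_and, not_le]
        intro hy
        have := (abs_le.1 ((abs_re_le_norm y).trans (hR y hy))).1
        simp; linarith
      rw [this]; exact ⟨0, by simp, by simp⟩
    | succ n ih =>
      set s := -R - 1 + n * δ with hs
      have e : -R - 1 + (n + 1 : ℕ) * δ = s + δ := by push_cast; ring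
      rw [e]
      refine (line_glue (c := s) hK hKp inter_subset_left inter_subset_left (cl1 s)
        (hK.isClosed.inter ((isClosed_le continuous_const continuous_re).inter
          (isClosed_le continuous_re continuous_const)))
        (fun z hz => hz.2) (fun z hz => hz.2.1) ?_ ih (hstrip s)).mono ?_
      · intro z hz h
        exact ⟨⟨hz, h.le⟩, hz, h.ge, by simp only [mem_ofPred_eq]; linarith⟩
      · rintro z ⟨hz, hz'⟩
        rcases le_total z.re s with h | h
        · exact Or.inl ⟨hz, h⟩
        · exact Or.inr ⟨hz, h, hz'⟩
  obtain ⟨n, hn⟩ := exists_nat_gt ((2 * R + 1) / δ)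
  rw [div_lt_iff₀ hδ] at hn
  refine (step n).mono fun z hz => ⟨hz, ?_⟩
  have := (abs_le.1 ((abs_re_le_norm z).trans (hR z hz))).2
  simp only [mem_ofPred_eq]; linarith

theorem not_HL_circle {n : ℤ} (hn : n ≠ 0) : ¬ HL (univ : Set Circle) (fun z => (z : ℂ) ^ n) := by
  intro h
  have h1 := HL.image (S := (univ : Set Circle)) (c := fun z : Circle => (z : ℂ))
    (g := fun z : ℂ => z ^ n) isCompact_univ (by fun_prop) (fun x _ y _ h => Subtype.ext h) h
  refine not_HL_sphere (a := 0) one_pos hn ((h1.mono ?_).congr fun z _ => by simp)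
  intro z hz
  exact ⟨⟨z, by simpa [Submonoid.unitSphere] using hz⟩, trivial, rfl⟩

theorem isQuotientMap_circle_exp : IsQuotientMap Circle.exp :=
  IsOpenMap.isQuotientMap Circle.isCoveringMap_exp.isLocalHomeomorph.isOpenMap
    (by fun_prop) Circle.exp_surjective

theorem descend_circle {β : Type*} [TopologicalSpace β] {F : ℝ → β} (hF : Continuous F)
    (hp : ∀ t, F (t + 2 * π) = F t) : ∃ L : Circle → β, Continuous L ∧
    ∀ t, L (Circle.exp t) = F t := by
  have hp' : Function.Periodic F (2 * π) := hp
  have key : ∀ t, F (Complex.arg (Circle.exp t)) = F t := by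
    intro t
    have h := Circle.exp_arg (Circle.exp t)
    obtain ⟨m, hm⟩ := Circle.exp_eq_exp.1 h
    rw [hm]
    exact hp'.int_mul m t
  refine ⟨fun z => F (Complex.arg z), ?_, key⟩
  rw [isQuotientMap_circle_exp.continuous_iff]
  convert hF using 1
  ext t; exact key t

theorem circle_form {g : Circle → ℂ} (hg : Continuous g) (h0 : ∀ z, g z ≠ 0) :
    ∃ n : ℤ, HL (univ : Set Circle) (fun z => g z / (z : ℂ) ^ n) := by
  obtain ⟨l, hl, hle⟩ := HL.of_convex (X := (univ : Set ℝ)) (g := fun t => g (Circle.exp t))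
    convex_univ (by fun_prop) (fun t _ => h0 _)
  rw [continuousOn_univ] at hl
  obtain ⟨n, hn⟩ := log_diff_const (X := (univ : Set ℝ)) isPreconnected_univ
    (l := fun t => l (t + 2 * π)) (l' := l) (by fun_prop) (by fun_prop) (fun t _ => by
      rw [hle _ trivial, hle _ trivial]; simp)
  obtain ⟨L, hL, hLe⟩ := descend_circle (F := fun t : ℝ => l t - n * (t * I)) (by fun_prop)
    (fun t => by
      have := hn t trivial
      rw [this]; push_cast; ring)
  refine ⟨n, L, hL.continuousOn, fun z _ => ?_⟩
  obtain ⟨t, rfl⟩ := Circle.exp_surjective z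
  rw [hLe, exp_sub, hle t trivial, exp_int_mul]
  simp only [Circle.coe_exp]

def IsJCurve (X : Set ℂ) : Prop := ∃ γ : Circle → ℂ, Continuous γ ∧ Function.Injective γ ∧ range γ = X

theorem IsJCurve.isCompact {X : Set ℂ} (h : IsJCurve X) : IsCompact X := by
  obtain ⟨γ, hc, -, rfl⟩ := h
  exact isCompact_range hc

theorem IsJCurve.image {X : Set ℂ} (h : IsJCurve X) {f : ℂ → ℂ} (hf : ContinuousOn f X)
    (hi : InjOn f X) : IsJCurve (f '' X) := by
  obtain ⟨γ, hc, hinj, rfl⟩ := h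
  refine ⟨f ∘ γ, hf.comp_continuous hc fun x => ⟨x, rfl⟩, fun x y hxy => ?_, by rw [range_comp]⟩
  exact hinj (hi ⟨x, rfl⟩ ⟨y, rfl⟩ hxy)

theorem IsJCurve.HL_of {γ : Circle → ℂ} (hc : Continuous γ) (hi : Function.Injective γ) {g : ℂ → ℂ}
    (h : HL univ (fun z => g (γ z))) : HL (range γ) g := by
  rw [← image_univ]
  exact HL.image isCompact_univ hc.continuousOn hi.injOn h

theorem IsJCurve.exists_ess {X : Set ℂ} (h : IsJCurve X) : ∃ p ∉ X, ¬ HL X (fun z => z - p) := by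
  by_contra! hcon
  have hK := h.isCompact
  obtain ⟨γ, hc, hi, rfl⟩ := h
  have hd : ∀ x ∈ (univ : Set Circle), Function.invFun γ (γ x) = x :=
    fun x _ => Function.leftInverse_invFun hi x
  have hinv := continuousOn_inv_image isCompact_univ hc.continuousOn hd
  rw [image_univ] at hinv
  have := borsuk hK hcon (φ := fun z => (Function.invFun γ z : Circle)) (by fun_prop)
    (fun z _ => Circle.coe_ne_zero _)
  refine not_HL_circle one_ne_zero ((this.comp hc.continuousOn fun x _ => ⟨x, rfl⟩).congr ?_)
  intro z _
  simp [hd z trivial]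

theorem IsJCurve.arc {X : Set ℂ} (h : IsJCurve X) {x : ℂ} (hx : x ∈ X) {U : Set ℂ}
    (hU : U ∈ 𝓝 x) : ∃ A ⊆ X, IsCompact A ∧ X \ A ⊆ U ∧ IsPreconnected A ∧
      ∀ g : ℂ → ℂ, ContinuousOn g A → (∀ z ∈ A, g z ≠ 0) → HL A g := by
  obtain ⟨γ, hc, hi, rfl⟩ := h
  obtain ⟨u, rfl⟩ := hx
  obtain ⟨t0, rfl⟩ := Circle.exp_surjective u
  set c : ℝ → ℂ := fun t => γ (Circle.exp t) with hcdef
  have hcc : Continuous c := by fun_prop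
  obtain ⟨ε0, hε0, hball⟩ := Metric.mem_nhds_iff.1 (hcc.continuousAt.preimage_mem_nhds hU)
  set ε := min (ε0 / 2) 1 with hε
  have hεpos : 0 < ε := by positivity
  have hεlt : ε < ε0 := by have := min_le_left (ε0 / 2) 1; linarith
  have hpi := pi_gt_three
  have hε1 : ε ≤ 1 := min_le_right _ _
  set I := Icc (t0 + ε) (t0 + 2 * π - ε) with hI
  have hinj : InjOn c I := by
    intro s hs t ht hst
    obtain ⟨m, hm⟩ := Circle.exp_eq_exp.1 (hi hst)
    have hm0 : m = 0 := by
      have h1 : (m : ℝ) * (2 * π) < 1 * (2 * π) := by linarith [hs.2, ht.1]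
      have h2 : (-1 : ℝ) * (2 * π) < m * (2 * π) := by linarith [hs.1, ht.2]
      have h3 := lt_of_mul_lt_mul_right h1 (by positivity)
      have h4 := lt_of_mul_lt_mul_right h2 (by positivity)
      have h3' : m < 1 := by exact_mod_cast h3
      have h4' : -1 < m := by exact_mod_cast h4
      omega
    rw [hm, hm0]; simp
  refine ⟨c '' I, ?_, isCompact_Icc.image hcc, ?_, isPreconnected_Icc.image _ hcc.continuousOn, ?_⟩
  · rintro _ ⟨t, -, rfl⟩; exact ⟨_, rfl⟩
  · rintro _ ⟨⟨v, rfl⟩, hv⟩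
    obtain ⟨t, rfl⟩ := Circle.exp_surjective v
    obtain ⟨s, ⟨hs1, hs2⟩, hs⟩ : ∃ s ∈ Ico (t0 - ε) (t0 - ε + 2 * π),
        Circle.exp s = Circle.exp t := by
      refine ⟨toIcoMod two_pi_pos (t0 - ε) t, toIcoMod_mem_Ico _ _ _, ?_⟩
      rw [Circle.exp_eq_exp]
      refine ⟨- toIcoDiv two_pi_pos (t0 - ε) t, ?_⟩
      have := toIcoMod_add_toIcoDiv_zsmul two_pi_pos (t0 - ε) t
      simp only [zsmul_eq_mul] at this
      push_cast; linarith
    have hsI : s ∉ I := fun h => hv ⟨s, h, by simp [hcdef, hs]⟩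
    have : s < t0 + ε := by
      by_contra! h
      exact hsI ⟨h, by linarith⟩
    have h3 := hball (a := s) (by rw [mem_ball, dist_eq, abs_lt]; constructor <;> linarith)
    rw [← hs]; exact h3
  · intro g hg h0
    refine HL.image isCompact_Icc hcc.continuousOn hinj ?_
    exact HL.of_convex (convex_Icc _ _) (hg.comp hcc.continuousOn (fun t ht => ⟨t, ht, rfl⟩))
      (fun t ht => h0 _ ⟨t, ht, rfl⟩)

theorem IsPreconnected.subset_of_frontier {α : Type*} [TopologicalSpace α] {C W : Set α}
    (hC : IsPreconnected C) (h1 : (C ∩ W).Nonempty) (h2 : Disjoint C (frontier W)) : C ⊆ W := by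
  have h3 := hC.subset_of_closure_inter_subset (u := interior W) isOpen_interior ?_ ?_
  · exact h3.trans interior_subset
  · obtain ⟨x, hx, hxW⟩ := h1
    refine ⟨x, hx, ?_⟩
    by_contra hni
    exact Set.disjoint_left.1 h2 hx ⟨subset_closure hxW, hni⟩
  · rintro x ⟨hx, hxC⟩
    by_contra hni
    exact Set.disjoint_left.1 h2 hxC ⟨closure_mono interior_subset hx, hni⟩

theorem IsJCurve.frontier_comp {X : Set ℂ} (h : IsJCurve X) {p q : ℂ} (hp : p ∉ X) (hq : q ∉ X)
    (hpq : q ∉ connectedComponentIn Xᶜ p) : frontier (connectedComponentIn Xᶜ p) = X := by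
  have hX := h.isCompact
  refine (frontier_comp_subset hX.isClosed p).antisymm ?_
  intro x hx
  by_contra hxf
  set W := connectedComponentIn Xᶜ p with hW
  have hxc : x ∉ closure W := by
    intro hxc
    apply hxf
    refine ⟨hxc, fun hi => ?_⟩
    exact connectedComponentIn_subset _ _ (interior_subset hi) hx
  obtain ⟨A, hAX, hA, hAU, -, hHL⟩ := h.arc hx (isClosed_closure.isOpen_compl.mem_nhds hxc)
  have hne : ∀ p ∉ X, ∀ z ∈ A, z - p ≠ 0 := fun p hp z hz h => hp (by
    rw [sub_eq_zero] at h; rw [← h]; exact hAX hz)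
  have hj : JoinedIn Aᶜ p q := joined_of_HL hA (fun h => hp (hAX h)) (fun h => hq (hAX h))
    (hHL _ (ContinuousOn.div (by fun_prop) (by fun_prop) (hne q hq))
      fun z hz => div_ne_zero (hne p hp z hz) (hne q hq z hz))
  rw [joinedIn_iff_comp hA.isClosed.isOpen_compl (fun h => hp (hAX h))] at hj
  apply hpq
  refine IsPreconnected.subset_of_frontier isPreconnected_connectedComponentIn
    ⟨p, mem_connectedComponentIn (show p ∈ Aᶜ from fun h => hp (hAX h)), mem_connectedComponentIn hp⟩ ?_ hj
  rw [Set.disjoint_left]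
  intro y hy hyf
  have h1 := frontier_comp_subset hX.isClosed p hyf
  have h2 : y ∉ A := connectedComponentIn_subset _ _ hy
  exact hAU ⟨h1, h2⟩ hyf.1

def Ess (X : Set ℂ) : Prop := 0 ∉ X ∧ ¬ HL X (fun z => z)

def inn (X : Set ℂ) : Set ℂ := connectedComponentIn Xᶜ 0

def out (X : Set ℂ) : Set ℂ := (X ∪ inn X)ᶜ

theorem IsJCurve.third {X : Set ℂ} (h : IsJCurve X) (he : Ess X) {q : ℂ} (hq : q ∈ out X) :
    ¬ Bornology.IsBounded (connectedComponentIn Xᶜ q) := by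
  intro hb
  have hX := h.isCompact
  have hqX : q ∉ X := fun hh => hq (Or.inl hh)
  have h0W : 0 ∉ connectedComponentIn Xᶜ q := by
    intro hh
    apply hq
    right
    rw [inn, ← connectedComponentIn_eq hh]
    exact mem_connectedComponentIn hqX
  have hopen : IsOpen (connectedComponentIn Xᶜ q) := hX.isClosed.isOpen_compl.connectedComponentIn
  obtain ⟨γ, hc, hi, hr⟩ := h
  have hγX : ∀ u, γ u ∈ X := fun u => hr ▸ ⟨u, rfl⟩
  obtain ⟨d, hd⟩ := circle_form hc (fun u h => he.1 (h ▸ hγX u))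
  have hd0 : d ≠ 0 := by
    rintro rfl
    apply he.2
    rw [← hr]
    exact IsJCurve.HL_of hc hi (hd.congr fun z _ => by simp)
  obtain ⟨d', hd'⟩ := circle_form (g := fun u => γ u - q) (by fun_prop)
    (fun u h => hqX (by rw [sub_eq_zero] at h; rw [← h]; exact hγX u))
  have hHL : HL X (fun z => (z - q) ^ d / z ^ d') := by
    rw [← hr]
    refine IsJCurve.HL_of hc hi (((hd'.zpow d).div (hd.zpow d')).congr fun z _ => ?_)
    have hz := Circle.coe_ne_zero z
    rw [div_zpow, div_zpow, ← zpow_mul, ← zpow_mul, mul_comm d' d]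
    rw [div_div_div_cancel_right₀ (zpow_ne_zero _ hz)]
  obtain ⟨l, hl, hle⟩ := hHL
  have hclos : ∀ z ∈ closure (connectedComponentIn Xᶜ q), z ≠ 0 := by
    rintro z hz rfl
    apply he.1
    apply frontier_comp_subset hX.isClosed q
    rw [hopen.frontier_eq]
    exact ⟨hz, h0W⟩
  have := glue_HL hX.isClosed (frontier_comp_subset hX.isClosed q) hl
    (g1 := fun z => (z - q) ^ d) (g2 := fun z => z ^ d') ?_ ?_ ?_ ?_ ?_
  · exact not_HL_compl hb hd0 this
  · rw [hopen.isClosed_compl.closure_eq]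
    refine ContinuousOn.zpow₀ (by fun_prop) _ ?_
    intro z hz
    left
    intro h
    rw [sub_eq_zero] at h
    exact hz (by rw [h]; exact mem_connectedComponentIn hqX)
  · intro z hz
    refine zpow_ne_zero _ fun h => ?_
    rw [sub_eq_zero] at h
    exact hz (by rw [h]; exact mem_connectedComponentIn hqX)
  · exact ContinuousOn.zpow₀ (by fun_prop) _ fun z hz => Or.inl (hclos z hz)
  · intro z hz
    exact zpow_ne_zero _ (hclos z (subset_closure hz))
  · intro z hz
    rw [hle z (frontier_comp_subset hX.isClosed q hz), mul_div_cancel₀]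
    exact zpow_ne_zero _ (hclos z (frontier_subset_closure hz))

section
variable {X : Set ℂ}
theorem inn_open (h : IsJCurve X) : IsOpen (inn X) := h.isCompact.isClosed.isOpen_compl.connectedComponentIn

theorem inn_conn (he : Ess X) : IsConnected (inn X) := isConnected_connectedComponentIn_iff.2 he.1

theorem zero_mem_inn (he : Ess X) : (0 : ℂ) ∈ inn X := mem_connectedComponentIn he.1

theorem inn_subset : inn X ⊆ Xᶜ := connectedComponentIn_subset _ _

theorem inn_bdd (h : IsJCurve X) (he : Ess X) : Bornology.IsBounded (inn X) :=
  bdd_of_not_HL h.isCompact (by simpa using he.2)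

theorem exists_far (h : IsJCurve X) (he : Ess X) : ∃ R > 0, ∀ z : ℂ, R < ‖z‖ → z ∈ out X := by
  obtain ⟨R, hR0, hR⟩ := (h.isCompact.isBounded.union (inn_bdd h he)).exists_pos_norm_le
  exact ⟨R, hR0, fun z hz hz' => absurd (hR z hz') (not_le.2 hz)⟩

theorem out_eq (h : IsJCurve X) (he : Ess X) {q : ℂ} (hq : q ∈ out X) :
    out X = connectedComponentIn Xᶜ q := by
  have hqX : q ∉ X := fun hh => hq (Or.inl hh)
  ext z
  constructor
  · intro hz
    rw [← comp_unbdd_eq h.isCompact.isBounded (h.third he hz) (h.third he hq)]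
    exact mem_connectedComponentIn fun hh => hz (Or.inl hh)
  · rintro hz (hz' | hz')
    · exact connectedComponentIn_subset _ _ hz hz'
    · apply hq
      right
      rw [inn, connectedComponentIn_eq hz', ← connectedComponentIn_eq hz]
      exact mem_connectedComponentIn hqX

theorem frontier_inn (h : IsJCurve X) (he : Ess X) : frontier (inn X) = X := by
  obtain ⟨R, hR0, hR⟩ := exists_far h he
  have hq := hR ((R + 1 : ℝ) : ℂ) (by
    rw [norm_real, norm_eq_abs]; exact (lt_add_one R).trans_le (le_abs_self _))
  exact h.frontier_comp he.1 (fun hh => hq (Or.inl hh)) (fun hh => hq (Or.inr hh))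

theorem out_nonempty (h : IsJCurve X) (he : Ess X) : (out X).Nonempty := by
  obtain ⟨R, hR0, hR⟩ := exists_far h he
  exact ⟨((R + 1 : ℝ) : ℂ), hR _ (by
    rw [norm_real, norm_eq_abs]; exact (lt_add_one R).trans_le (le_abs_self _))⟩

theorem frontier_out (h : IsJCurve X) (he : Ess X) : frontier (out X) = X := by
  obtain ⟨q, hq⟩ := out_nonempty h he
  rw [out_eq h he hq]
  refine h.frontier_comp (fun hh => hq (Or.inl hh)) he.1 ?_
  rw [← out_eq h he hq]
  exact fun hh => hh (Or.inr (zero_mem_inn he))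

theorem out_conn (h : IsJCurve X) (he : Ess X) : IsConnected (out X) := by
  obtain ⟨q, hq⟩ := out_nonempty h he
  rw [out_eq h he hq]
  exact isConnected_connectedComponentIn_iff.2 (fun hh => hq (Or.inl hh))

theorem closure_inn (h : IsJCurve X) (he : Ess X) : closure (inn X) = X ∪ inn X := by
  rw [closure_eq_self_union_frontier, frontier_inn h he, union_comm]

theorem out_open (h : IsJCurve X) (he : Ess X) : IsOpen (out X) := by
  rw [out, ← closure_inn h he]; exact isClosed_closure.isOpen_compl

theorem compl_inn (h : IsJCurve X) (he : Ess X) : (inn X)ᶜ = closure (out X) := by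
  rw [closure_eq_self_union_frontier, frontier_out h he]
  ext z
  simp only [out, mem_compl_iff, mem_union]
  constructor
  · intro hz
    by_cases hzX : z ∈ X
    · exact Or.inr hzX
    · left; rintro (h | h)
      · exact hzX h
      · exact hz h
  · rintro (h | h) hz
    · exact h (Or.inr hz)
    · exact inn_subset hz h

theorem compl_inn_conn (h : IsJCurve X) (he : Ess X) : IsPreconnected (inn X)ᶜ := by
  rw [compl_inn h he]; exact (out_conn h he).isPreconnected.closure
end

theorem HL_simply {G : Set ℂ} (hG : IsOpen G) (hb : Bornology.IsBounded G) (hc : IsPreconnected G)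
    (h0G : (0:ℂ) ∈ G) (hcc : IsPreconnected Gᶜ) {φ : ℂ → ℂ} (hφ : ContinuousOn φ G)
    (h0 : ∀ z ∈ G, φ z ≠ 0) : HL G φ := by
  classical
  obtain ⟨R, hR0, hR⟩ := hb.exists_pos_norm_le
  have hfar : ∀ z : ℂ, R < ‖z‖ → z ∈ Gᶜ := fun z hz hz' => absurd (hR z hz') (not_le.2 hz)
  have hne : (Gᶜ).Nonempty := ⟨((R + 1 : ℝ) : ℂ), hfar _ (by
    rw [norm_real, norm_eq_abs]; exact (lt_add_one R).trans_le (le_abs_self _))⟩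
  have hcl : IsClosed Gᶜ := hG.isClosed_compl
  have hid : Continuous (fun z : ℂ => infDist z Gᶜ) := continuous_infDist_pt _
  have key : ∀ r > 0, HL {z | r ≤ infDist z Gᶜ} φ := by
    intro r hr
    have hsub : {z : ℂ | r ≤ infDist z Gᶜ} ⊆ G := by
      intro z hz
      by_contra hzG
      have : infDist z Gᶜ = 0 := infDist_zero_of_mem hzG
      have hz' : r ≤ infDist z Gᶜ := hz
      linarith
    have hK : IsCompact {z : ℂ | r ≤ infDist z Gᶜ} :=
      Metric.isCompact_of_isClosed_isBounded (isClosed_le continuous_const hid) (hb.subset hsub)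
    refine borsuk hK (fun p hp => HL.of_unbdd hK fun hbb => ?_) (hφ.mono hsub)
      (fun z hz => h0 z (hsub hz))
    have hp' : infDist p Gᶜ < r := not_le.1 hp
    obtain ⟨c, hcG, hpc⟩ := (infDist_lt_iff hne).1 hp'
    have hconn : IsPreconnected (ball c r ∪ Gᶜ) :=
      IsPreconnected.union c (mem_ball_self hr) hcG (convex_ball c r).isPreconnected hcc
    have hss : ball c r ∪ Gᶜ ⊆ {z | r ≤ infDist z Gᶜ}ᶜ := by
      rintro z (hz | hz)
      · simp only [mem_compl_iff, mem_ofPred_eq, not_le]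
        exact (infDist_lt_iff hne).2 ⟨c, hcG, hz⟩
      · exact fun h => hz (hsub h)
    have := hconn.subset_connectedComponentIn (x := p) (Or.inl hpc) hss
    obtain ⟨R', hR'⟩ := (hbb.subset (subset_union_right.trans this)).exists_norm_le
    have h3 := hR' ((max R R' + 1 : ℝ) : ℂ) (hfar _ (by
      rw [norm_real, norm_eq_abs]
      exact (lt_of_le_of_lt (le_max_left R R') (lt_add_one _)).trans_le (le_abs_self _)))
    rw [norm_real, norm_eq_abs] at h3
    have := (le_abs_self _).trans h3
    linarith [le_max_right R R']
  set V : ℕ → Set ℂ := fun j => connectedComponentIn {z | 1 / ((j : ℝ) + 1) < infDist z Gᶜ} 0 with hV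
  have hVo : ∀ j, IsOpen (V j) := fun j => (isOpen_lt continuous_const hid).connectedComponentIn
  have hVsub : ∀ j, V j ⊆ {z | 1 / ((j : ℝ) + 1) < infDist z Gᶜ} :=
    fun j => connectedComponentIn_subset _ _
  have hVne : ∀ j z, z ∈ V j → (0 : ℂ) ∈ V j := fun j z hz => by
    refine mem_connectedComponentIn ?_
    by_contra h
    rw [hV] at hz
    simp only [connectedComponentIn_eq_empty h] at hz
    exact hz
  have hVmono : ∀ i j, i ≤ j → V i ⊆ V j := fun i j hij => by
    refine connectedComponentIn_mono _ fun z hz => ?_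
    have hz' : 1 / ((i : ℝ) + 1) < infDist z Gᶜ := hz
    refine lt_of_le_of_lt ?_ hz'
    exact one_div_le_one_div_of_le (by positivity) (by exact_mod_cast Nat.succ_le_succ hij)
  have hVex : ∀ z ∈ G, ∃ j, z ∈ V j := by
    intro z hz
    have hj : JoinedIn G 0 z := (joinedIn_iff_comp hG h0G).2
      (hc.subset_connectedComponentIn h0G subset_rfl hz)
    obtain ⟨γ, hγ⟩ := hj
    have hcomp : IsCompact (range γ) := isCompact_range γ.continuous
    obtain ⟨x, hx, hmin⟩ := hcomp.exists_isMinOn ⟨_, mem_range_self 0⟩ hid.continuousOn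
    have hpos : 0 < infDist x Gᶜ := by
      rw [← hcl.notMem_iff_infDist_pos hne]
      obtain ⟨t, rfl⟩ := hx
      exact fun h => h (hγ t)
    obtain ⟨j, hj⟩ := exists_nat_one_div_lt hpos
    refine ⟨j, ?_⟩
    refine (isPreconnected_range γ.continuous).subset_connectedComponentIn
      ⟨0, γ.source⟩ ?_ ⟨1, γ.target⟩
    intro y hy
    exact hj.trans_le (hmin hy)
  have hlog : ∀ j, ∃ l : ℂ → ℂ, ContinuousOn l (V j) ∧ (∀ z ∈ V j, Complex.exp (l z) = φ z) ∧
      l 0 = Complex.log (φ 0) := by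
    intro j
    obtain ⟨l, hl, hle⟩ := (key (1 / ((j : ℝ) + 1)) (by positivity)).mono
      ((hVsub j).trans fun z (hz : 1 / ((j : ℝ) + 1) < infDist z Gᶜ) => hz.le)
    by_cases h : (0 : ℂ) ∈ V j
    · refine ⟨fun z => l z + (Complex.log (φ 0) - l 0), by fun_prop, fun z hz => ?_, by ring⟩
      rw [exp_add, exp_sub, hle z hz, hle 0 h, exp_log (h0 0 h0G),
        div_self (h0 0 h0G), mul_one]
    · have : V j = ∅ := by
        by_contra hh
        obtain ⟨z, hz⟩ := nonempty_iff_ne_empty.2 hh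
        exact h (hVne j z hz)
      exact ⟨fun _ => Complex.log (φ 0), by fun_prop, by simp [this], rfl⟩
  choose l hl hle hl0 using hlog
  have hagree : ∀ i j, i ≤ j → ∀ z ∈ V i, l j z = l i z := by
    intro i j hij z hz
    obtain ⟨n, hn⟩ := log_diff_const (X := V i) isPreconnected_connectedComponentIn
      ((hl j).mono (hVmono i j hij)) (hl i)
      (fun w hw => by rw [hle j w (hVmono i j hij hw), hle i w hw])
    have h1 := hn 0 (hVne i z hz)
    rw [hl0, hl0] at h1
    have h2 := hn z hz
    rw [h2]
    linear_combination -h1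
  refine ⟨fun z => if h : ∃ j, z ∈ V j then l (Nat.find h) z else 0, ?_, ?_⟩
  · intro z hz
    obtain ⟨j, hj⟩ := hVex z hz
    refine ContinuousAt.continuousWithinAt ?_
    refine ((hl j).continuousAt ((hVo j).mem_nhds hj)).congr ?_
    filter_upwards [(hVo j).mem_nhds hj] with w hw
    have hex : ∃ j, w ∈ V j := ⟨j, hw⟩
    rw [dif_pos hex]
    exact hagree _ _ (Nat.find_min' hex hw) w (Nat.find_spec hex)
  · intro z hz
    simp only [dif_pos (hVex z hz)]
    exact hle _ _ (Nat.find_spec (hVex z hz))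

theorem log_differentiableOn {G : Set ℂ} (hG : IsOpen G) {φ l : ℂ → ℂ} (hφ : DifferentiableOn ℂ φ G)
    (hl : ContinuousOn l G) (hle : ∀ z ∈ G, Complex.exp (l z) = φ z) : DifferentiableOn ℂ l G := by
  intro z hz
  refine DifferentiableAt.differentiableWithinAt ?_
  have hlz := hl.continuousAt (hG.mem_nhds hz)
  have hφz := hφ.differentiableAt (hG.mem_nhds hz)
  have h0 : φ z ≠ 0 := by rw [← hle z hz]; exact exp_ne_zero _
  have hd : DifferentiableAt ℂ (fun w => Complex.log (φ w / φ z) + l z) z := by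
    refine DifferentiableAt.add_const _ (DifferentiableAt.clog (hφz.div_const _) ?_)
    rw [div_self h0]; exact Complex.one_mem_slitPlane
  refine hd.congr_of_eventuallyEq ?_
  have hev : ∀ᶠ w in 𝓝 z, dist (l w) (l z) < 1 := hlz (ball_mem_nhds _ one_pos)
  filter_upwards [hev, hG.mem_nhds hz] with w hw hwG
  rw [← hle w hwG, ← hle z hz, ← exp_sub]
  have him : |(l w - l z).im| < 1 := (abs_im_le_norm _).trans_lt (by rwa [← dist_eq_norm])
  have hpi := pi_gt_three
  rw [abs_lt] at him
  rw [log_exp (by linarith) (by linarith)]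
  ring

theorem exists_sqrt {G : Set ℂ} (hG : IsOpen G) {φ : ℂ → ℂ} (hφ : DifferentiableOn ℂ φ G)
    (h : HL G φ) : ∃ s : ℂ → ℂ, DifferentiableOn ℂ s G ∧ ∀ z ∈ G, s z ^ 2 = φ z := by
  obtain ⟨l, hl, hle⟩ := h
  have hd := log_differentiableOn hG hφ hl hle
  refine ⟨fun z => Complex.exp (l z / 2), (hd.div_const 2).cexp, fun z hz => ?_⟩
  rw [← Complex.exp_nat_mul, ← hle z hz]
  congr 1; push_cast; ring

theorem inj_holo_inverse {G : Set ℂ} (hG : IsOpen G) {f : ℂ → ℂ} (hf : DifferentiableOn ℂ f G)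
    (hi : InjOn f G) : IsOpen (f '' G) ∧ ∃ g : ℂ → ℂ, DifferentiableOn ℂ g (f '' G) ∧
      (∀ z ∈ G, g (f z) = z) := by
  have han : ∀ z ∈ G, AnalyticAt ℂ f z := fun z hz => hf.analyticAt (hG.mem_nhds hz)
  have hnc : ∀ z ∈ G, ¬ ∀ᶠ w in 𝓝 z, f w = f z := by
    intro z hz h
    obtain ⟨w, ⟨hw1, hw2⟩, hw3⟩ := ((h.and (hG.mem_nhds hz)).filter_mono
      (nhdsWithin_le_nhds (s := {z}ᶜ)) |>.and self_mem_nhdsWithin).exists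
    exact hw3 (hi hw2 hz hw1)
  have hopen : ∀ z ∈ G, 𝓝 (f z) ≤ Filter.map f (𝓝 z) := fun z hz =>
    ((han z hz).eventually_constant_or_nhds_le_map_nhds).resolve_left (hnc z hz)
  have himg : ∀ z ∈ G, ∀ U ∈ 𝓝 z, f '' U ∈ 𝓝 (f z) := fun z hz U hU =>
    hopen z hz (Filter.image_mem_map hU)
  have hfo : IsOpen (f '' G) := by
    rw [isOpen_iff_mem_nhds]
    rintro _ ⟨z, hz, rfl⟩
    exact himg z hz G (hG.mem_nhds hz)
  set g : ℂ → ℂ := Function.invFunOn f G with hg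
  have hgf : ∀ z ∈ G, g (f z) = z := fun z hz => hi.leftInvOn_invFunOn hz
  refine ⟨hfo, g, ?_, hgf⟩
  have hgc : ∀ z ∈ G, ContinuousAt g (f z) := by
    intro z hz U hU
    rw [hgf z hz] at hU
    rw [Filter.mem_map]
    refine Filter.mem_of_superset (himg z hz (U ∩ G) (Filter.inter_mem hU (hG.mem_nhds hz))) ?_
    rintro _ ⟨w, ⟨hw, hwG⟩, rfl⟩
    rw [mem_preimage, hgf w hwG]; exact hw
  have hgd : ∀ z ∈ G, deriv f z ≠ 0 → DifferentiableAt ℂ g (f z) := by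
    intro z hz hd
    have hder := (hf.differentiableAt (hG.mem_nhds hz)).hasDerivAt
    refine (HasDerivAt.of_local_left_inverse (f := f) (f' := deriv f z) (hgc z hz) ?_ hd ?_).differentiableAt
    · rw [hgf z hz]; exact hder
    · filter_upwards [hfo.mem_nhds ⟨z, hz, rfl⟩]
      rintro _ ⟨w, hw, rfl⟩
      rw [hgf w hw]
  rintro _ ⟨z, hz, rfl⟩
  refine DifferentiableAt.differentiableWithinAt (AnalyticAt.differentiableAt
    (Complex.analyticAt_of_differentiable_on_punctured_nhds_of_continuousAt ?_ (hgc z hz)))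
  have hand : AnalyticAt ℂ (deriv f) z := (han z hz).deriv
  rcases hand.eventually_eq_zero_or_eventually_ne_zero with h | h
  · exfalso
    obtain ⟨r, hr, hrb⟩ := Metric.mem_nhds_iff.1 (Filter.inter_mem h (hG.mem_nhds hz))
    refine hnc z hz ?_
    filter_upwards [ball_mem_nhds z hr] with w hw
    refine (convex_ball z r).is_const_of_fderivWithin_eq_zero (𝕜 := ℂ)
      (hf.mono fun y hy => (hrb hy).2) (fun y hy => ?_) hw (mem_ball_self hr)
    rw [fderivWithin_of_isOpen isOpen_ball hy]
    ext
    simpa using (hrb hy).1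
  · rw [eventually_nhdsWithin_iff] at h ⊢
    obtain ⟨r, hr, hrb⟩ := Metric.mem_nhds_iff.1 (Filter.inter_mem h (hG.mem_nhds hz))
    filter_upwards [himg z hz _ (ball_mem_nhds z hr)]
    rintro _ ⟨w, hw, rfl⟩ hne
    exact hgd w (hrb hw).2 ((hrb hw).1 (fun h => hne (by rw [mem_singleton_iff] at h; rw [h]; rfl)))

theorem montel {G : Set ℂ} (hG : IsOpen G) {f : ℕ → ℂ → ℂ} (hf : ∀ n, DifferentiableOn ℂ (f n) G)
    (hb : ∀ n, MapsTo (f n) G (ball 0 1)) (𝒰 : Ultrafilter ℕ) :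
    ∃ g : ℂ → ℂ, TendstoLocallyUniformlyOn f g (𝒰 : Filter ℕ) G := by
  have hlim : ∀ z, ∃ w, z ∈ G → Filter.Tendsto (fun n => f n z) (𝒰 : Filter ℕ) (𝓝 w) := by
    intro z
    by_cases hz : z ∈ G
    · have hc := isCompact_closedBall (0 : ℂ) 1
      obtain ⟨w, -, hw⟩ := hc.ultrafilter_le_nhds (𝒰.map (fun n => f n z)) (by
        simp only [Filter.le_principal_iff]
        refine Filter.mem_map.2 (Filter.univ_mem' fun n => ?_)
        exact ball_subset_closedBall (hb n hz))
      exact ⟨w, fun _ => hw⟩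
    · exact ⟨0, fun h => absurd h hz⟩
  choose g hg using hlim
  refine ⟨g, ?_⟩
  rw [Metric.tendstoLocallyUniformlyOn_iff]
  intro ε hε z hz
  obtain ⟨r, hr, hrG⟩ := Metric.isOpen_iff.1 hG z hz
  have hlip : ∀ n, ∀ w ∈ ball z r, dist (f n w) (f n z) ≤ 2 / r * dist w z := by
    intro n w hw
    refine Complex.dist_le_div_mul_dist_of_mapsTo_ball ((hf n).mono hrG) (fun y hy => ?_) hw
    have h1 := hb n (hrG hy)
    have h2 := hb n hz
    rw [mem_closedBall]
    rw [mem_ball] at h1 h2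
    have := dist_triangle_right (f n y) (f n z) 0
    linarith
  have hlip' : ∀ w ∈ ball z r, dist (g w) (g z) ≤ 2 / r * dist w z := by
    intro w hw
    exact le_of_tendsto ((hg w (hrG hw)).dist (hg z hz)) (Filter.Eventually.of_forall fun n => hlip n w hw)
  set δ := min r (ε * r / 8) with hδ
  have hδ0 : 0 < δ := by positivity
  refine ⟨ball z δ, mem_nhdsWithin_of_mem_nhds (ball_mem_nhds z hδ0), ?_⟩
  have hev : ∀ᶠ n in (𝒰 : Filter ℕ), dist (f n z) (g z) < ε / 3 :=
    (hg z hz) (ball_mem_nhds _ (by positivity))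
  filter_upwards [hev] with n hn w hw
  have hwr : w ∈ ball z r := ball_subset_ball (min_le_left _ _) hw
  have hwδ : dist w z < ε * r / 8 := lt_of_lt_of_le hw (min_le_right _ _)
  have hs : 2 / r * dist w z ≤ ε / 4 := by
    calc 2 / r * dist w z ≤ 2 / r * (ε * r / 8) := by gcongr
      _ = ε / 4 := by field_simp; ring
  have h1 := hlip n w hwr
  have h2 := hlip' w hwr
  have h3 := dist_triangle4 (g w) (g z) (f n z) (f n w)
  rw [dist_comm (g z), dist_comm (f n z) (f n w)] at h3
  linarith

theorem hurwitz {G : Set ℂ} (hG : IsOpen G) (hc : IsPreconnected G) {f : ℕ → ℂ → ℂ} {g : ℂ → ℂ}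
    {𝒰 : Filter ℕ} [𝒰.NeBot]
    (hf : ∀ n, DifferentiableOn ℂ (f n) G) (hi : ∀ n, InjOn (f n) G)
    (hg : TendstoLocallyUniformlyOn f g 𝒰 G) (hgd : DifferentiableOn ℂ g G)
    {z0 : ℂ} (hz0 : z0 ∈ G) (hd : deriv g z0 ≠ 0) : InjOn g G := by
  intro a ha b hb hab
  by_contra hne
  have han : AnalyticOnNhd ℂ g G := hgd.analyticOnNhd hG
  have hpunct : ∀ᶠ z in 𝓝[≠] b, g z ≠ g b := by
    rcases (han b hb).eventually_eq_or_eventually_ne (analyticAt_const (v := g b)) with h | h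
    · exfalso
      have := han.eqOn_of_preconnected_of_eventuallyEq (analyticOnNhd_const (v := g b)) hc hb h
      apply hd
      have h2 : g =ᶠ[𝓝 z0] fun _ => g b := by
        filter_upwards [hG.mem_nhds hz0] with z hz using this hz
      rw [h2.deriv_eq]; simp
    · exact h
  rw [eventually_nhdsWithin_iff] at hpunct
  have hane : ∀ᶠ z in 𝓝 b, z ≠ a := by
    exact eventually_ne_nhds (Ne.symm hne)
  obtain ⟨r, hr, hrb⟩ := Metric.nhds_basis_closedBall.mem_iff.1
    (Filter.inter_mem hpunct (Filter.inter_mem hane (hG.mem_nhds hb)))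
  have hK : IsCompact (closedBall b r) := isCompact_closedBall _ _
  have hKG : closedBall b r ⊆ G := fun z hz => (hrb hz).2.2
  have hSK : sphere b r ⊆ closedBall b r := sphere_subset_closedBall
  have hgc : ContinuousOn (fun z => ‖g z - g b‖) (sphere b r) :=
    ((hgd.continuousOn.mono (hSK.trans hKG)).sub continuousOn_const).norm
  obtain ⟨x, hx, hmin⟩ := (isCompact_sphere b r).exists_isMinOn
    (NormedSpace.sphere_nonempty.2 hr.le) hgc
  set m := ‖g x - g b‖ with hm
  have hm0 : 0 < m := by
    rw [hm, norm_pos_iff, sub_ne_zero]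
    refine (hrb (hSK hx)).1 ?_
    intro h
    rw [mem_singleton_iff] at h
    rw [h, mem_sphere, dist_self] at hx
    exact hr.ne hx
  have hunif : TendstoUniformlyOn f g 𝒰 (closedBall b r) :=
    (tendstoLocallyUniformlyOn_iff_forall_isCompact hG).1 hg _ hKG hK
  have ha' : Filter.Tendsto (fun n => f n a) 𝒰 (𝓝 (g a)) := hg.tendsto_at ha
  have hev : ∀ᶠ n in 𝒰, dist (f n a) (g a) < m / 4 :=
    ha' (ball_mem_nhds _ (by positivity))
  obtain ⟨n, hn1, hn2⟩ := ((Metric.tendstoUniformlyOn_iff.1 hunif (m / 4) (by positivity)).and hev).exists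
  have hnz : ∀ z ∈ closedBall b r, f n z - f n a ≠ 0 := by
    intro z hz h
    exact (hrb hz).2.1 (hi n (hKG hz) ha (sub_eq_zero.1 h))
  have hdc : DiffContOnCl ℂ (fun z => (f n z - f n a)⁻¹) (ball b r) := by
    refine DifferentiableOn.diffContOnCl_ball (U := closedBall b r) ?_ subset_rfl
    exact (((hf n).mono hKG).sub_const _).inv hnz
  have hfr : ∀ z ∈ frontier (ball b r), ‖(f n z - f n a)⁻¹‖ ≤ (m / 2)⁻¹ := by
    intro z hz
    rw [frontier_ball b hr.ne'] at hz
    rw [norm_inv]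
    refine inv_anti₀ (by positivity) ?_
    have h1 : m ≤ ‖g z - g b‖ := hmin hz
    have h2 := hn1 z (hSK hz)
    rw [← dist_eq_norm] at h1 ⊢
    have h3 := dist_triangle4 (g z) (f n z) (f n a) (g b)
    rw [← hab] at h3 h1
    linarith
  have := Complex.norm_le_of_forall_mem_frontier_norm_le isBounded_ball hdc hfr
    (subset_closure (mem_ball_self hr))
  rw [norm_inv] at this
  have h1 := (inv_le_inv₀ (norm_pos_iff.2 (hnz b (mem_closedBall_self hr.le))) (by positivity)).1 this
  rw [← dist_eq_norm] at h1
  have h2 := hn1 b (mem_closedBall_self hr.le)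
  have h3 := dist_triangle (f n b) (g b) (f n a)
  have h4 := dist_comm (f n b) (g b)
  have h5 := dist_comm (g b) (f n a)
  rw [hab] at hn2
  linarith

def mob (a z : ℂ) : ℂ := (z - a) / (1 - (starRingEnd ℂ) a * z)

theorem mob_den {a z : ℂ} (ha : ‖a‖ < 1) (hz : ‖z‖ < 1) : 1 - (starRingEnd ℂ) a * z ≠ 0 := by
  intro h
  have h1 : (starRingEnd ℂ) a * z = 1 := (sub_eq_zero.1 h).symm
  have h2 : ‖a‖ * ‖z‖ = 1 := by rw [← norm_conj a, ← norm_mul, h1, norm_one]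
  nlinarith [norm_nonneg a, norm_nonneg z]

theorem mob_norm {a z : ℂ} (ha : ‖a‖ < 1) (hz : ‖z‖ < 1) : ‖mob a z‖ < 1 := by
  rw [mob, norm_div, div_lt_one (norm_pos_iff.2 (mob_den ha hz)),
    ← sq_lt_sq₀ (norm_nonneg _) (norm_nonneg _), ← normSq_eq_norm_sq, ← normSq_eq_norm_sq]
  have ha2 : Complex.normSq a < 1 := by
    rw [normSq_eq_norm_sq]; nlinarith [norm_nonneg a]
  have hz2 : Complex.normSq z < 1 := by
    rw [normSq_eq_norm_sq]; nlinarith [norm_nonneg z]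
  simp only [normSq_apply] at *
  simp
  nlinarith

theorem mob_inj {a z w : ℂ} (ha : ‖a‖ < 1) (hz : ‖z‖ < 1) (hw : ‖w‖ < 1) (h : mob a z = mob a w) :
    z = w := by
  rw [mob, mob, div_eq_div_iff (mob_den ha hz) (mob_den ha hw)] at h
  have h1 : (z - w) * (1 - (starRingEnd ℂ) a * a) = 0 := by linear_combination h
  rcases mul_eq_zero.1 h1 with h2 | h2
  · exact sub_eq_zero.1 h2
  · exact absurd h2 (mob_den ha ha)

theorem mob_deriv {a z : ℂ} (ha : ‖a‖ < 1) (hz : ‖z‖ < 1) :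
    HasDerivAt (mob a) ((1 - (starRingEnd ℂ) a * a) / (1 - (starRingEnd ℂ) a * z) ^ 2) z := by
  have h1 : HasDerivAt (fun z : ℂ => z - a) 1 z := (hasDerivAt_id z).sub_const a
  have h2 : HasDerivAt (fun z : ℂ => 1 - (starRingEnd ℂ) a * z) (-(starRingEnd ℂ) a) z := by
    simpa using ((hasDerivAt_id z).const_mul ((starRingEnd ℂ) a)).const_sub 1
  refine (h1.div h2 (mob_den ha hz)).congr_deriv ?_
  congr 1; ring

theorem mob_zero_iff {a z : ℂ} (ha : ‖a‖ < 1) (hz : ‖z‖ < 1) : mob a z = 0 ↔ z = a := by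
  rw [mob, div_eq_zero_iff, sub_eq_zero, or_iff_left (mob_den ha hz)]

theorem rmt {G : Set ℂ} (hG : IsOpen G) (hb : Bornology.IsBounded G) (hc : IsPreconnected G)
    (h0G : (0:ℂ) ∈ G) (hcc : IsPreconnected Gᶜ) :
    ∃ g : ℂ → ℂ, DifferentiableOn ℂ g (ball 0 1) ∧ InjOn g (ball 0 1) ∧ g '' ball 0 1 = G ∧ g 0 = 0 := by
  set 𝓕 : Set (ℂ → ℂ) := {f | DifferentiableOn ℂ f G ∧ InjOn f G ∧ MapsTo f G (ball 0 1) ∧ f 0 = 0} with h𝓕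
  obtain ⟨R, hR0, hR⟩ := hb.exists_pos_norm_le
  obtain ⟨ρ, hρ, hρG⟩ := Metric.isOpen_iff.1 hG 0 h0G
  set S : Set ℝ := (fun f : ℂ → ℂ => ‖deriv f 0‖) '' 𝓕 with hS
  have hmem : (fun z : ℂ => ((R + 1 : ℝ) : ℂ)⁻¹ * z) ∈ 𝓕 := by
    have hne : ((R + 1 : ℝ) : ℂ)⁻¹ ≠ 0 := inv_ne_zero (by exact_mod_cast (by positivity : (R + 1) ≠ 0))
    refine ⟨by fun_prop, fun x _ y _ h => mul_left_cancel₀ hne h, fun z hz => ?_, by simp⟩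
    rw [mem_ball_zero_iff, norm_mul, norm_inv, norm_real, norm_eq_abs,
      abs_of_pos (by positivity), inv_mul_lt_one₀ (by positivity)]
    linarith [hR z hz]
  have hbdd : BddAbove S := by
    refine ⟨1 / ρ, ?_⟩
    rintro _ ⟨f, ⟨h1, h2, h3, h4⟩, rfl⟩
    refine Complex.norm_deriv_le_div_of_mapsTo_ball (h1.mono hρG) (fun z hz => ?_) hρ
    rw [h4]; exact ball_subset_closedBall (h3 (hρG hz))
  have hSne : S.Nonempty := ⟨_, _, hmem, rfl⟩
  set M := sSup S with hM
  have hMpos : 0 < M := by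
    refine lt_of_lt_of_le ?_ (le_csSup hbdd ⟨_, hmem, rfl⟩)
    simp only [norm_pos_iff]
    rw [deriv_const_mul _ (by fun_prop)]
    simp only [deriv_id'', mul_one, ne_eq, inv_eq_zero]
    exact_mod_cast (by positivity : (R + 1) ≠ 0)
  obtain ⟨u, -, hu, huS⟩ := exists_seq_tendsto_sSup hSne hbdd
  choose fn hfn hfu using huS
  set 𝒰 : Ultrafilter ℕ := Filter.hyperfilter ℕ
  obtain ⟨f, hf⟩ := montel hG (fun n => (hfn n).1) (fun n => (hfn n).2.2.1) 𝒰
  have hfd : DifferentiableOn ℂ f G := hf.differentiableOn (Filter.Eventually.of_forall fun n => (hfn n).1) hG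
  have hder : ‖deriv f 0‖ = M := by
    have h1 := (hf.deriv (Filter.Eventually.of_forall fun n => (hfn n).1) hG).tendsto_at h0G
    have h2 : Filter.Tendsto u (𝒰 : Filter ℕ) (𝓝 M) := hu.mono_left Nat.hyperfilter_le_atTop
    refine tendsto_nhds_unique h1.norm (h2.congr fun n => ?_)
    rw [← hfu n]; rfl
  have hd0 : deriv f 0 ≠ 0 := by rw [← norm_pos_iff, hder]; exact hMpos
  have hinj := hurwitz hG hc (fun n => (hfn n).1) (fun n => (hfn n).2.1) hf hfd h0G hd0
  have hf0 : f 0 = 0 := by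
    refine tendsto_nhds_unique (hf.tendsto_at h0G) ?_
    simp only [(hfn _).2.2.2]; exact tendsto_const_nhds
  have hle : ∀ z ∈ G, ‖f z‖ ≤ 1 := by
    intro z hz
    refine le_of_tendsto (hf.tendsto_at hz).norm (Filter.Eventually.of_forall fun n => ?_)
    simpa using (mem_ball_zero_iff.1 ((hfn n).2.2.1 hz)).le
  have hmaps : MapsTo f G (ball 0 1) := by
    intro z hz
    rw [mem_ball_zero_iff]
    refine lt_of_le_of_ne (hle z hz) fun h => ?_
    have := Complex.norm_eqOn_of_isPreconnected_of_isMaxOn hc hG hfd hz (fun w hw => by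
      show ‖f w‖ ≤ ‖f z‖; rw [h]; exact hle w hw)
    have h2 : ‖f 0‖ = ‖f z‖ := this h0G
    rw [hf0, norm_zero, h] at h2
    exact zero_ne_one h2
  have hsurj : f '' G = ball 0 1 := by
    refine (image_subset_iff.2 hmaps).antisymm ?_
    intro w hw
    by_contra hwf
    rw [mem_ball_zero_iff] at hw
    have hfz : ∀ z ∈ G, ‖f z‖ < 1 := fun z hz => mem_ball_zero_iff.1 (hmaps hz)
    have hw0 : w ≠ 0 := fun h => hwf ⟨0, h0G, by rw [hf0, h]⟩
    set f1 : ℂ → ℂ := fun z => mob w (f z) with hf1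
    have hf1n : ∀ z ∈ G, ‖f1 z‖ < 1 := fun z hz => mob_norm hw (hfz z hz)
    have hf1d : DifferentiableOn ℂ f1 G := fun z hz =>
      ((mob_deriv hw (hfz z hz)).differentiableAt.comp_differentiableWithinAt z (hfd z hz))
    have hf10 : ∀ z ∈ G, f1 z ≠ 0 := fun z hz h =>
      hwf ⟨z, hz, (mob_zero_iff hw (hfz z hz)).1 h⟩
    obtain ⟨s, hsd, hs⟩ := exists_sqrt hG hf1d (HL_simply hG hb hc h0G hcc hf1d.continuousOn hf10)
    have hsn : ∀ z ∈ G, ‖s z‖ < 1 := by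
      intro z hz
      have := hf1n z hz
      rw [← hs z hz, norm_pow] at this
      exact (pow_lt_one_iff_of_nonneg (norm_nonneg _) two_ne_zero).1 this
    set f2 : ℂ → ℂ := fun z => mob (s 0) (s z) with hf2
    have hs0 := hsn 0 h0G
    have hf2mem : f2 ∈ 𝓕 := by
      refine ⟨fun z hz => ((mob_deriv hs0 (hsn z hz)).differentiableAt.comp_differentiableWithinAt z (hsd z hz)),
        fun x hx y hy h => ?_, fun z hz => mem_ball_zero_iff.2 (mob_norm hs0 (hsn z hz)),
        (mob_zero_iff hs0 hs0).2 rfl⟩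
      have h1 := mob_inj hs0 (hsn x hx) (hsn y hy) h
      have h2 : f1 x = f1 y := by rw [← hs x hx, ← hs y hy, h1]
      exact hinj hx hy (mob_inj hw (hfz x hx) (hfz y hy) h2)
    have hle2 : ‖deriv f2 0‖ ≤ M := le_csSup hbdd ⟨f2, hf2mem, rfl⟩
    have hfat := (hfd.differentiableAt (hG.mem_nhds h0G)).hasDerivAt
    have hsat := (hsd.differentiableAt (hG.mem_nhds h0G)).hasDerivAt
    have hd1 : HasDerivAt f1 ((1 - (starRingEnd ℂ) w * w) * deriv f 0) 0 := by
      have := (mob_deriv hw (hfz 0 h0G)).comp 0 hfat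
      refine this.congr_deriv ?_
      simp [hf0]
    have hd1' : HasDerivAt f1 (2 * s 0 * deriv s 0) 0 := by
      have := hsat.pow 2
      refine (this.congr_deriv (by ring)).congr_of_eventuallyEq ?_
      filter_upwards [hG.mem_nhds h0G] with z hz
      rw [← hs z hz]; rfl
    have heq := hd1.unique hd1'
    have hd2 : HasDerivAt f2 ((1 - (starRingEnd ℂ) (s 0) * (s 0))⁻¹ * deriv s 0) 0 := by
      refine ((mob_deriv hs0 hs0).comp 0 hsat).congr_deriv ?_
      have := mob_den hs0 hs0
      field_simp
    rw [hd2.deriv] at hle2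
    have hcc1 : ∀ v : ℂ, (1 - (starRingEnd ℂ) v * v) = ((1 - ‖v‖ ^ 2 : ℝ) : ℂ) := by
      intro v
      rw [mul_comm, mul_conj, normSq_eq_norm_sq]; push_cast; rfl
    set σ := ‖s 0‖ with hσ
    have hwσ : ‖w‖ = σ ^ 2 := by
      rw [hσ, ← norm_pow, hs 0 h0G, hf1]
      simp [mob, hf0]
    have hσ0 : 0 < σ := by
      have : 0 < σ ^ 2 := by rw [← hwσ]; exact norm_pos_iff.2 hw0
      rcases (norm_nonneg (s 0)).eq_or_lt with h | h
      · rw [hσ, ← h] at this; simp at this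
      · exact h
    have e1 := congrArg norm heq
    rw [hcc1, norm_mul, norm_mul, norm_mul, norm_real, norm_eq_abs, hder, hwσ,
      abs_of_pos (by nlinarith)] at e1
    rw [hcc1, norm_mul, norm_inv, norm_real, norm_eq_abs, ← hσ,
      abs_of_pos (by nlinarith), inv_mul_le_iff₀ (by nlinarith)] at hle2
    simp only [Complex.norm_ofNat] at e1
    rw [← hσ] at e1
    have h5 : (1 - σ ^ 2) * (1 + σ ^ 2) * M ≤ 2 * σ * ((1 - σ ^ 2) * M) := by
      calc (1 - σ ^ 2) * (1 + σ ^ 2) * M = (1 - (σ ^ 2) ^ 2) * M := by ring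
        _ = 2 * σ * ‖deriv s 0‖ := e1
        _ ≤ _ := by gcongr
    have h6 : 0 < (1 - σ ^ 2) * M := mul_pos (by nlinarith) hMpos
    have h7 : 0 < (1 - σ) ^ 2 := by have : 0 < 1 - σ := by linarith
                                    positivity
    nlinarith
  obtain ⟨-, g, hgd, hg⟩ := inj_holo_inverse hG hfd hinj
  rw [hsurj] at hgd
  refine ⟨g, hgd, ?_, ?_, ?_⟩
  · rw [← hsurj]
    rintro _ ⟨x, hx, rfl⟩ _ ⟨y, hy, rfl⟩ h
    rw [hg x hx, hg y hy] at h; rw [h]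
  · rw [← hsurj, image_image]
    ext z; constructor
    · rintro ⟨x, hx, rfl⟩; simp only [hg x hx]; exact hx
    · intro hz; exact ⟨z, hz, hg z hz⟩
  · have := hg 0 h0G; rwa [hf0] at this

def strip : Set ℂ := {s | |s.im| < π / 2}

theorem strip_open : IsOpen strip := isOpen_lt (by fun_prop) continuous_const

open MeasureTheory in
theorem length_area {h : ℂ → ℂ} (hd : DifferentiableOn ℂ h strip) (hi : InjOn h strip)
    (hb : Bornology.IsBounded (h '' strip)) {η : ℝ} (hη : 0 < η) (N : ℝ) :
    ∃ x > N, ∀ θ₁ ∈ Ioo (-(π / 2)) (π / 2), ∀ θ₂ ∈ Ioo (-(π / 2)) (π / 2),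
      dist (h (x + θ₁ * Complex.I)) (h (x + θ₂ * Complex.I)) ≤ 3 * η := by
  set I := Ioo (-(π / 2)) (π / 2) with hI
  have hmemS : ∀ x : ℝ, ∀ θ ∈ I, (x + θ * Complex.I : ℂ) ∈ strip := by
    intro x θ hθ
    simp only [strip, mem_ofPred_eq, add_im, ofReal_im, mul_im,
      ofReal_re, Complex.I_im, Complex.I_re]
    rw [abs_lt]; constructor <;> simp <;> linarith [hθ.1, hθ.2]
  have hdc : ContinuousOn (deriv h) strip := (hd.deriv strip_open).continuousOn
  have harea : ∫⁻ s in strip, ENNReal.ofReal (‖deriv h s‖ ^ 2) = volume (h '' strip) := by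
    rw [← lintegral_abs_det_fderiv_eq_addHaar_image volume strip_open.measurableSet
      (f := h) (f' := fun s => ((ContinuousLinearMap.toSpanSingleton ℂ (deriv h s)).restrictScalars ℝ)) ?_ hi]
    · congr 1
      ext s
      congr 1
      have : ((ContinuousLinearMap.toSpanSingleton ℂ (deriv h s)).restrictScalars ℝ).det = ‖deriv h s‖ ^ 2 := by
        simp [ContinuousLinearMap.det, LinearMap.det_restrictScalars, ← normSq_eq_norm_sq,
          Algebra.norm_complex_apply, normSq_apply]
      rw [this, abs_of_nonneg (by positivity)]
    · intro s hs
      exact ((hd.differentiableAt (strip_open.mem_nhds hs)).hasDerivAt.hasFDerivAt.restrictScalars ℝ).hasFDerivWithinAt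
  have hfin : volume (h '' strip) < ⊤ := hb.measure_lt_top
  set Φ : ℝ × ℝ → ENNReal := fun p => ENNReal.ofReal (‖deriv h (p.1 + p.2 * Complex.I)‖ ^ 2) with hΦ
  have hfub : ∫⁻ p in (Ioi N ×ˢ I), Φ p < ⊤ := by
    refine lt_of_le_of_lt ?_ (harea ▸ hfin)
    rw [← (Complex.volume_preserving_equiv_real_prod.symm).setLIntegral_comp_preimage_emb
      (MeasurableEquiv.measurableEmbedding _)]
    have : ∀ p : ℝ × ℝ, ENNReal.ofReal (‖deriv h (Complex.measurableEquivRealProd.symm p)‖ ^ 2) = Φ p := by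
      intro p
      rw [Complex.measurableEquivRealProd_symm_apply, Complex.mk_eq_add_mul_I]
    simp only [this]
    refine lintegral_mono_set ?_
    rintro ⟨x, θ⟩ ⟨-, hθ⟩
    have := hmemS x θ hθ
    rw [mem_preimage, Complex.measurableEquivRealProd_symm_apply, Complex.mk_eq_add_mul_I]
    exact this
  have hcontΦ : ContinuousOn Φ (Ioi N ×ˢ I) := by
    refine ENNReal.continuous_ofReal.comp_continuousOn ((ContinuousOn.norm ?_).pow 2)
    refine hdc.comp (by fun_prop) ?_
    rintro ⟨x, θ⟩ ⟨-, hθ⟩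
    exact hmemS x θ hθ
  have hmeas : AEMeasurable Φ ((volume.prod volume).restrict (Ioi N ×ˢ I)) :=
    hcontΦ.aemeasurable (measurableSet_Ioi.prod measurableSet_Ioo)
  have hfub2 : ∫⁻ x in Ioi N, ∫⁻ θ in I, Φ (x, θ) < ⊤ := by
    rw [← setLIntegral_prod Φ hmeas]; exact hfub
  obtain ⟨x, hxN, hx⟩ : ∃ x > N, ∫⁻ θ in I, Φ (x, θ) < ENNReal.ofReal (η ^ 2) := by
    by_contra! hcon
    have : ∫⁻ _ in Ioi N, ENNReal.ofReal (η ^ 2) ≤ ∫⁻ x in Ioi N, ∫⁻ θ in I, Φ (x, θ) :=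
      setLIntegral_mono' measurableSet_Ioi fun x hx => hcon x hx
    rw [setLIntegral_const, Real.volume_Ioi, ENNReal.mul_top (by simp; positivity)] at this
    exact absurd hfub2 (not_lt.2 this)
  refine ⟨x, hxN, ?_⟩
  have key : ∀ θ₁ ∈ I, ∀ θ₂ ∈ I, θ₁ ≤ θ₂ →
      dist (h (x + θ₂ * Complex.I)) (h (x + θ₁ * Complex.I)) ≤ 3 * η := by
    intro θ₁ h1 θ₂ h2 h12
    have hsub : Icc θ₁ θ₂ ⊆ I := fun t ht => ⟨h1.1.trans_le ht.1, ht.2.trans_lt h2.2⟩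
    have hder : ∀ t ∈ uIcc θ₁ θ₂, HasDerivAt (fun t : ℝ => h (x + t * Complex.I))
        (deriv h (x + t * Complex.I) * Complex.I) t := by
      intro t ht
      rw [uIcc_of_le h12] at ht
      have e1 := (hd.differentiableAt (strip_open.mem_nhds (hmemS x t (hsub ht)))).hasDerivAt
      have e2 : HasDerivAt (fun t : ℝ => (x + t * Complex.I : ℂ)) Complex.I t := by
        simpa using ((Complex.ofRealCLM.hasDerivAt (x := t)).mul_const Complex.I).const_add (x : ℂ)
      exact e1.comp t e2
    have hcont : ContinuousOn (fun t : ℝ => deriv h (x + t * Complex.I)) (Icc θ₁ θ₂) :=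
      hdc.comp (by fun_prop) fun t ht => hmemS x t (hsub ht)
    have hcont' := hcont
    rw [← uIcc_of_le h12] at hcont'
    have hftc := intervalIntegral.integral_eq_sub_of_hasDerivAt hder
      ((hcont'.mul continuousOn_const).intervalIntegrable)
    rw [dist_eq_norm, ← hftc]
    have hI2 : ∫ t in θ₁..θ₂, ‖deriv h (x + t * Complex.I)‖ ^ 2 ≤ η ^ 2 := by
      rw [intervalIntegral.integral_of_le h12]
      rw [← ENNReal.ofReal_le_ofReal_iff (by positivity)]
      rw [ofReal_integral_eq_lintegral_ofReal]
      · refine le_trans ?_ hx.le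
        exact lintegral_mono_set (Ioc_subset_Icc_self.trans hsub)
      · exact ((hcont.norm.pow 2).integrableOn_Icc).mono_set Ioc_subset_Icc_self
      · exact Filter.Eventually.of_forall fun t => by positivity
    calc ‖∫ t in θ₁..θ₂, deriv h (x + t * Complex.I) * Complex.I‖
        ≤ ∫ t in θ₁..θ₂, ‖deriv h (x + t * Complex.I) * Complex.I‖ :=
          intervalIntegral.norm_integral_le_integral_norm h12
      _ ≤ ∫ t in θ₁..θ₂, (η / 2 + (1 / (2 * η)) * ‖deriv h (x + t * Complex.I)‖ ^ 2) := by
          refine intervalIntegral.integral_mono_on h12 ?_ ?_ ?_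
          · exact ((hcont'.mul continuousOn_const).norm).intervalIntegrable
          · exact (continuousOn_const.add (continuousOn_const.mul (hcont'.norm.pow 2))).intervalIntegrable
          · intro t _
            rw [norm_mul, Complex.norm_I, mul_one]
            set d := ‖deriv h (x + t * Complex.I)‖
            have : η / 2 + 1 / (2 * η) * d ^ 2 - d = (η - d) ^ 2 / (2 * η) := by field_simp; ring
            have h0 : 0 ≤ (η - d) ^ 2 / (2 * η) := by positivity
            linarith
      _ = (θ₂ - θ₁) * (η / 2) + 1 / (2 * η) * ∫ t in θ₁..θ₂, ‖deriv h (x + t * Complex.I)‖ ^ 2 := by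
          rw [intervalIntegral.integral_add, intervalIntegral.integral_const,
            intervalIntegral.integral_const_mul, smul_eq_mul]
          · exact continuousOn_const.intervalIntegrable
          · exact (continuousOn_const.mul (hcont'.norm.pow 2)).intervalIntegrable
      _ ≤ 4 * (η / 2) + 1 / (2 * η) * η ^ 2 := by
          gcongr
          have := Real.pi_le_four
          linarith [h1.1, h2.2]
      _ ≤ 3 * η := by
          have : 1 / (2 * η) * η ^ 2 = η / 2 := by field_simp
          rw [this]; linarith
  intro θ₁ h1 θ₂ h2
  rcases le_total θ₁ θ₂ with h | h
  · rw [dist_comm]; exact key _ h1 _ h2 h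
  · exact key _ h2 _ h1 h

def tau (s : ℂ) : ℂ := (Complex.exp s - 1) / (Complex.exp s + 1)

theorem exp_re_pos {s : ℂ} (hs : s ∈ strip) : 0 < (Complex.exp s).re := by
  rw [Complex.exp_re]
  have hs' : |s.im| < π / 2 := hs
  rw [abs_lt] at hs'
  exact mul_pos (exp_pos _) (Real.cos_pos_of_mem_Ioo ⟨by linarith, hs'.2⟩)

theorem exp_add_one_ne {s : ℂ} (hs : s ∈ strip) : Complex.exp s + 1 ≠ 0 := by
  intro h
  have h1 := exp_re_pos hs
  have h2 := congrArg Complex.re h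
  simp at h2
  linarith

theorem tau_mem {s : ℂ} (hs : s ∈ strip) : ‖tau s‖ < 1 := by
  have h1 := exp_re_pos hs
  rw [tau, norm_div, div_lt_one (norm_pos_iff.2 (exp_add_one_ne hs)),
    ← sq_lt_sq₀ (norm_nonneg _) (norm_nonneg _), ← normSq_eq_norm_sq, ← normSq_eq_norm_sq]
  simp only [normSq_apply, sub_re, sub_im, add_re, add_im,
    Complex.one_re, Complex.one_im]
  nlinarith

theorem tau_diff : DifferentiableOn ℂ tau strip := fun s hs =>
  (((Complex.differentiable_exp s).sub_const 1).div ((Complex.differentiable_exp s).add_const 1)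
    (exp_add_one_ne hs)).differentiableWithinAt

theorem tau_inj : InjOn tau strip := by
  intro s hs t ht h
  rw [tau, tau, div_eq_div_iff (exp_add_one_ne hs) (exp_add_one_ne ht)] at h
  have h1 : Complex.exp s = Complex.exp t := by linear_combination (1/2) * h
  have hs' : |s.im| < π / 2 := hs
  have ht' : |t.im| < π / 2 := ht
  rw [abs_lt] at hs' ht'
  have hpi := pi_pos
  rw [← log_exp (x := s) (by linarith) (by linarith), h1,
    log_exp (by linarith) (by linarith)]

theorem tau_inv {z : ℂ} (hz : ‖z‖ < 1) : Complex.log ((1 + z) / (1 - z)) ∈ strip ∧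
    tau (Complex.log ((1 + z) / (1 - z))) = z := by
  have h1 : 1 - z ≠ 0 := by
    intro h; rw [← sub_eq_zero.1 h] at hz; simp at hz
  have h2 : 1 + z ≠ 0 := by
    intro h
    rw [show z = -1 by linear_combination h] at hz; simp at hz
  have hre : 0 < ((1 + z) / (1 - z)).re := by
    have e : (1 + z) / (1 - z) = ((1 + z) * (starRingEnd ℂ) (1 - z)) / ((Complex.normSq (1 - z) : ℝ) : ℂ) := by
      rw [← mul_conj, mul_div_mul_right _ _ ((map_ne_zero _).2 h1)]
    rw [e, Complex.div_ofReal_re]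
    refine div_pos ?_ (Complex.normSq_pos.2 h1)
    have hn : z.re ^ 2 + z.im ^ 2 < 1 := by
      have : Complex.normSq z < 1 := by rw [normSq_eq_norm_sq]; nlinarith [norm_nonneg z]
      rw [normSq_apply] at this; linarith
    simp
    nlinarith
  constructor
  · show |(Complex.log _).im| < _
    rw [Complex.log_im]
    exact Complex.abs_arg_lt_pi_div_two_iff.2 (Or.inl hre)
  · rw [tau, exp_log (div_ne_zero h2 h1)]
    field_simp
    ring

theorem tau_image : tau '' strip = ball 0 1 := by
  ext z
  rw [mem_ball_zero_iff]
  constructor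
  · rintro ⟨s, hs, rfl⟩; exact tau_mem hs
  · intro hz; exact ⟨_, (tau_inv hz).1, (tau_inv hz).2⟩

theorem IsJCurve.small_arc {X : Set ℂ} (h : IsJCurve X) {ε : ℝ} (hε : 0 < ε) : ∃ δ > 0, ∀ e ∈ X,
    ∃ B ⊆ X, IsCompact B ∧ IsPreconnected B ∧ X ∩ ball e δ ⊆ B ∧ B ⊆ closedBall e ε := by
  have hXc := h.isCompact
  obtain ⟨γ, hc, hi, rfl⟩ := h
  obtain ⟨τ, hτ, hτγ⟩ := Metric.uniformContinuous_iff.1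
    (CompactSpace.uniformContinuous_of_continuous hc) ε hε
  obtain ⟨t0, ht0, ht0'⟩ : ∃ t0 > 0, ∀ t : ℝ, |t| ≤ t0 → ‖(Circle.exp t : ℂ) - 1‖ < τ := by
    have hcont : Continuous fun t : ℝ => ‖(Circle.exp t : ℂ) - 1‖ := by fun_prop
    have : ∀ᶠ t in 𝓝 (0:ℝ), ‖(Circle.exp t : ℂ) - 1‖ < τ :=
      hcont.continuousAt.eventually (gt_mem_nhds (by simpa using hτ))
    obtain ⟨r, hr, hr'⟩ := Metric.nhds_basis_closedBall.mem_iff.1 this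
    exact ⟨r, hr, fun t ht => hr' (by simpa using ht)⟩
  obtain ⟨τ', hτ', hτ''⟩ : ∃ τ' > 0, ∀ w : Circle, ‖(w : ℂ) - 1‖ < τ' → |Complex.arg w| ≤ t0 := by
    have hca : ContinuousAt Complex.arg 1 := Complex.continuousAt_arg Complex.one_mem_slitPlane
    have : ∀ᶠ w in 𝓝 (1:ℂ), dist (Complex.arg w) (Complex.arg 1) < t0 := hca (ball_mem_nhds _ ht0)
    obtain ⟨r, hr, hr'⟩ := Metric.mem_nhds_iff.1 this
    refine ⟨r, hr, fun w hw => ?_⟩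
    have h1 : dist (Complex.arg w) (Complex.arg 1) < t0 := hr' (by rwa [mem_ball, dist_eq_norm])
    rw [Complex.arg_one, dist_eq, sub_zero] at h1
    exact h1.le
  have hd : ∀ x ∈ (univ : Set Circle), Function.invFun γ (γ x) = x :=
    fun x _ => Function.leftInverse_invFun hi x
  have hinv := continuousOn_inv_image isCompact_univ hc.continuousOn hd
  rw [image_univ] at hinv
  obtain ⟨δ, hδ, hδ'⟩ := Metric.uniformContinuousOn_iff.1
    (hXc.uniformContinuousOn_of_continuous hinv) τ' hτ'
  refine ⟨δ, hδ, ?_⟩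
  rintro _ ⟨u, rfl⟩
  have hdist : ∀ a b : Circle, dist a b = ‖((b⁻¹ * a : Circle) : ℂ) - 1‖ := by
    intro a b
    have e1 : dist a b = ‖(a : ℂ) - b‖ := dist_eq_norm (a : ℂ) (b : ℂ)
    rw [e1, Circle.coe_mul, Circle.coe_inv]
    have hb := Circle.coe_ne_zero b
    rw [show ((b : ℂ)⁻¹ * a - 1) = (b : ℂ)⁻¹ * (a - b) by field_simp, norm_mul, norm_inv, Circle.norm_coe]
    simp
  refine ⟨(fun t : ℝ => γ (u * Circle.exp t)) '' Icc (-t0) t0, ?_, ?_, ?_, ?_, ?_⟩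
  · rintro _ ⟨t, -, rfl⟩; exact ⟨_, rfl⟩
  · exact isCompact_Icc.image (by fun_prop)
  · exact isPreconnected_Icc.image _ (by fun_prop)
  · rintro _ ⟨⟨v, rfl⟩, hv⟩
    have h1 := hδ' (γ v) ⟨v, rfl⟩ (γ u) ⟨u, rfl⟩ hv
    rw [hd v trivial, hd u trivial, hdist] at h1
    have h2 := hτ'' _ h1
    rw [abs_le] at h2
    refine ⟨_, h2, ?_⟩
    simp only [Circle.exp_arg, mul_inv_cancel_left]
  · rintro _ ⟨t, ht, rfl⟩
    refine (hτγ ?_).le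
    rw [hdist, inv_mul_cancel_left]
    exact ht0' t (abs_le.2 ht)

theorem isPreconnected_compl_closedBall (c : ℂ) {r : ℝ} (hr : 0 < r) :
    IsPreconnected (closedBall c r)ᶜ := by
  have : (closedBall c r)ᶜ = (fun z => z + c) '' {z : ℂ | r < ‖z‖} := by
    ext z
    simp only [mem_compl_iff, mem_closedBall, not_le, mem_image, mem_ofPred_eq, dist_eq_norm]
    constructor
    · intro h; exact ⟨z - c, h, by ring⟩
    · rintro ⟨w, hw, rfl⟩; simpa using hw
  rw [this]
  exact (isPreconnected_norm_gt hr).image _ (by fun_prop)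

theorem cara_osc {X : Set ℂ} (h : IsJCurve X) (he : Ess X) {g : ℂ → ℂ}
    (hgd : DifferentiableOn ℂ g (ball 0 1)) (hgi : InjOn g (ball 0 1)) (hgG : g '' ball 0 1 = inn X)
    (hg0 : g 0 = 0) {ζ : ℂ} (hζ : ‖ζ‖ = 1) {ε : ℝ} (hε : 0 < ε) :
    ∃ c : ℂ, ∃ N : ℝ, ∀ s ∈ strip, N < s.re → dist (g (ζ * tau s)) c ≤ ε := by
  set k : ℂ → ℂ := fun s => g (ζ * tau s) with hk
  have hζ0 : ζ ≠ 0 := by rw [← norm_pos_iff, hζ]; exact one_pos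
  have hmaps : ∀ s ∈ strip, ζ * tau s ∈ ball (0:ℂ) 1 := fun s hs => by
    rw [mem_ball_zero_iff, norm_mul, hζ, one_mul]; exact tau_mem hs
  have hkd : DifferentiableOn ℂ k strip := hgd.comp (tau_diff.const_mul ζ) hmaps
  have hki : InjOn k strip := fun s hs t ht hst =>
    tau_inj hs ht (mul_left_cancel₀ hζ0 (hgi (hmaps s hs) (hmaps t ht) hst))
  have hkG : k '' strip = inn X := by
    rw [← hgG]
    ext w; constructor
    · rintro ⟨s, hs, rfl⟩; exact ⟨_, hmaps s hs, rfl⟩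
    · rintro ⟨z, hz, rfl⟩
      have hz1 : ‖z / ζ‖ < 1 := by
        rw [norm_div, hζ, div_one]; exact mem_ball_zero_iff.1 hz
      refine ⟨_, (tau_inv hz1).1, ?_⟩
      simp only [hk]
      rw [(tau_inv hz1).2, mul_div_cancel₀ _ hζ0]
  have h0s : (0:ℂ) ∈ strip := by simp [strip, pi_pos]
  have hk0 : k 0 = 0 := by simp [hk, tau, hg0]
  have hIo := inn_open h
  obtain ⟨-, f, hfd, hf⟩ := inj_holo_inverse isOpen_ball hgd hgi
  obtain ⟨-, q, hqd, hq⟩ := inj_holo_inverse strip_open hkd hki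
  rw [hgG] at hfd
  rw [hkG] at hqd
  obtain ⟨d, hd0, hdG⟩ := Metric.nhds_basis_closedBall.mem_iff.1 (hIo.mem_nhds (zero_mem_inn he))
  obtain ⟨ρ, hρ1, hρ⟩ : ∃ ρ < 1, ∀ z ∈ ball (0:ℂ) 1, ρ < ‖z‖ → d < ‖g z‖ := by
    have hfK : ContinuousOn (fun w => ‖f w‖) (closedBall 0 d) := (hfd.continuousOn.mono hdG).norm
    obtain ⟨w, hw, hmax⟩ := (isCompact_closedBall (0:ℂ) d).exists_isMaxOn
      ⟨0, mem_closedBall_self hd0.le⟩ hfK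
    refine ⟨‖f w‖, ?_, fun z hz hzn => ?_⟩
    · obtain ⟨z, hz, hzw⟩ := hgG.symm ▸ hdG hw
      rw [← hzw, hf z hz]; exact mem_ball_zero_iff.1 hz
    · by_contra! hcon
      have : ‖f (g z)‖ ≤ ‖f w‖ := hmax (mem_closedBall_zero_iff.2 hcon)
      rw [hf z hz] at this
      linarith
  obtain ⟨N0, hN0, hN⟩ : ∃ N0 : ℝ, 0 ≤ N0 ∧ ∀ x : ℝ, N0 < x → ρ < ‖tau x‖ := by
    have h1 : Filter.Tendsto (fun x : ℝ => (Real.exp x - 1) / (Real.exp x + 1)) Filter.atTop (𝓝 1) := by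
      have e : (fun x : ℝ => (Real.exp x - 1) / (Real.exp x + 1)) = fun x => 1 - 2 / (Real.exp x + 1) := by
        ext x
        have : Real.exp x + 1 ≠ 0 := by positivity
        field_simp; ring
      rw [e]
      have : Filter.Tendsto (fun x : ℝ => 2 / (Real.exp x + 1)) Filter.atTop (𝓝 0) :=
        Filter.Tendsto.div_atTop tendsto_const_nhds
          (Filter.tendsto_atTop_add_const_right _ _ Real.tendsto_exp_atTop)
      simpa using this.const_sub 1
    obtain ⟨N, hN⟩ := Filter.eventually_atTop.1 (h1.eventually (lt_mem_nhds hρ1))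
    refine ⟨max N 0, le_max_right _ _, fun x hx => ?_⟩
    refine lt_of_lt_of_le (hN x ((le_max_left _ _).trans hx.le)) ?_
    have : tau x = (((Real.exp x - 1) / (Real.exp x + 1) : ℝ) : ℂ) := by
      simp [tau]
    rw [this, norm_real]
    exact le_abs_self _
  set ε1 := min ε d with hε1
  have hε1p : 0 < ε1 := lt_min hε hd0
  obtain ⟨δ, hδ, harc⟩ := h.small_arc (ε := ε1 / 2) (by positivity)
  set η := min (δ / 7) (ε1 / 7) with hη
  have hηp : 0 < η := by positivity
  have hη1 : η ≤ δ / 7 := min_le_left _ _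
  have hη2 : η ≤ ε1 / 7 := min_le_right _ _
  obtain ⟨x, hxN, hosc⟩ := length_area hkd hki (hkG ▸ inn_bdd h he) hηp N0
  set I := Ioo (-(π / 2)) (π / 2) with hI
  set c := k x with hc
  have h0I : (0:ℝ) ∈ I := ⟨by linarith [pi_pos], by linarith [pi_pos]⟩
  have hxs : ((x : ℝ) : ℂ) ∈ strip := by simp [strip, pi_pos]
  have hcn : ε1 < ‖c‖ := by
    refine lt_of_le_of_lt (min_le_right _ _) (hρ _ (hmaps _ hxs) ?_)
    rw [norm_mul, hζ, one_mul]
    exact hN x hxN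
  set C := (fun θ : ℝ => k (x + θ * Complex.I)) '' I with hC
  have hCb : closure C ⊆ closedBall c (3 * η) := by
    refine closure_minimal ?_ isClosed_closedBall
    rintro _ ⟨θ, hθ, rfl⟩
    have := hosc θ hθ 0 h0I
    simpa using this
  have hCcomp : IsCompact (closure C) :=
    (isCompact_closedBall c (3 * η)).of_isClosed_subset isClosed_closure hCb
  obtain ⟨B, hBX, hBc, hBp, hCB, hBb⟩ : ∃ B ⊆ X, IsCompact B ∧ IsPreconnected B ∧
      X ∩ closure C ⊆ B ∧ B ⊆ closedBall c ε1 := by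
    rcases (X ∩ closure C).eq_empty_or_nonempty with hemp | ⟨e, heX, heC⟩
    · exact ⟨∅, empty_subset _, isCompact_empty, isPreconnected_empty, hemp.subset, empty_subset _⟩
    · obtain ⟨B, hBX, hBc, hBp, h1, h2⟩ := harc e heX
      refine ⟨B, hBX, hBc, hBp, ?_, ?_⟩
      · rintro y ⟨hyX, hyC⟩
        refine h1 ⟨hyX, ?_⟩
        have e1 := hCb hyC
        have e2 := hCb heC
        rw [mem_closedBall] at e1 e2
        rw [mem_ball]
        have := dist_triangle_right y e c
        linarith
      · intro y hy
        have e1 := h2 hy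
        have e2 := hCb heC
        rw [mem_closedBall] at e1 e2 ⊢
        have := dist_triangle y e c
        linarith
  have hYb : B ∪ closure C ⊆ closedBall c ε1 :=
    union_subset hBb (hCb.trans (closedBall_subset_closedBall (by linarith)))
  have hXY : X ∩ (B ∪ closure C) = B := by
    ext y; constructor
    · rintro ⟨hy, hy' | hy'⟩
      · exact hy'
      · exact hCB ⟨hy, hy'⟩
    · intro hy; exact ⟨hBX hy, Or.inl hy⟩
  refine ⟨c, x, fun s hs hsx => ?_⟩
  by_contra hcon
  push Not at hcon
  have hp : k s ∉ closedBall c ε1 := fun hh => absurd ((mem_closedBall.1 hh).trans (min_le_left _ _)) (not_le.2 hcon)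
  have h0 : (0:ℂ) ∉ closedBall c ε1 := by
    rw [mem_closedBall, dist_zero_left, not_le]; exact hcn
  have hj1 : JoinedIn Xᶜ 0 (k s) := (joinedIn_iff_comp h.isCompact.isClosed.isOpen_compl he.1).2
    (show k s ∈ inn X from hkG ▸ mem_image_of_mem k hs)
  have hj2 : JoinedIn (B ∪ closure C)ᶜ 0 (k s) := by
    refine JoinedIn.mono ?_ (compl_subset_compl.2 hYb)
    rw [joinedIn_iff_comp isClosed_closedBall.isOpen_compl h0]
    exact (isPreconnected_compl_closedBall c hε1p).subset_connectedComponentIn h0 subset_rfl hp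
  have hj := janiszewski h.isCompact (hBc.union hCcomp) (hXY.symm ▸ hBp) hj1 hj2
  obtain ⟨σ, hσ⟩ := hj
  have hT : range σ ⊆ inn X := by
    refine (isPreconnected_range σ.continuous).subset_connectedComponentIn ⟨0, σ.source⟩ ?_
    rintro _ ⟨t, rfl⟩ hh
    exact hσ t (Or.inl hh)
  have hre : ContinuousOn (fun w => (q w).re) (range σ) :=
    continuous_re.comp_continuousOn (hqd.continuousOn.mono hT)
  have hiv := (isPreconnected_range σ.continuous).intermediate_value
    (⟨0, σ.source⟩ : (0:ℂ) ∈ range σ) (⟨1, σ.target⟩ : k s ∈ range σ) hre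
  have hq0 : q 0 = 0 := by have := hq 0 h0s; rwa [hk0] at this
  obtain ⟨w, hw, hwx⟩ := hiv (show x ∈ Icc _ _ from ⟨by rw [hq0]; simp; linarith, by rw [hq s hs]; exact hsx.le⟩)
  obtain ⟨s', hs', rfl⟩ := hkG.symm ▸ hT hw
  simp only [hq s' hs'] at hwx
  obtain ⟨t, ht⟩ := hw
  apply hσ t
  rw [ht]
  right; right
  refine subset_closure ⟨s'.im, abs_lt.1 hs', ?_⟩
  simp only
  rw [← hwx, Complex.re_add_im]

theorem cara_ext {X : Set ℂ} (h : IsJCurve X) (he : Ess X) {g : ℂ → ℂ}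
    (hgd : DifferentiableOn ℂ g (ball 0 1)) (hgi : InjOn g (ball 0 1)) (hgG : g '' ball 0 1 = inn X)
    (hg0 : g 0 = 0) : ∃ G : ℂ → ℂ, ContinuousOn G (closedBall 0 1) ∧ (∀ z ∈ ball (0:ℂ) 1, G z = g z) ∧
      G '' sphere 0 1 = X := by
  have hlim : ∀ ζ : ℂ, ‖ζ‖ = 1 → ∃ y, Filter.Tendsto g (𝓝[ball 0 1] ζ) (𝓝 y) := by
    intro ζ hζ
    have hζ0 : ζ ≠ 0 := by rw [← norm_pos_iff, hζ]; exact one_pos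
    have hne : (𝓝[ball 0 1] ζ).NeBot := by
      rw [← mem_closure_iff_nhdsWithin_neBot, closure_ball _ one_ne_zero]
      simp [hζ]
    apply cauchy_map_iff_exists_tendsto.1
    rw [Metric.cauchy_iff]
    refine ⟨Filter.map_neBot, fun ε hε => ?_⟩
    obtain ⟨c, N, hN⟩ := cara_osc h he hgd hgi hgG hg0 hζ (ε := ε / 3) (by positivity)
    refine ⟨closedBall c (ε / 3), ?_, fun x hx y hy => ?_⟩
    · rw [Filter.mem_map, mem_nhdsWithin]
      refine ⟨ball ζ (min 1 (Real.exp (-N))), isOpen_ball, mem_ball_self (by positivity), ?_⟩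
      rintro z ⟨hz1, hz2⟩
      rw [mem_ball_zero_iff] at hz2
      rw [mem_ball, dist_eq_norm, lt_min_iff] at hz1
      set w := z / ζ with hw
      have hzw : z = ζ * w := by rw [hw]; field_simp
      have hwn : ‖w‖ < 1 := by rw [hw, norm_div, hζ, div_one]; exact hz2
      have h1w : ‖1 - w‖ = ‖z - ζ‖ := by
        rw [hzw, show ζ * w - ζ = ζ * (w - 1) by ring, norm_mul, hζ, one_mul, norm_sub_rev]
      obtain ⟨hs, ht⟩ := tau_inv hwn
      have hne1 : 1 - w ≠ 0 := fun h0 => by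
        rw [← sub_eq_zero.1 h0] at hwn; simp at hwn
      have h1w' : 0 < ‖1 - w‖ := norm_pos_iff.2 hne1
      have h2w : 1 < ‖1 + w‖ := by
        have : ‖(2:ℂ)‖ ≤ ‖1 + w‖ + ‖1 - w‖ := by
          rw [show (2:ℂ) = (1 + w) + (1 - w) by ring]; exact norm_add_le _ _
        have h2 : ‖(2:ℂ)‖ = 2 := by simp
        rw [h2] at this
        linarith [hz1.1]
      have := hN _ hs (by
        rw [log_re, norm_div, Real.log_div (by linarith) h1w'.ne']
        have a1 : 0 < Real.log ‖1 + w‖ := Real.log_pos h2w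
        have a2 : Real.log ‖1 - w‖ < -N := by
          rw [Real.log_lt_iff_lt_exp h1w', h1w]; exact hz1.2
        linarith)
      rw [ht, ← hzw] at this
      exact this
    · have h1 := mem_closedBall.1 hx
      have h2 := mem_closedBall.1 hy
      linarith [dist_triangle_right x y c]
  have hcl : closure (ball (0:ℂ) 1) = closedBall 0 1 := closure_ball _ one_ne_zero
  refine ⟨extendFrom (ball 0 1) g, ?_, ?_, ?_⟩
  · apply continuousOn_extendFrom hcl.symm.subset
    intro x hx
    rw [mem_closedBall_zero_iff] at hx
    rcases hx.lt_or_eq with h1 | h1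
    · exact ⟨g x, hgd.continuousOn x (by simpa using h1)⟩
    · exact hlim x h1
  · intro z hz
    exact extendFrom_extends hgd.continuousOn z hz
  · set G := extendFrom (ball 0 1) g with hG
    have hGc : ContinuousOn G (closedBall 0 1) := by
      apply continuousOn_extendFrom hcl.symm.subset
      intro x hx
      rw [mem_closedBall_zero_iff] at hx
      rcases hx.lt_or_eq with h1 | h1
      · exact ⟨g x, hgd.continuousOn x (by simpa using h1)⟩
      · exact hlim x h1
    have hGg : ∀ z ∈ ball (0:ℂ) 1, G z = g z := fun z hz => extendFrom_extends hgd.continuousOn z hz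
    have hGim : G '' ball 0 1 = inn X := by rw [← hgG]; exact image_congr hGg
    have himg : G '' closedBall 0 1 = X ∪ inn X := by
      rw [← closure_inn h he]
      apply subset_antisymm
      · rw [← hcl, ← hGim]
        exact ContinuousOn.image_closure (hcl ▸ hGc)
      · apply closure_minimal _ ((isCompact_closedBall _ _).image_of_continuousOn hGc).isClosed
        rw [← hGim]; exact image_mono ball_subset_closedBall
    obtain ⟨-, f, hfd, hf⟩ := inj_holo_inverse isOpen_ball hgd hgi
    rw [hgG] at hfd
    have hout : ∀ z ∈ sphere (0:ℂ) 1, G z ∉ inn X := by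
      intro z hz hzi
      have hfc : ContinuousAt f (G z) := (hfd.continuousOn).continuousAt ((inn_open h).mem_nhds hzi)
      have hne : (𝓝[ball 0 1] z).NeBot := by
        rw [← mem_closure_iff_nhdsWithin_neBot, hcl]; exact sphere_subset_closedBall hz
      have t1 : Filter.Tendsto G (𝓝[ball 0 1] z) (𝓝 (G z)) :=
        ((hGc z (sphere_subset_closedBall hz)).mono ball_subset_closedBall)
      have t2 := hfc.tendsto.comp t1
      have t3 : Filter.Tendsto (f ∘ G) (𝓝[ball 0 1] z) (𝓝 z) := by
        refine Filter.Tendsto.congr' ?_ (Filter.tendsto_id.mono_left nhdsWithin_le_nhds)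
        filter_upwards [self_mem_nhdsWithin] with w hw
        simp only [id, Function.comp, hGg w hw, hf w hw]
      have e := tendsto_nhds_unique t2 t3
      obtain ⟨w, hw, hwz⟩ : G z ∈ g '' ball 0 1 := hgG ▸ hzi
      rw [← hwz, hf w hw] at e
      rw [e] at hw; simp at hw hz; linarith
    apply subset_antisymm
    · rintro _ ⟨z, hz, rfl⟩
      have : G z ∈ X ∪ inn X := himg ▸ mem_image_of_mem G (sphere_subset_closedBall hz)
      exact this.resolve_right (hout z hz)
    · intro x hx
      have : x ∈ G '' closedBall 0 1 := himg ▸ Or.inl hx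
      obtain ⟨z, hz, rfl⟩ := this
      refine ⟨z, ?_, rfl⟩
      rw [mem_closedBall_zero_iff] at hz
      rcases hz.lt_or_eq with h1 | h1
      · exact absurd hx (inn_subset (hGim ▸ mem_image_of_mem G (by simpa using h1)))
      · simpa using h1

theorem circle_compl_preconn (u : Circle) : IsPreconnected ({u}ᶜ : Set Circle) := by
  obtain ⟨a, rfl⟩ := Circle.exp_surjective u
  have : ({Circle.exp a}ᶜ : Set Circle) = Circle.exp '' Ioo a (a + 2 * π) := by
    ext z
    constructor
    · intro hz
      obtain ⟨t, rfl⟩ := Circle.exp_surjective z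
      have h2 := toIcoMod_mem_Ico two_pi_pos a t
      have h3 : Circle.exp (toIcoMod two_pi_pos a t) = Circle.exp t := by
        rw [toIcoMod, zsmul_eq_mul]; exact Circle.periodic_exp.sub_int_mul_eq _
      refine ⟨_, ⟨lt_of_le_of_ne h2.1 ?_, h2.2⟩, h3⟩
      intro h4
      exact hz (by rw [mem_singleton_iff, ← h3, ← h4])
    · rintro ⟨t, ht, rfl⟩ h
      rw [mem_singleton_iff, Circle.exp_eq_exp] at h
      obtain ⟨m, hm⟩ := h
      have hp := two_pi_pos
      have h1 : (0:ℝ) < m := by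
        by_contra hc; push Not at hc
        nlinarith [ht.1]
      have h2 : (m:ℝ) < 1 := by
        by_contra hc; push Not at hc
        nlinarith [ht.2]
      have h1' : 0 < m := by exact_mod_cast h1
      have h2' : m < 1 := by exact_mod_cast h2
      omega
  rw [this]
  exact isPreconnected_Ioo.image _ (by fun_prop)

theorem IsJCurve.compl_pt {X : Set ℂ} (h : IsJCurve X) {x : ℂ} (hx : x ∈ X) : IsPreconnected (X \ {x}) := by
  obtain ⟨γ, hc, hi, rfl⟩ := h
  obtain ⟨u, rfl⟩ := hx
  have : range γ \ {γ u} = γ '' {u}ᶜ := by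
    rw [image_compl_eq_range_sdiff_image hi, image_singleton]
  rw [this]
  exact (circle_compl_preconn u).image _ hc.continuousOn

theorem HL.union' {α : Type*} [TopologicalSpace α] {A B : Set α} {f : α → ℂ} (hA : IsClosed A)
    (hB : IsClosed B) {l m : α → ℂ}
    (hl : ContinuousOn l A) (hm : ContinuousOn m B) (h1 : ∀ z ∈ A, Complex.exp (l z) = f z)
    (h2 : ∀ z ∈ B, Complex.exp (m z) = f z) (h : ∀ z ∈ A, z ∈ B → l z = m z) : HL (A ∪ B) f := by
  classical
  refine ⟨fun z => if z ∈ A then l z else m z, ?_, ?_⟩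
  · apply ContinuousOn.union_of_isClosed _ _ hA hB
    · exact hl.congr fun z hz => if_pos hz
    · refine hm.congr fun z hz => ?_
      by_cases hzA : z ∈ A
      · simp only [if_pos hzA, h z hzA hz]
      · simp only [if_neg hzA]
  · intro z hz
    by_cases hzA : z ∈ A
    · simp only [if_pos hzA, h1 z hzA]
    · simp only [if_neg hzA, h2 z (hz.resolve_left hzA)]

theorem cara_const {G : ℂ → ℂ} (hGc : ContinuousOn G (closedBall 0 1))
    (hGd : DifferentiableOn ℂ G (ball 0 1)) {U : Set ℂ} (hU : IsOpen U) {z0 ω : ℂ}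
    (hz0 : z0 ∈ sphere (0:ℂ) 1) (hzU : z0 ∈ U) (hω : ∀ z ∈ sphere (0:ℂ) 1, z ∈ U → G z = ω) : G 0 = ω := by
  classical
  have hS : IsCompact (sphere (0:ℂ) 1) := isCompact_sphere _ _
  obtain ⟨t, ht1, ht⟩ := hS.elim_nhds_subcover (fun z => {w | w * (z0 / z) ∈ U}) (by
    intro z hz
    apply (hU.preimage (by fun_prop : Continuous fun w : ℂ => w * (z0 / z))).mem_nhds
    show z * (z0 / z) ∈ U
    have : z ≠ 0 := by rintro rfl; simp at hz
    rw [mul_div_cancel₀ _ this]; exact hzU)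
  have hn : ∀ z ∈ t, ‖z0 / z‖ = 1 := fun z hz => by
    have h1 := ht1 z hz
    rw [mem_sphere_zero_iff_norm] at h1 hz0
    rw [norm_div, h1, hz0, div_one]
  set P : ℂ → ℂ := fun w => ∏ z ∈ t, (G (w * (z0 / z)) - ω) with hP
  have hm : ∀ z ∈ t, MapsTo (fun w => w * (z0 / z)) (ball (0:ℂ) 1) (ball 0 1) := fun z hz w hw => by
    rw [mem_ball_zero_iff] at *; rw [norm_mul, hn z hz, mul_one]; exact hw
  have hm' : ∀ z ∈ t, MapsTo (fun w => w * (z0 / z)) (closedBall (0:ℂ) 1) (closedBall 0 1) := fun z hz w hw => by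
    rw [mem_closedBall_zero_iff] at *; rw [norm_mul, hn z hz, mul_one]; exact hw
  have hPd : DiffContOnCl ℂ P (ball 0 1) := by
    constructor
    · apply DifferentiableOn.fun_finsetProd
      intro z hz
      exact (hGd.comp (by fun_prop) (hm z hz)).sub_const _
    · rw [closure_ball _ one_ne_zero]
      apply continuousOn_finsetProd
      intro z hz
      exact (hGc.comp (by fun_prop) (hm' z hz)).sub continuousOn_const
  have h0 : EqOn P (fun _ => 0) (frontier (ball 0 1)) := by
    rw [frontier_ball _ one_ne_zero]
    intro w hw
    obtain ⟨z, hz, hwz⟩ := mem_iUnion₂.1 (ht hw)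
    apply Finset.prod_eq_zero hz
    rw [sub_eq_zero]
    apply hω _ _ hwz
    rw [mem_sphere_zero_iff_norm, norm_mul, hn z hz, mul_one]; simpa using hw
  have h1 := Complex.eqOn_closure_of_eqOn_frontier isBounded_ball hPd diffContOnCl_const h0
    (subset_closure (mem_ball_self one_pos))
  simp only [hP, zero_mul, Finset.prod_const] at h1
  exact sub_eq_zero.1 (eq_zero_of_pow_eq_zero h1)

theorem chord_sphere {a b z : ℂ} (ha : ‖a‖ = 1) (hb : ‖b‖ = 1) (hz : ‖z‖ = 1) (hab : a ≠ b)
    (hs : ((z - a) * starRingEnd ℂ (b - a)).im = 0) : z = a ∨ z = b := by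
  have hd : b - a ≠ 0 := sub_ne_zero.2 hab.symm
  set t : ℝ := ((z - a) / (b - a)).re with ht
  have h1 : (z - a) / (b - a) = (t : ℂ) := by
    apply Complex.ext
    · simp [ht]
    · rw [ofReal_im, Complex.div_im]
      simp only [mul_im, conj_re, conj_im] at hs
      rw [← sub_div]
      apply div_eq_zero_iff.2; left; linarith
  have h2 : z = a + t * (b - a) := by rw [← h1]; field_simp; ring
  have q : ∀ w : ℂ, ‖w‖ = 1 → w.re * w.re + w.im * w.im = 1 := fun w hw => by
    have := normSq_eq_norm_sq w
    rw [hw, normSq_apply] at this; simpa using this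
  have qa := q a ha
  have qb := q b hb
  have qz := q z hz
  have zr : z.re = a.re + t * (b.re - a.re) := by rw [h2]; simp
  have zi : z.im = a.im + t * (b.im - a.im) := by rw [h2]; simp
  have hpos : 0 < (b.re - a.re) ^ 2 + (b.im - a.im) ^ 2 := by
    have := Complex.normSq_pos.2 hd
    rw [normSq_apply] at this
    simp at this; nlinarith
  have key : t * (t - 1) * ((b.re - a.re) ^ 2 + (b.im - a.im) ^ 2) = 0 := by
    rw [zr, zi] at qz; linear_combination qz - (1 - t) * qa - t * qb
  rcases mul_eq_zero.1 key with h | h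
  · rcases mul_eq_zero.1 h with h | h
    · left; rw [h2, h]; simp
    · right; rw [h2, show t = 1 by linarith]; simp
  · exact absurd h hpos.ne'

theorem cara_inj {X : Set ℂ} (h : IsJCurve X) (he : Ess X) {G : ℂ → ℂ}
    (hGc : ContinuousOn G (closedBall 0 1))
    (hgd : DifferentiableOn ℂ G (ball 0 1)) (hgi : InjOn G (ball 0 1)) (hgG : G '' ball 0 1 = inn X)
    (hg0 : G 0 = 0) (hGX : G '' sphere 0 1 = X) : InjOn G (sphere 0 1) := by
  intro a ha b hb hab
  by_contra hne
  have ha' : ‖a‖ = 1 := by simpa using ha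
  have hb' : ‖b‖ = 1 := by simpa using hb
  set side : ℂ → ℝ := fun z => ((z - a) * starRingEnd ℂ (b - a)).im with hside
  have hsc : Continuous side := by
    simp only [hside]
    fun_prop
  have hsa : side a = 0 := by simp [hside]
  have hsb : side b = 0 := by simp only [hside, mul_conj]; simp
  set S := sphere (0:ℂ) 1 with hS
  have hSb : ∀ z ∈ closedBall (0:ℂ) 1, z ∈ S ∨ z ∈ ball (0:ℂ) 1 := fun z hz => by
    simp only [hS, mem_closedBall_zero_iff, mem_sphere_zero_iff_norm, mem_ball_zero_iff] at *
    exact hz.eq_or_lt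
  have hXS : ∀ z ∈ S, G z ∈ X := fun z hz => hGX ▸ mem_image_of_mem G hz
  have hin : ∀ z ∈ ball (0:ℂ) 1, G z ∈ inn X := fun z hz => hgG ▸ mem_image_of_mem G hz
  have hdisj : ∀ z ∈ closedBall (0:ℂ) 1, ∀ w ∈ ball (0:ℂ) 1, G z = G w → z = w := by
    intro z hz w hw hzw
    rcases hSb z hz with h1 | h1
    · exact absurd (hXS z h1) (inn_subset (hzw ▸ hin w hw))
    · exact hgi h1 hw hzw
  have hcomb : ∀ x y : ℂ, ∀ s t : ℝ, s + t = 1 → side (s • x + t • y) = s * side x + t * side y := by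
    intro x y s t hst
    obtain rfl : s = 1 - t := by linarith
    simp only [hside, mul_im, conj_re, conj_im, sub_re, sub_im,
      add_re, add_im, Complex.real_smul, Complex.mul_re, ofReal_re, ofReal_im]
    ring
  have hconv1 : Convex ℝ {z | 0 ≤ side z} := by
    intro x hx y hy s t hs ht hst
    have hx' : 0 ≤ side x := hx
    have hy' : 0 ≤ side y := hy
    show 0 ≤ side _
    rw [hcomb _ _ _ _ hst]; positivity
  have hconv2 : Convex ℝ {z | side z ≤ 0} := by
    intro x hx y hy s t hs ht hst
    have hx' : side x ≤ 0 := hx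
    have hy' : side y ≤ 0 := hy
    show side _ ≤ 0
    rw [hcomb _ _ _ _ hst]; nlinarith [mul_nonneg hs (neg_nonneg.2 hx'), mul_nonneg ht (neg_nonneg.2 hy')]
  set T1 := closedBall (0:ℂ) 1 ∩ {z | 0 ≤ side z} with hT1
  set T2 := closedBall (0:ℂ) 1 ∩ {z | side z ≤ 0} with hT2
  have cT1 : Convex ℝ T1 := (convex_closedBall _ _).inter hconv1
  have cT2 : Convex ℝ T2 := (convex_closedBall _ _).inter hconv2
  set C := T1 ∩ T2 with hC
  have cC : Convex ℝ C := cT1.inter cT2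
  have kC : IsCompact C := by
    have k1 : IsCompact T1 := (isCompact_closedBall _ _).inter_right (isClosed_le continuous_const hsc)
    have k2 : IsClosed T2 := isClosed_closedBall.inter (isClosed_le hsc continuous_const)
    exact k1.inter_right k2
  have hCS : ∀ z ∈ C, z ∈ S → z = a ∨ z = b := fun z hz hzS =>
    chord_sphere ha' hb' (by simpa [hS] using hzS) hne (le_antisymm hz.2.2 hz.1.2)
  have haC : a ∈ C := ⟨⟨sphere_subset_closedBall ha, hsa.ge⟩, ⟨sphere_subset_closedBall ha, hsa.le⟩⟩
  have hbC : b ∈ C := ⟨⟨sphere_subset_closedBall hb, hsb.ge⟩, ⟨sphere_subset_closedBall hb, hsb.le⟩⟩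
  have hGC : ContinuousOn G C := hGc.mono fun z hz => hz.1.1
  set J := G '' C with hJ
  have kJ : IsCompact J := kC.image_of_continuousOn hGC
  have hXJ : X \ {G a} ⊆ Jᶜ := by
    rintro x ⟨hx, hxa⟩ ⟨z, hz, rfl⟩
    rcases hSb z hz.1.1 with h1 | h1
    · rcases hCS z hz h1 with rfl | rfl
      · exact hxa rfl
      · exact hxa hab.symm
    · exact inn_subset (hin z h1) hx
  have hnear : ∀ (σ : ℝ), (σ = 1 ∨ σ = -1) → ∃ α ∈ S, 0 < σ * side α ∧ G α ≠ G a := by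
    intro σ hσ
    by_contra! hcon
    have hn : 0 < ‖b - a‖ := norm_pos_iff.2 (sub_ne_zero.2 (Ne.symm hne))
    set α : ℂ := σ * (I * (b - a)) / ‖b - a‖ with hα
    have hαS : α ∈ S := by
      rw [hS, mem_sphere_zero_iff_norm, hα, norm_div, norm_mul, norm_mul]
      have : ‖(σ:ℂ)‖ = 1 := by rcases hσ with rfl | rfl <;> simp
      rw [this]; simp [hn.ne']
    have hσα : 0 < σ * side α := by
      have e1 : side α = σ * ‖b - a‖ - (a * starRingEnd ℂ (b - a)).im := by
        have : (α - a) * starRingEnd ℂ (b - a) = ((σ * ‖b - a‖ : ℝ) : ℂ) * I - a * starRingEnd ℂ (b - a) := by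
          have h2 := mul_conj (b - a)
          rw [normSq_eq_norm_sq] at h2
          have hn' : (‖b - a‖ : ℂ) ≠ 0 := by exact_mod_cast hn.ne'
          rw [hα, sub_mul, div_mul_eq_mul_div, mul_assoc (σ:ℂ), mul_assoc I, h2]
          push_cast; field_simp
        rw [hside]; simp only [this]
        rw [sub_im]
        congr 1
        simp
      have e2 : |(a * starRingEnd ℂ (b - a)).im| < ‖b - a‖ := by
        have h1 : ‖a * starRingEnd ℂ (b - a)‖ = ‖b - a‖ := by rw [norm_mul, ha', one_mul, norm_conj]
        refine lt_of_le_of_ne (h1 ▸ abs_im_le_norm _) fun h2 => ?_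
        have h3 : (a * starRingEnd ℂ (b - a)).re = 0 := by
          have h4 := normSq_eq_norm_sq (a * starRingEnd ℂ (b - a))
          rw [h1, normSq_apply, ← h2, ← pow_two, ← pow_two, sq_abs] at h4
          nlinarith
        have qa : a.re * a.re + a.im * a.im = 1 := by
          have := normSq_eq_norm_sq a
          rw [ha', normSq_apply] at this; simpa using this
        have qb : b.re * b.re + b.im * b.im = 1 := by
          have := normSq_eq_norm_sq b
          rw [hb', normSq_apply] at this; simpa using this
        simp at h3
        have h5 : (b.re - a.re) ^ 2 + (b.im - a.im) ^ 2 = 0 := by nlinarith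
        have h6 : b.re - a.re = 0 := by nlinarith [sq_nonneg (b.re - a.re), sq_nonneg (b.im - a.im)]
        have h7 : b.im - a.im = 0 := by nlinarith [sq_nonneg (b.re - a.re), sq_nonneg (b.im - a.im)]
        exact hne (Complex.ext (by linarith) (by linarith))
      rw [e1]
      have := abs_lt.1 e2
      rcases hσ with rfl | rfl <;> linarith
    have := cara_const hGc hgd (U := {z | 0 < σ * side z}) (isOpen_lt continuous_const (by fun_prop))
      hαS hσα (fun z hz hzU => hcon z hz hzU)
    rw [hg0] at this
    exact he.1 (this ▸ hXS a ha)
  obtain ⟨α1, hα1, hs1, hG1⟩ := hnear 1 (Or.inl rfl)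
  obtain ⟨α2, hα2, hs2, hG2⟩ := hnear (-1) (Or.inr rfl)
  set V := connectedComponentIn Jᶜ (G α1) with hV
  have hα1J : G α1 ∈ Jᶜ := hXJ ⟨hXS _ hα1, hG1⟩
  have hVX : X \ {G a} ⊆ V := (h.compl_pt (hXS a ha)).subset_connectedComponentIn ⟨hXS _ hα1, hG1⟩ hXJ
  have hVo : IsOpen V := kJ.isClosed.isOpen_compl.connectedComponentIn
  have hpick : ∀ (σ : ℝ), ∀ α ∈ S, 0 < σ * side α → G α ∈ V → ∃ z ∈ ball (0:ℂ) 1, 0 < σ * side z ∧ G z ∈ V := by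
    intro σ α hα hs hv
    have hcl : α ∈ closure (ball (0:ℂ) 1) := by
      rw [closure_ball _ one_ne_zero]; exact sphere_subset_closedBall hα
    have hne' : (𝓝[ball 0 1] α).NeBot := mem_closure_iff_nhdsWithin_neBot.1 hcl
    have t1 : Filter.Tendsto G (𝓝[ball 0 1] α) (𝓝 (G α)) :=
      (hGc α (sphere_subset_closedBall hα)).mono ball_subset_closedBall
    have e1 := t1.eventually (hVo.mem_nhds hv)
    have e2 : ∀ᶠ z in 𝓝[ball 0 1] α, 0 < σ * side z := nhdsWithin_le_nhds
      ((isOpen_lt continuous_const (by fun_prop : Continuous fun z => σ * side z)).mem_nhds hs)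
    obtain ⟨z, ⟨hz1, hz2⟩, hz3⟩ := ((e1.and e2).and self_mem_nhdsWithin).exists
    exact ⟨z, hz3, hz2, hz1⟩
  obtain ⟨z1, hz1, hsz1, hv1⟩ := hpick 1 α1 hα1 hs1 (hVX ⟨hXS _ hα1, hG1⟩)
  obtain ⟨z2, hz2, hsz2, hv2⟩ := hpick (-1) α2 hα2 hs2 (hVX ⟨hXS _ hα2, hG2⟩)
  set w1 := G z1 with hw1
  set w2 := G z2 with hw2
  have hjJ : JoinedIn Jᶜ w1 w2 :=
    (((joinedIn_iff_comp kJ.isClosed.isOpen_compl hα1J).2 hv1).symm).trans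
      ((joinedIn_iff_comp kJ.isClosed.isOpen_compl hα1J).2 hv2)
  have hjX : JoinedIn Xᶜ w1 w2 :=
    (((joinedIn_iff_comp h.isCompact.isClosed.isOpen_compl he.1).2 (hin z1 hz1)).symm).trans
      ((joinedIn_iff_comp h.isCompact.isClosed.isOpen_compl he.1).2 (hin z2 hz2))
  obtain ⟨μ, hμc, hμ0⟩ := HL.of_joined hjJ
  have hμ : ∀ z ∈ J, Complex.exp (μ z) = (z - w1) / (z - w2) := hμ0
  obtain ⟨lam, hlc, hl0⟩ := HL.of_joined hjX
  have hl : ∀ z ∈ X, Complex.exp (lam z) = (z - w1) / (z - w2) := hl0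
  have nz1 : ∀ z ∈ T2, G z - w1 ≠ 0 := by
    intro z hz h0
    have := hdisj z hz.1 z1 hz1 (sub_eq_zero.1 h0)
    have hz2 : side z ≤ 0 := hz.2
    rw [this] at hz2; linarith
  have nz2 : ∀ z ∈ T1, G z - w2 ≠ 0 := by
    intro z hz h0
    have := hdisj z hz.1 z2 hz2 (sub_eq_zero.1 h0)
    have hz2 : 0 ≤ side z := hz.2
    rw [this] at hz2; linarith
  obtain ⟨m1, hm1c, hm10⟩ := HL.of_convex cT1 ((hGc.mono inter_subset_left).sub continuousOn_const) nz2
  have hm1 : ∀ z ∈ T1, Complex.exp (m1 z) = G z - w2 := hm10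
  obtain ⟨m2, hm2c, hm20⟩ := HL.of_convex cT2 ((hGc.mono inter_subset_left).sub continuousOn_const) nz1
  have hm2 : ∀ z ∈ T2, Complex.exp (m2 z) = G z - w1 := hm20
  obtain ⟨n, hn⟩ := log_diff_const cC.isPreconnected (l := fun z => m2 z - m1 z) (l' := fun z => μ (G z))
    ((hm2c.mono inter_subset_right).sub (hm1c.mono inter_subset_left))
    (hμc.comp hGC (mapsTo_image _ _)) (by
      intro z hz
      rw [exp_sub, hm2 z hz.2, hm1 z hz.1, hμ _ (mem_image_of_mem G hz)])
  have hma := hn a haC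
  have hmb := hn b hbC
  rw [← hab] at hmb
  set k := m2 a - lam (G a) - m1 a with hk
  have hek : Complex.exp k = 1 := by
    rw [hk, exp_sub, exp_sub, hm2 a haC.2, hm1 a haC.1, hl _ (hXS a ha)]
    have := nz1 a haC.2
    have := nz2 a haC.1
    field_simp
  have hHS : HL ((S ∩ T1) ∪ (S ∩ T2)) (fun z => G z - w2) := by
    have kT1 : IsClosed (S ∩ T1) := isClosed_sphere.inter (isClosed_closedBall.inter (isClosed_le continuous_const hsc))
    have kT2 : IsClosed (S ∩ T2) := isClosed_sphere.inter (isClosed_closedBall.inter (isClosed_le hsc continuous_const))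
    refine HL.union' kT1 kT2 (l := m1) (m := fun z => m2 z - lam (G z) - k) (hm1c.mono inter_subset_right) ?_
      (fun z hz => hm1 z hz.2) ?_ ?_
    · refine ((hm2c.mono inter_subset_right).sub (hlc.comp (hGc.mono fun z hz => hz.2.1) ?_)).sub continuousOn_const
      exact fun z hz => hXS z hz.1
    · intro z hz
      rw [exp_sub, exp_sub, hek, hm2 z hz.2, hl _ (hXS z hz.1), div_one, div_div_cancel₀ (nz1 z hz.2)]
    · intro z hzA hzB
      rcases hCS z ⟨hzA.2, hzB.2⟩ hzA.1 with rfl | rfl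
      · simp [hk]
      · rw [← hab, hk]
        linear_combination hma - hmb
  have hcov : (S ∩ T1) ∪ (S ∩ T2) = S := by
    ext z
    constructor
    · rintro (h1 | h1) <;> exact h1.1
    · intro hz
      rcases le_total 0 (side z) with h1 | h1
      · exact Or.inl ⟨hz, sphere_subset_closedBall hz, h1⟩
      · exact Or.inr ⟨hz, sphere_subset_closedBall hz, h1⟩
  rw [hcov] at hHS
  have hz2n : closedBall (0:ℂ) 1 ∈ 𝓝 z2 := Filter.mem_of_superset (isOpen_ball.mem_nhds hz2) ball_subset_closedBall
  have hd2 : DifferentiableAt ℂ G z2 := hgd.differentiableAt (isOpen_ball.mem_nhds hz2)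
  have hder : deriv G z2 ≠ 0 := by
    obtain ⟨-, f, hfd, hf⟩ := inj_holo_inverse isOpen_ball hgd hgi
    rw [hgG] at hfd
    intro h0
    have d1 : HasDerivAt f (deriv f (G z2)) (G z2) :=
      (hfd.differentiableAt ((inn_open h).mem_nhds (hin z2 hz2))).hasDerivAt
    have d2 := d1.comp z2 hd2.hasDerivAt
    rw [h0, mul_zero] at d2
    have d3 : HasDerivAt (f ∘ G) 1 z2 := by
      refine (hasDerivAt_id z2).congr_of_eventuallyEq ?_
      filter_upwards [isOpen_ball.mem_nhds hz2] with w hw using hf w hw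
    exact zero_ne_one (d2.unique d3)
  have hHb : HL (closedBall (0:ℂ) 1) (dslope G z2) := by
    refine HL.of_convex (convex_closedBall _ _) ((continuousOn_dslope hz2n).2 ⟨hGc, hd2⟩) ?_
    intro z hz
    by_cases hzz : z = z2
    · rw [hzz, dslope_same]; exact hder
    · rw [dslope_of_ne _ hzz, slope_def_field]
      exact div_ne_zero (sub_ne_zero.2 fun h0 => hzz (hdisj z hz z2 hz2 h0)) (sub_ne_zero.2 hzz)
  have hj0 : JoinedIn Sᶜ 0 z2 := by
    refine JoinedIn.mono (((convex_ball (0:ℂ) 1).isPathConnected ⟨z2, hz2⟩).joinedIn 0 (mem_ball_self one_pos) z2 hz2) ?_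
    intro z hz hzS
    simp [hS] at hz hzS; linarith
  refine not_HL_sphere (a := 0) one_pos (n := 1) one_ne_zero
    (((hHS.div (hHb.mono sphere_subset_closedBall)).mul (HL.of_joined hj0)).congr ?_)
  intro z hz
  have hzz : z ≠ z2 := by rintro rfl; simp [hS] at hz hz2; linarith
  have e1 : G z - w2 ≠ 0 := sub_ne_zero.2 fun h0 => hzz (hdisj z (sphere_subset_closedBall hz) z2 hz2 h0)
  have e2 : z - z2 ≠ 0 := sub_ne_zero.2 hzz
  have e3 : dslope G z2 z = (G z - w2) / (z - z2) := by rw [dslope_of_ne _ hzz, slope_def_field]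
  simp only [e3, sub_zero, zpow_one]
  field_simp

theorem cara {X : Set ℂ} (h : IsJCurve X) (he : Ess X) : ∃ G : ℂ → ℂ, ContinuousOn G (closedBall 0 1) ∧
    InjOn G (closedBall 0 1) ∧ G '' ball 0 1 = inn X ∧ G '' sphere 0 1 = X ∧ G 0 = 0 ∧ DifferentiableOn ℂ G (ball 0 1) := by
  obtain ⟨g, hgd, hgi, hgG, hg0⟩ := rmt (inn_open h) (inn_bdd h he) (inn_conn he).isPreconnected (zero_mem_inn he)
    (compl_inn_conn h he)
  obtain ⟨G, hGc, hGg, hGX⟩ := cara_ext h he hgd hgi hgG hg0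
  have hd : DifferentiableOn ℂ G (ball 0 1) := hgd.congr hGg
  have hi : InjOn G (ball 0 1) := fun x hx y hy hxy => hgi hx hy (by rwa [← hGg x hx, ← hGg y hy])
  have him : G '' ball 0 1 = inn X := by rw [← hgG]; exact image_congr hGg
  have h0 : G 0 = 0 := by rw [hGg 0 (mem_ball_self one_pos), hg0]
  refine ⟨G, hGc, ?_, him, hGX, h0, hd⟩
  have hs := cara_inj h he hGc hd hi him h0 hGX
  have hd : ∀ x ∈ ball (0:ℂ) 1, ∀ y ∈ sphere (0:ℂ) 1, G x ≠ G y := fun x hx y hy hxy => by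
    have h1 : G x ∈ inn X := him ▸ mem_image_of_mem G hx
    have h2 : G y ∈ X := hGX ▸ mem_image_of_mem G hy
    exact inn_subset h1 (hxy ▸ h2)
  intro x hx y hy hxy
  rw [← ball_union_sphere] at hx hy
  rcases hx with hx | hx <;> rcases hy with hy | hy
  · exact hi hx hy hxy
  · exact absurd hxy (hd x hx y hy)
  · exact absurd hxy.symm (hd y hy x hx)
  · exact hs hx hy hxy

theorem inv_curve {X : Set ℂ} (h : IsJCurve X) (he : Ess X) : IsJCurve ((·⁻¹) '' X) ∧ Ess ((·⁻¹) '' X) := by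
  have hc : ContinuousOn (fun z : ℂ => z⁻¹) X := fun z hz =>
    (continuousAt_inv₀ (fun h0 => he.1 (h0 ▸ hz))).continuousWithinAt
  refine ⟨h.image hc (fun x _ y _ hxy => inv_injective hxy), ?_, ?_⟩
  · rintro ⟨z, hz, hz0⟩
    rw [inv_eq_zero.1 hz0] at hz
    exact he.1 hz
  · intro hl
    exact he.2 ((hl.comp hc (mapsTo_image _ _)).inv.congr fun z _ => by simp)

theorem inv_out {X : Set ℂ} (h : IsJCurve X) (he : Ess X) {z : ℂ} (hz : z ≠ 0) :
    z ∈ out X ↔ z⁻¹ ∈ inn ((·⁻¹) '' X) := by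
  obtain ⟨h', he'⟩ := inv_curve h he
  set X' := (fun z : ℂ => z⁻¹) '' X with hX'
  obtain ⟨R, hR0, hR⟩ := exists_far h he
  obtain ⟨r, hr0, hr⟩ := Metric.isOpen_iff.1 (inn_open h') 0 (zero_mem_inn he')
  obtain ⟨q, hq⟩ : ∃ q : ℝ, max R r⁻¹ < q := exists_gt _
  have hq0 : 0 < q := lt_trans (lt_max_of_lt_left hR0) hq
  have hqo : (q:ℂ) ∈ out X := hR _ (by simpa [abs_of_pos hq0] using (max_lt_iff.1 hq).1)
  have hqi : (q:ℂ)⁻¹ ∈ inn X' := hr (by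
    simp [abs_of_pos hq0]
    exact inv_lt_of_inv_lt₀ hr0 (max_lt_iff.1 hq).2)
  have hout0 : ∀ z ∈ out X, z ≠ 0 := fun z hz h0 => hz (Or.inr (h0 ▸ zero_mem_inn he))
  constructor
  · intro hzo
    have hc : ContinuousOn (fun z : ℂ => z⁻¹) (out X) := fun z hz =>
      (continuousAt_inv₀ (hout0 z hz)).continuousWithinAt
    have h1 := (out_conn h he).isPreconnected.image _ hc
    have h2 : (fun z : ℂ => z⁻¹) '' out X ⊆ X'ᶜ := by
      rintro _ ⟨w, hw, rfl⟩ ⟨x, hx, hxw⟩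
      exact hw (Or.inl (inv_injective hxw ▸ hx))
    have h3 := h1.subset_connectedComponentIn ⟨_, hqo, rfl⟩ h2
    have h4 : connectedComponentIn X'ᶜ ((q:ℂ)⁻¹) = inn X' := (connectedComponentIn_eq hqi).symm
    exact h4 ▸ h3 ⟨z, hzo, rfl⟩
  · intro hzi
    obtain ⟨G, hGc, hGi, hGb, hGs, hG0, -⟩ := cara h' he'
    have hp : IsPreconnected (ball (0:ℂ) 1 \ {0}) := by
      have : ball (0:ℂ) 1 \ {0} = (fun p : ℝ × ℂ => (p.1 : ℂ) * p.2) '' (Ioo 0 1 ×ˢ sphere (0:ℂ) 1) := by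
        ext z
        constructor
        · rintro ⟨hz1, hz0⟩
          have hz0 : z ≠ 0 := hz0
          have hn : 0 < ‖z‖ := norm_pos_iff.2 hz0
          refine ⟨(‖z‖, z / ‖z‖), ⟨⟨hn, by simpa using hz1⟩, by simp [hz0]⟩, ?_⟩
          have : (‖z‖:ℂ) ≠ 0 := by exact_mod_cast hn.ne'
          simp only; field_simp
        · rintro ⟨⟨t, u⟩, ⟨ht, hu⟩, rfl⟩
          have hu : ‖u‖ = 1 := by simpa using hu
          have hu0 : u ≠ 0 := by rw [← norm_pos_iff, hu]; exact one_pos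
          refine ⟨by simp [hu, abs_of_pos ht.1, ht.2], ?_⟩
          simp [ht.1.ne', hu0]
      rw [this]
      refine (isPreconnected_Ioo.prod ?_).image _ (by fun_prop)
      exact isPreconnected_sphere (by simp) _ _
    have h1 : IsPreconnected (G '' (ball (0:ℂ) 1 \ {0})) :=
      hp.image _ (hGc.mono (sdiff_subset.trans ball_subset_closedBall))
    have h2 : G '' (ball (0:ℂ) 1 \ {0}) = inn X' \ {0} := by
      rw [(hGi.mono ball_subset_closedBall).image_sdiff_subset (by simp), hGb, image_singleton, hG0]
    rw [h2] at h1
    have h3 := h1.image (fun z : ℂ => z⁻¹) (fun z hz => (continuousAt_inv₀ hz.2).continuousWithinAt)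
    have h4 : (fun z : ℂ => z⁻¹) '' (inn X' \ {0}) ⊆ Xᶜ := by
      rintro _ ⟨w, hw, rfl⟩ hx
      exact inn_subset hw.1 ⟨_, hx, inv_inv w⟩
    rw [out_eq h he hqo]
    refine h3.subset_connectedComponentIn ⟨(q:ℂ)⁻¹, ⟨hqi, ?_⟩, inv_inv _⟩ h4 ⟨z⁻¹, ⟨hzi, inv_ne_zero hz⟩, inv_inv _⟩
    simpa using hq0.ne'

theorem schoen {X : Set ℂ} (h : IsJCurve X) (he : Ess X) : ∃ F : ℂ ≃ₜ ℂ, F 0 = 0 ∧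
    F '' sphere 0 1 = X ∧ F '' ball 0 1 = inn X ∧ DifferentiableOn ℂ F (ball 0 1) := by
  classical
  obtain ⟨h', he'⟩ := inv_curve h he
  set X' := (fun z : ℂ => z⁻¹) '' X with hX'
  obtain ⟨G, hGc, hGi, hGb, hGs, hG0, hGd⟩ := cara h he
  obtain ⟨H, hHc, hHi, hHb, hHs, hH0, -⟩ := cara h' he'
  set S := sphere (0:ℂ) 1 with hS
  have hSc : S ⊆ closedBall 0 1 := sphere_subset_closedBall
  set d := Function.invFunOn H (closedBall 0 1) with hd
  have hdl : ∀ x ∈ closedBall (0:ℂ) 1, d (H x) = x := fun x hx => hHi.leftInvOn_invFunOn hx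
  have hdc : ContinuousOn d X' := by
    rw [← hHs]; exact continuousOn_inv_image (isCompact_sphere _ _) (hHc.mono hSc) fun x hx => hdl x (hSc hx)
  have hdS : ∀ w ∈ X', d w ∈ S ∧ H (d w) = w := by
    intro w hw
    rw [← hHs] at hw
    obtain ⟨x, hx, rfl⟩ := hw
    rw [hdl x (hSc hx)]; exact ⟨hx, rfl⟩
  have hX0 : ∀ z ∈ X, z ≠ 0 := fun z hz h0 => he.1 (h0 ▸ hz)
  have hGX : ∀ u ∈ S, G u ∈ X := fun u hu => hGs ▸ mem_image_of_mem G hu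
  have hGX' : ∀ u ∈ S, (G u)⁻¹ ∈ X' := fun u hu => ⟨_, hGX u hu, rfl⟩
  set ψ : ℂ → ℂ := fun u => d (G u)⁻¹ with hψ
  have hψc : ContinuousOn ψ S :=
    hdc.comp ((hGc.mono hSc).inv₀ fun u hu => hX0 _ (hGX u hu)) fun u hu => hGX' u hu
  have hψS : ∀ u ∈ S, ψ u ∈ S := fun u hu => (hdS _ (hGX' u hu)).1
  have hHψ : ∀ u ∈ S, H (ψ u) = (G u)⁻¹ := fun u hu => (hdS _ (hGX' u hu)).2
  set K : ℂ → ℂ := fun z => ψ (z / ‖z‖) / ‖z‖ with hK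
  have hunit : ∀ z : ℂ, z ≠ 0 → z / ‖z‖ ∈ S := fun z hz => by simp [hS, hz]
  have hKn : ∀ z : ℂ, z ≠ 0 → ‖K z‖ = ‖z‖⁻¹ := fun z hz => by
    have := hψS _ (hunit z hz)
    rw [hS, mem_sphere_zero_iff_norm] at this
    rw [hK]; simp only; rw [norm_div, this]; simp
  have hK0 : ∀ z : ℂ, z ≠ 0 → K z ≠ 0 := fun z hz => by
    rw [← norm_pos_iff, hKn z hz]; exact inv_pos.2 (norm_pos_iff.2 hz)
  have hKc : ContinuousOn K {z | 1 ≤ ‖z‖} := by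
    have h0 : ∀ z ∈ {z : ℂ | 1 ≤ ‖z‖}, z ≠ 0 := fun z hz h0 => by
      have hz' : 1 ≤ ‖z‖ := hz
      rw [h0, norm_zero] at hz'; linarith
    have hn : ∀ z ∈ {z : ℂ | 1 ≤ ‖z‖}, (‖z‖:ℂ) ≠ 0 := fun z hz => by
      exact_mod_cast (norm_pos_iff.2 (h0 z hz)).ne'
    have hn' : Continuous fun z : ℂ => (‖z‖:ℂ) := by fun_prop
    refine ContinuousOn.div (hψc.comp (continuousOn_id.div hn'.continuousOn hn) ?_) hn'.continuousOn hn
    exact fun z hz => hunit z (h0 z hz)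
  have hKcb : ∀ z : ℂ, 1 ≤ ‖z‖ → K z ∈ closedBall (0:ℂ) 1 := fun z hz => by
    have h0 : z ≠ 0 := norm_pos_iff.1 (by linarith)
    rw [mem_closedBall_zero_iff, hKn z h0]; exact inv_le_one_of_one_le₀ hz
  have hHne : ∀ v ∈ closedBall (0:ℂ) 1, v ≠ 0 → H v ≠ 0 := fun v hv hv0 h0 =>
    hv0 (hHi hv (by simp) (by rw [h0, hH0]))
  set O : ℂ → ℂ := fun z => (H (K z))⁻¹ with hO
  have hOc : ContinuousOn O {z | 1 ≤ ‖z‖} := by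
    refine (hHc.comp hKc fun z hz => hKcb z hz).inv₀ ?_
    intro z hz
    have hz' : 1 ≤ ‖z‖ := hz
    have h0 : z ≠ 0 := norm_pos_iff.1 (by linarith)
    exact hHne _ (hKcb z hz) (hK0 z h0)
  set f : ℂ → ℂ := fun z => if ‖z‖ ≤ 1 then G z else O z with hf
  have hfG : ∀ z, ‖z‖ ≤ 1 → f z = G z := fun z hz => by simp only [hf, if_pos hz]
  have hfO : ∀ z, 1 ≤ ‖z‖ → f z = O z := by
    intro z hz
    rcases hz.eq_or_lt with h1 | h1
    · rw [hfG z h1.symm.le]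
      have : z ∈ S := by simp [hS, h1]
      simp only [hO, hK, ← h1, Complex.ofReal_one, div_one]
      rw [hHψ z this, inv_inv]
    · simp only [hf, if_neg (not_le.2 h1)]
  have hfc : Continuous f := by
    rw [← continuousOn_univ, show (univ : Set ℂ) = closedBall 0 1 ∪ {z | 1 ≤ ‖z‖} by
      ext z; simpa using le_total _ _]
    refine ContinuousOn.union_of_isClosed ?_ ?_ isClosed_closedBall (isClosed_le continuous_const continuous_norm)
    · exact hGc.congr fun z hz => hfG z (by simpa using hz)
    · exact hOc.congr fun z hz => hfO z hz
  have hin : ∀ z, ‖z‖ ≤ 1 → f z ∈ X ∪ inn X := by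
    intro z hz
    rw [hfG z hz]
    rcases hz.eq_or_lt with h1 | h1
    · exact Or.inl (hGX z (by simp [hS, h1]))
    · exact Or.inr (hGb ▸ mem_image_of_mem G (by simpa using h1))
  have hHo : ∀ v ∈ ball (0:ℂ) 1, v ≠ 0 → (H v)⁻¹ ∈ out X := by
    intro v hv hv0
    rw [inv_out h he (inv_ne_zero (hHne v (ball_subset_closedBall hv) hv0)), inv_inv]
    exact (hHb ▸ mem_image_of_mem H hv : H v ∈ inn X')
  have hout : ∀ z, 1 < ‖z‖ → f z ∈ out X := by
    intro z hz
    have h0 : z ≠ 0 := norm_pos_iff.1 (by linarith)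
    rw [hfO z hz.le]
    exact hHo _ (by rw [mem_ball_zero_iff, hKn z h0]; exact inv_lt_one_of_one_lt₀ hz) (hK0 z h0)
  have hKinj : ∀ z w : ℂ, 1 < ‖z‖ → 1 < ‖w‖ → K z = K w → z = w := by
    intro z w hz hw hzw
    have h0 : z ≠ 0 := norm_pos_iff.1 (by linarith)
    have h0' : w ≠ 0 := norm_pos_iff.1 (by linarith)
    have hn : ‖z‖ = ‖w‖ := by
      rw [← inv_inj, ← hKn z h0, ← hKn w h0', hzw]
    have hn0 : (‖w‖:ℂ) ≠ 0 := by exact_mod_cast (norm_pos_iff.2 h0').ne'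
    simp only [hK, hn] at hzw
    rw [div_left_inj' hn0] at hzw
    have h1 := hunit z h0
    have h2 := hunit w h0'
    rw [hn] at h1
    have h3 := congrArg H hzw
    rw [hHψ _ h1, hHψ _ h2, inv_inj] at h3
    have := hGi (hSc h1) (hSc h2) h3
    rwa [div_left_inj' hn0] at this
  have hinj : Function.Injective f := by
    intro z w hzw
    rcases le_or_gt ‖z‖ 1 with hz | hz <;> rcases le_or_gt ‖w‖ 1 with hw | hw
    · rw [hfG z hz, hfG w hw] at hzw
      exact hGi (by simpa using hz) (by simpa using hw) hzw
    · exact absurd (hzw ▸ hin z hz) (hout w hw)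
    · exact absurd (hzw ▸ hin w hw) (hout z hz)
    · rw [hfO z hz.le, hfO w hw.le] at hzw
      exact hKinj z w hz hw (hHi (hKcb z hz.le) (hKcb w hw.le) (inv_injective hzw))
  have hsurj : Function.Surjective f := by
    intro w
    by_cases hw : w ∈ X ∪ inn X
    · rcases hw with hw | hw
      · rw [← hGs] at hw
        obtain ⟨z, hz, rfl⟩ := hw
        exact ⟨z, hfG z (by simpa using hSc hz)⟩
      · rw [← hGb] at hw
        obtain ⟨z, hz, rfl⟩ := hw
        exact ⟨z, hfG z (by simpa using (ball_subset_closedBall hz : z ∈ closedBall (0:ℂ) 1))⟩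
    · have hw' : w ∈ out X := hw
      have hw0 : w ≠ 0 := fun h0 => hw (Or.inr (h0 ▸ zero_mem_inn he))
      have h1 := (inv_out h he hw0).1 hw'
      rw [← hX', ← hHb] at h1
      obtain ⟨v, hv, hvw⟩ := h1
      have hv0 : v ≠ 0 := by
        rintro rfl
        rw [hH0] at hvw
        exact hw0 (inv_eq_zero.1 hvw.symm)
      have hvS := hunit v hv0
      have h2 : H (v / ‖v‖) ∈ X' := hHs ▸ mem_image_of_mem H hvS
      obtain ⟨x, hx, hxH⟩ := h2
      rw [← hGs] at hx
      obtain ⟨u, hu, rfl⟩ := hx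
      have hψu : ψ u = v / ‖v‖ := by
        simp only [hψ]
        rw [show (G u)⁻¹ = H (v / ‖v‖) from hxH, hdl _ (hSc hvS)]
      have hvn : 0 < ‖v‖ := norm_pos_iff.2 hv0
      have hun : ‖u‖ = 1 := by simpa [hS] using hu
      have hvn0 : (‖v‖:ℂ) ≠ 0 := by exact_mod_cast hvn.ne'
      have hzn : ‖u / (‖v‖:ℂ)‖ = ‖v‖⁻¹ := by rw [norm_div, hun]; simp
      refine ⟨u / ‖v‖, ?_⟩
      have hv1 : ‖v‖ < 1 := by simpa using hv
      rw [hfO _ (by rw [hzn]; exact (one_lt_inv₀ hvn).2 hv1 |>.le)]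
      simp only [hO, hK]
      rw [hzn]
      have e1 : u / (‖v‖:ℂ) / ((‖v‖⁻¹ : ℝ) : ℂ) = u := by push_cast; field_simp
      rw [e1, hψu]
      have e2 : v / (‖v‖:ℂ) / ((‖v‖⁻¹ : ℝ) : ℂ) = v := by push_cast; field_simp
      rw [e2, hvw, inv_inv]
  have hclosed : IsClosedMap f := by
    refine IsProperMap.isClosedMap ((isProperMap_iff_tendsto_cocompact).2 ⟨hfc, ?_⟩)
    apply Filter.tendsto_cocompact_cocompact_of_norm
    intro ε
    have h1 : ContinuousAt H 0 := hHc.continuousAt (closedBall_mem_nhds _ one_pos)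
    obtain ⟨δ, hδ, hδH⟩ := Metric.continuousAt_iff.1 h1 (|ε| + 1)⁻¹ (by positivity)
    refine ⟨max 1 δ⁻¹, fun z hz => ?_⟩
    obtain ⟨hz1, hz2⟩ := max_lt_iff.1 hz
    have h0 : z ≠ 0 := norm_pos_iff.1 (by linarith)
    rw [hfO z hz1.le]
    have h2 := hδH (x := K z) (by
      rw [dist_zero_right, hKn z h0]; exact inv_lt_of_inv_lt₀ hδ hz2)
    rw [hH0, dist_zero_right] at h2
    have h3 : 0 < ‖H (K z)‖ := norm_pos_iff.2 (hHne _ (hKcb z hz1.le) (hK0 z h0))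
    simp only [hO]
    rw [norm_inv]
    have h4 := (lt_inv_comm₀ h3 (by positivity)).1 h2
    linarith [le_abs_self ε]
  let F := Equiv.toHomeomorphOfContinuousClosed (Equiv.ofBijective f ⟨hinj, hsurj⟩) hfc hclosed
  have hF : ∀ z, F z = f z := fun z => rfl
  refine ⟨F, ?_, ?_, ?_, ?_⟩
  · rw [hF, hfG 0 (by simp), hG0]
  · rw [← hGs]; exact image_congr fun z hz => by rw [hF, hfG z (by simpa using hSc hz)]
  · rw [← hGb]; exact image_congr fun z hz => by rw [hF, hfG z (by simpa using (ball_subset_closedBall hz : z ∈ closedBall (0:ℂ) 1))]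
  · exact hGd.congr fun z hz => by rw [hF, hfG z (by simpa using (ball_subset_closedBall hz : z ∈ closedBall (0:ℂ) 1))]

theorem schoen_norm {X : Set ℂ} (h : IsJCurve X) (he : Ess X) : ∃ F : ℂ ≃ₜ ℂ,
    F '' sphere 0 1 = X ∧ F '' ball 0 1 = inn X ∧ ∃ a : ℂ, a ≠ 0 ∧ ∃ δ > 0, ∀ z : ℂ, ‖z‖ ≤ δ → F z = a * z := by
  obtain ⟨F, hF0, hFs, hFb, hFd⟩ := schoen h he
  obtain ⟨-, f, hfd, hf⟩ := inj_holo_inverse isOpen_ball hFd F.injective.injOn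
  rw [hFb] at hfd
  have hf0 : f 0 = 0 := by have := hf 0 (mem_ball_self one_pos); rwa [hF0] at this
  have hfs : ∀ w ∈ inn X, f w = F.symm w := by
    intro w hw
    rw [← hFb] at hw
    obtain ⟨z, hz, rfl⟩ := hw
    rw [hf z hz, F.symm_apply_apply]
  have hX0 := (inn_open h).mem_nhds (zero_mem_inn he)
  have hb : deriv f 0 ≠ 0 := by
    intro h0
    have d1 : HasDerivAt f 0 (F 0) := by
      rw [hF0]; exact (hfd.differentiableAt hX0).hasDerivAt.congr_deriv h0
    have d2 := d1.comp 0 (hFd.differentiableAt (isOpen_ball.mem_nhds (mem_ball_self one_pos))).hasDerivAt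
    rw [zero_mul] at d2
    have d3 : HasDerivAt (f ∘ F) 1 0 := by
      refine (hasDerivAt_id (0:ℂ)).congr_of_eventuallyEq ?_
      filter_upwards [isOpen_ball.mem_nhds (mem_ball_self one_pos)] with w hw using hf w hw
    exact zero_ne_one (d2.unique d3)
  set a := (deriv f 0)⁻¹ with ha
  set g : ℂ → ℂ := fun w => a * f w - w with hg
  have hg0 : g 0 = 0 := by simp [hg, hf0]
  have hgs : HasStrictDerivAt g 0 0 := by
    have h1 := (hfd.analyticAt hX0).hasStrictDerivAt
    have h2 := (h1.const_mul a).sub (hasStrictDerivAt_id (0:ℂ))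
    exact h2.congr_deriv (by rw [ha, inv_mul_cancel₀ hb, sub_self])
  obtain ⟨s, hs, hlip⟩ := HasStrictFDerivAt.approximates_deriv_on_nhds hgs (c := 1/8) (Or.inr (by norm_num))
  have hlip' : ∀ x ∈ s, ∀ y ∈ s, ‖g x - g y‖ ≤ 1/8 * ‖x - y‖ := by
    intro x hx y hy
    have := hlip x hx y hy
    simpa using this
  obtain ⟨r, hr, hrs⟩ := Metric.nhds_basis_closedBall.mem_iff.1 (Filter.inter_mem hs hX0)
  set δ := r / 2 with hδ
  have hδ0 : 0 < δ := by positivity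
  have hball : ∀ x : ℂ, ‖x‖ ≤ 2 * δ → x ∈ s ∧ x ∈ inn X := fun x hx => hrs (by
    rw [mem_closedBall_zero_iff]; linarith)
  set χ : ℂ → ℝ := fun w => max 0 (min 1 (2 - ‖w‖ / δ)) with hχ
  have hχ0 : ∀ w, 0 ≤ χ w := fun w => le_max_left _ _
  have hχ1 : ∀ w, χ w ≤ 1 := fun w => max_le zero_le_one (min_le_left _ _)
  have hχL : ∀ x y, |χ x - χ y| ≤ ‖x - y‖ / δ := by
    intro x y
    have h1 : |‖y‖ - ‖x‖| ≤ ‖x - y‖ := by rw [abs_sub_comm]; exact abs_norm_sub_norm_le x y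
    calc |χ x - χ y| ≤ |min 1 (2 - ‖x‖ / δ) - min 1 (2 - ‖y‖ / δ)| := by
          have := abs_max_sub_max_le_max 0 (min 1 (2 - ‖x‖ / δ)) 0 (min 1 (2 - ‖y‖ / δ))
          simpa using this
      _ ≤ |(2 - ‖x‖ / δ) - (2 - ‖y‖ / δ)| := by
          have := abs_min_sub_min_le_max 1 (2 - ‖x‖ / δ) 1 (2 - ‖y‖ / δ)
          simpa using this
      _ = |‖y‖ - ‖x‖| / δ := by
          rw [show (2 - ‖x‖ / δ) - (2 - ‖y‖ / δ) = (‖y‖ - ‖x‖) / δ by ring, abs_div, abs_of_pos hδ0]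
      _ ≤ ‖x - y‖ / δ := by gcongr
  have hχin : ∀ w, ‖w‖ ≤ δ → χ w = 1 := fun w hw => by
    have : ‖w‖ / δ ≤ 1 := (div_le_one hδ0).2 hw
    simp only [hχ]; rw [min_eq_left (by linarith), max_eq_right zero_le_one]
  have hχout : ∀ w, 2 * δ < ‖w‖ → χ w = 0 := fun w hw => by
    have : 2 < ‖w‖ / δ := (lt_div_iff₀ hδ0).2 hw
    simp only [hχ]; exact max_eq_left ((min_le_right _ _).trans (by linarith))
  set m : ℂ → ℂ := fun w => χ w * g w with hm
  have hmix : ∀ x y : ℂ, ‖x‖ ≤ 2 * δ → ‖((χ x - χ y : ℝ) : ℂ) * g x‖ ≤ 1/4 * ‖x - y‖ := by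
    intro x y hx
    have h1 := hlip' x (hball x hx).1 0 (hball 0 (by simp [hδ0.le])).1
    rw [hg0, sub_zero, sub_zero] at h1
    rw [norm_mul, norm_real, norm_eq_abs]
    calc |χ x - χ y| * ‖g x‖ ≤ (‖x - y‖ / δ) * (1/8 * (2 * δ)) := by
          gcongr
          · exact hχL x y
          · linarith
      _ = 1/4 * ‖x - y‖ := by field_simp; ring
  have hmL : ∀ x y : ℂ, ‖x‖ ≤ 2 * δ → ‖m x - m y‖ ≤ 1/2 * ‖x - y‖ := by
    intro x y hx
    by_cases hy : ‖y‖ ≤ 2 * δ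
    · have e : m x - m y = ((χ x - χ y : ℝ) : ℂ) * g x + χ y * (g x - g y) := by
        simp only [hm]; push_cast; ring
      have h1 := hmix x y hx
      have h2 : ‖(χ y : ℂ) * (g x - g y)‖ ≤ 1 * (1/8 * ‖x - y‖) := by
        rw [norm_mul, norm_real, norm_eq_abs, abs_of_nonneg (hχ0 y)]
        exact mul_le_mul (hχ1 y) (hlip' x (hball x hx).1 y (hball y hy).1) (norm_nonneg _) zero_le_one
      rw [e]
      refine (norm_add_le _ _).trans ?_
      linarith [norm_nonneg (x - y)]
    · have hy0 := hχout y (not_le.1 hy)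
      have e : m x - m y = ((χ x - χ y : ℝ) : ℂ) * g x := by
        simp [hm, hy0]
      rw [e]
      linarith [hmix x y hx, norm_nonneg (x - y)]
  have hmL' : ∀ x y : ℂ, ‖m x - m y‖ ≤ 1/2 * ‖x - y‖ := by
    intro x y
    by_cases hx : ‖x‖ ≤ 2 * δ
    · exact hmL x y hx
    by_cases hy : ‖y‖ ≤ 2 * δ
    · rw [norm_sub_rev (m x), norm_sub_rev x]; exact hmL y x hy
    · simp [hm, hχout x (not_le.1 hx), hχout y (not_le.1 hy)]
  have happ : ApproximatesLinearOn (fun w => w + m w) ((ContinuousLinearEquiv.refl ℂ ℂ : ℂ ≃L[ℂ] ℂ) : ℂ →L[ℂ] ℂ) univ (1/2 : NNReal) := by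
    intro x _ y _
    have := hmL' x y
    simp only [ContinuousLinearEquiv.coe_coe, ContinuousLinearEquiv.refl_apply]
    rw [show x + m x - (y + m y) - (x - y) = m x - m y by ring]
    simpa using this
  let M : ℂ ≃ₜ ℂ := happ.toHomeomorph _ (Or.inr (by
    have : ‖((ContinuousLinearEquiv.refl ℂ ℂ).symm : ℂ →L[ℂ] ℂ)‖₊ = 1 := by
      apply NNReal.eq
      exact ContinuousLinearMap.norm_id
    rw [this]
    rw [inv_one]
    exact NNReal.half_lt_self one_ne_zero))
  have hM : ∀ w, M w = w + m w := fun w => rfl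
  have hMid : ∀ w, w ∉ inn X → M w = w := fun w hw => by
    have : 2 * δ < ‖w‖ := by
      by_contra hc; exact hw (hball w (not_lt.1 hc)).2
    rw [hM]; simp [hm, hχout w this]
  refine ⟨F.trans M, ?_, ?_, a, inv_ne_zero hb, ?_⟩
  · have : ∀ x ∈ X, M x = x := fun x hx => hMid x fun hx' => inn_subset hx' hx
    rw [show ⇑(F.trans M) = M ∘ F from rfl, image_comp, hFs]
    exact (image_congr this).trans (image_id' X)
  · rw [show ⇑(F.trans M) = M ∘ F from rfl, image_comp, hFb]
    apply subset_antisymm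
    · rintro _ ⟨y, hy, rfl⟩
      by_contra hc
      exact hc ((M.injective (hMid _ hc)).symm ▸ hy)
    · intro w hw
      refine ⟨M.symm w, ?_, M.apply_symm_apply w⟩
      by_contra hc
      have := hMid _ hc
      rw [M.apply_symm_apply] at this
      exact hc (this ▸ hw)
  · have hFc : ContinuousAt F 0 := F.continuous.continuousAt
    have : F ⁻¹' closedBall 0 δ ∈ 𝓝 (0:ℂ) := hFc.preimage_mem_nhds (by rw [hF0]; exact closedBall_mem_nhds _ hδ0)
    obtain ⟨ε, hε, hεs⟩ := Metric.nhds_basis_closedBall.mem_iff.1 this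
    refine ⟨ε, hε, fun z hz => ?_⟩
    have hFz : ‖F z‖ ≤ δ := by
      have : F z ∈ closedBall (0:ℂ) δ := hεs (by simpa using hz)
      simpa using this
    rw [Homeomorph.trans_apply, hM]
    simp only [hm, hχin _ hFz, hg]
    rw [hfs (F z) (hball (F z) (by linarith)).2, F.symm_apply_apply]
    push_cast; ring

abbrev kmk (p : ℝ × Circle) : KleinBottle := Quot.mk kbRel p

def kE : KleinBottle → ℂ := Quot.lift (fun p => Complex.exp (2 * π * p.1 * I)) (by
  rintro ⟨t, z⟩ ⟨t', z'⟩ ⟨n, h1, -⟩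
  simp only at h1 ⊢
  rw [exp_eq_exp_iff_exists_int]
  refine ⟨-n, ?_⟩
  rw [h1]; push_cast; ring)

def kX : KleinBottle → ℝ := Quot.lift (fun p => (p.2 : ℂ).re) (by
  rintro ⟨t, z⟩ ⟨t', z'⟩ ⟨n, -, h1⟩
  simp only at h1 ⊢
  rw [h1]; split_ifs
  · rfl
  · rw [Circle.coe_inv_eq_conj, conj_re])

theorem exp_pi_int (n : ℤ) : Complex.exp (π * n * I) = if Even n then 1 else -1 := by
  split_ifs with h
  · obtain ⟨m, rfl⟩ := h
    rw [Complex.exp_eq_one_iff]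
    exact ⟨m, by push_cast; ring⟩
  · obtain ⟨m, rfl⟩ := Int.not_even_iff_odd.1 h
    rw [show (π : ℂ) * ((2 * m + 1 : ℤ) : ℂ) * I = π * I + m * (2 * π * I) by push_cast; ring,
      exp_add, exp_pi_mul_I, exp_int_mul_two_pi_mul_I, mul_one]

def kV : KleinBottle → ℂ := Quot.lift (fun p => ((p.2 : ℂ).im : ℂ) * Complex.exp (π * p.1 * I)) (by
  rintro ⟨t, z⟩ ⟨t', z'⟩ ⟨n, h1, h2⟩
  simp only at h1 h2 ⊢
  rw [h1, h2, show (π : ℂ) * ((t + n : ℝ) : ℂ) * I = π * t * I + π * n * I by push_cast; ring,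
    exp_add, exp_pi_int]
  split_ifs
  · simp
  · rw [Circle.coe_inv_eq_conj, conj_im]; push_cast; ring)

theorem continuous_kmk : Continuous kmk := continuous_quot_mk

theorem continuous_kE : Continuous kE := continuous_quot_lift _ (by fun_prop)
theorem continuous_kX : Continuous kX := continuous_quot_lift _ (by fun_prop)
theorem continuous_kV : Continuous kV := continuous_quot_lift _ (by fun_prop)

theorem kmk_surj (x : KleinBottle) : ∃ p, kmk p = x := Quot.exists_rep x

theorem exp_2pi {s t : ℝ} (h : Complex.exp (2 * π * s * I) = Complex.exp (2 * π * t * I)) :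
    ∃ n : ℤ, t = s + n := by
  obtain ⟨n, hn⟩ := exp_eq_exp_iff_exists_int.1 h.symm
  refine ⟨n, ?_⟩
  have h2 : (t : ℂ) = s + n := by
    have : (2 * π * I) ≠ 0 := two_pi_I_ne_zero
    apply mul_left_cancel₀ this
    linear_combination hn
  exact_mod_cast h2

theorem kmk_inj {p q : ℝ × Circle} (h1 : kE (kmk p) = kE (kmk q)) (h2 : kX (kmk p) = kX (kmk q))
    (h3 : kV (kmk p) = kV (kmk q)) : kbRel p q := by
  obtain ⟨t, z⟩ := p
  obtain ⟨t', z'⟩ := q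
  obtain ⟨n, rfl⟩ := exp_2pi h1
  refine ⟨n, rfl, ?_⟩
  replace h2 : (z : ℂ).re = (z' : ℂ).re := h2
  replace h3 : ((z : ℂ).im : ℂ) * Complex.exp (π * t * I) =
    ((z' : ℂ).im : ℂ) * Complex.exp (π * (t + n : ℝ) * I) := h3
  rw [show (π : ℂ) * ((t + n : ℝ) : ℂ) * I = π * t * I + π * n * I by push_cast; ring,
    exp_add, exp_pi_int, mul_left_comm, mul_comm] at h3
  have h4 := mul_left_cancel₀ (exp_ne_zero _) h3
  simp only
  split_ifs at h4 ⊢ with hn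
  · refine Circle.ext (Complex.ext h2.symm ?_)
    have : (z : ℂ).im = (z' : ℂ).im := by exact_mod_cast (by simpa using h4 : ((z : ℂ).im : ℂ) = (z' : ℂ).im)
    exact this.symm
  · refine Circle.ext ?_
    rw [Circle.coe_inv_eq_conj]
    refine Complex.ext h2.symm ?_
    have : ((z : ℂ).im : ℂ) = ((-(z' : ℂ).im : ℝ) : ℂ) := by rw [h4]; push_cast; ring
    have : (z : ℂ).im = -(z' : ℂ).im := by exact_mod_cast this
    simp [this]

theorem kmk_eq {p q : ℝ × Circle} : kmk p = kmk q ↔ kbRel p q :=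
  ⟨fun h => kmk_inj (by rw [h]) (by rw [h]) (by rw [h]), fun h => Quot.sound h⟩

instance : T2Space KleinBottle :=
  T2Space.of_injective_continuous (f := fun x => (kE x, kX x, kV x)) (by
    intro x y h
    obtain ⟨p, rfl⟩ := kmk_surj x
    obtain ⟨q, rfl⟩ := kmk_surj y
    simp only [Prod.mk.injEq] at h
    exact kmk_eq.2 (kmk_inj h.1 h.2.1 h.2.2))
    (continuous_kE.prodMk (continuous_kX.prodMk continuous_kV))

def kshift (n : ℤ) (p : ℝ × Circle) : ℝ × Circle := (p.1 + n, if Even n then p.2 else p.2⁻¹)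

theorem continuous_kshift (n : ℤ) : Continuous (kshift n) := by
  unfold kshift; split_ifs <;> fun_prop

theorem kmk_kshift (n : ℤ) (p) : kmk (kshift n p) = kmk p := (kmk_eq.2 ⟨n, rfl, rfl⟩).symm

theorem kmk_eq' {p q : ℝ × Circle} : kmk p = kmk q ↔ ∃ n, q = kshift n p :=
  kmk_eq.trans ⟨fun ⟨n, h, h'⟩ => ⟨n, Prod.ext h h'⟩, fun ⟨n, h⟩ => ⟨n, by rw [h]; rfl, by rw [h]; rfl⟩⟩

instance : CompactSpace KleinBottle := by
  refine ⟨?_⟩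
  have : (univ : Set KleinBottle) = kmk '' (Icc 0 1 ×ˢ univ) := by
    refine (eq_univ_of_forall fun x => ?_).symm
    obtain ⟨p, rfl⟩ := kmk_surj x
    refine ⟨kshift (-⌊p.1⌋) p, ⟨?_, mem_univ _⟩, kmk_kshift _ _⟩
    simp only [kshift, Int.cast_neg, ← sub_eq_add_neg]
    exact ⟨by linarith [Int.floor_le p.1], by linarith [Int.lt_floor_add_one p.1]⟩
  rw [this]
  exact (isCompact_Icc.prod isCompact_univ).image continuous_kmk

theorem isOpenMap_kmk : IsOpenMap kmk := by
  intro U hU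
  have : kmk ⁻¹' (kmk '' U) = ⋃ n, kshift n ⁻¹' U := by
    ext p
    simp only [mem_preimage, mem_image, mem_iUnion]
    constructor
    · rintro ⟨q, hq, h⟩
      obtain ⟨n, rfl⟩ := kmk_eq'.1 h.symm
      exact ⟨n, hq⟩
    · rintro ⟨n, h⟩
      exact ⟨_, h, kmk_kshift _ _⟩
  refine (isQuotientMap_quot_mk (r := kbRel)).isOpen_preimage.1 ?_
  change IsOpen (kmk ⁻¹' (kmk '' U))
  rw [this]
  exact isOpen_iUnion fun n => hU.preimage (continuous_kshift n)

theorem klift {Y : Type*} [TopologicalSpace Y] {S : Set Y} {Γ : Y → KleinBottle} (hΓ : ContinuousOn Γ S)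
    {c : Y → ℝ} (hc : ContinuousOn c S)
    (h : ∀ y ∈ S, Complex.exp (2 * π * c y * I) = kE (Γ y)) :
    ∃ u : Y → Circle, ContinuousOn u S ∧ ∀ y ∈ S, Γ y = kmk (c y, u y) := by
  have : ∀ y, ∃ u, y ∈ S → Γ y = kmk (c y, u) := by
    intro y
    by_cases hy : y ∈ S
    swap
    · exact ⟨1, fun h => absurd h hy⟩
    obtain ⟨⟨t, z⟩, hp⟩ := kmk_surj (Γ y)
    have h1 := h y hy
    rw [← hp] at h1
    obtain ⟨n, hn⟩ := exp_2pi h1.symm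
    refine ⟨(kshift n (t, z)).2, fun _ => ?_⟩
    rw [← hp, hn, ← kmk_kshift n (t, z)]; rfl
  choose u hu using this
  refine ⟨u, ?_, hu⟩
  rw [continuousOn_iff_continuous_domRestrict] at *
  refine Continuous.subtype_mk (p := fun z => z ∈ Submonoid.unitSphere ℂ) (f := fun y : S => (u y : ℂ)) ?_ _
  have e : (fun y : S => (u y : ℂ)) = fun y : S => (kX (S.domRestrict Γ y) : ℂ) + I *
      (kV (S.domRestrict Γ y) * Complex.exp (-(π * (S.domRestrict c y : ℝ) * I))) := by
    funext y
    simp only [domRestrict]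
    rw [hu y y.2]
    change (u y : ℂ) = (((u y : ℂ).re : ℝ) : ℂ) + I * ((u y : ℂ).im * Complex.exp (π * (c y : ℝ) * I) * Complex.exp (-(π * (c y : ℝ) * I)))
    rw [mul_assoc, ← exp_add, add_neg_cancel, Complex.exp_zero, mul_one]
    exact (by rw [mul_comm]; exact (Complex.re_add_im _).symm)
  rw [e]
  have := continuous_kX.comp hΓ
  have := continuous_kV.comp hΓ
  fun_prop

def kp (z : ℂ) : KleinBottle := kmk (z.re, Circle.exp z.im)

theorem continuous_kp : Continuous kp := continuous_kmk.comp (by fun_prop)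

theorem lift_real {E : Type*} [AddCommGroup E] [Module ℝ E] [TopologicalSpace E]
    [IsTopologicalAddGroup E] [ContinuousSMul ℝ E] {X : Set E} {g : E → ℂ} (hX : Convex ℝ X)
    (hg : ContinuousOn g X) (hg1 : ∀ x ∈ X, ‖g x‖ = 1) :
    ∃ y : E → ℝ, ContinuousOn y X ∧ ∀ x ∈ X, Complex.exp (y x * I) = g x := by
  obtain ⟨l, hl, h⟩ := HL.of_convex hX hg (fun x hx h => by simpa [h] using hg1 x hx)
  refine ⟨fun x => (l x).im, by fun_prop, fun x hx => ?_⟩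
  have h2 : (l x).re = 0 := by
    have := congrArg norm (h x hx)
    rw [Complex.norm_exp, hg1 x hx] at this
    simpa using this
  rw [← h x hx]
  congr 1
  apply Complex.ext <;> simp [h2]

theorem norm_kE (x) : ‖kE x‖ = 1 := by
  obtain ⟨p, rfl⟩ := kmk_surj x
  change ‖Complex.exp (2 * π * p.1 * I)‖ = 1
  rw [show (2 * π * p.1 * I : ℂ) = ((2 * π * p.1 : ℝ) : ℂ) * I by push_cast; ring, norm_exp_ofReal_mul_I]

theorem kp_lift {E : Type*} [AddCommGroup E] [Module ℝ E] [TopologicalSpace E]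
    [IsTopologicalAddGroup E] [ContinuousSMul ℝ E] {X : Set E} {Γ : E → KleinBottle} (hX : Convex ℝ X)
    (hΓ : ContinuousOn Γ X) : ∃ L : E → ℂ, ContinuousOn L X ∧ ∀ x ∈ X, Γ x = kp (L x) := by
  obtain ⟨c, hc, h⟩ := lift_real hX (continuous_kE.comp_continuousOn hΓ) (fun x _ => norm_kE _)
  have h' : ∀ x ∈ X, Complex.exp (2 * π * (c x / (2 * π) : ℝ) * I) = kE (Γ x) := by
    intro x hx
    refine Eq.trans ?_ (h x hx)
    congr 1
    push_cast
    field_simp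
  obtain ⟨u, hu, h2⟩ := klift hΓ (by fun_prop) h'
  obtain ⟨y, hy, h3⟩ := lift_real (g := fun x => (u x : ℂ)) hX (by fun_prop) (fun x _ => Circle.norm_coe _)
  refine ⟨fun x => ⟨c x / (2 * π), y x⟩, ?_, fun x hx => ?_⟩
  · have : ContinuousOn (fun x => ((c x / (2 * π) : ℝ) : ℂ) + (y x : ℝ) * I) X := by fun_prop
    exact this.congr fun x _ => Complex.ext (by simp [-ofReal_div]) (by simp [-ofReal_div])
  · rw [h2 x hx, kp]; congr 2; exact Circle.ext (by rw [Circle.coe_exp]; exact (h3 x hx).symm)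

def Iso (A B : Set KleinBottle) : Prop := ∃ F : ℝ → KleinBottle → KleinBottle,
    Continuous (fun q : ℝ × KleinBottle => F q.1 q.2) ∧
    (∀ t, IsHomeomorph (F t)) ∧ F 0 = id ∧ F 1 '' A = B

theorem Iso.refl (A) : Iso A A :=
  ⟨fun _ => id, continuous_snd, fun _ => IsHomeomorph.id, rfl, image_id _⟩

theorem Iso.trans {A B C} (h : Iso A B) (h' : Iso B C) : Iso A C := by
  obtain ⟨F, h1, h2, h3, h4⟩ := h
  obtain ⟨G, g1, g2, g3, g4⟩ := h'
  refine ⟨fun t => G t ∘ F t, g1.comp (continuous_fst.prodMk h1), fun t => (g2 t).comp (h2 t), by simp [h3, g3], ?_⟩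
  rw [image_comp, h4, g4]

theorem Iso.symm {A B} (h : Iso A B) : Iso B A := by
  obtain ⟨F, h1, h2, h3, h4⟩ := h
  let e := (h2 1).homeomorph
  have he : ∀ x, F 1 (e.symm x) = x := fun x => e.apply_symm_apply x
  refine ⟨fun t => F (1 - t) ∘ e.symm, ?_, fun t => (h2 _).comp e.symm.isHomeomorph, ?_, ?_⟩
  · exact h1.comp ((continuous_const.sub continuous_fst).prodMk (e.symm.continuous.comp continuous_snd))
  · funext x; simp [he]
  · simp only [sub_self, h3, Function.id_comp, ← h4]
    exact e.symm_image_image A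

theorem bump_bij {a L s : ℝ} (h : |a| < L) : Function.Bijective (fun x : ℝ => x + a * max 0 (1 - |x - s| / L)) := by
  have hL : 0 < L := (abs_nonneg a).trans_lt h
  have hb : ∀ x, |max 0 (1 - |x - s| / L)| ≤ 1 := fun x => by
    rw [abs_of_nonneg (le_max_left _ _)]
    refine max_le zero_le_one (by have : 0 ≤ |x - s| / L := by positivity
                                  linarith)
  have hb' : ∀ x, |a * max 0 (1 - |x - s| / L)| ≤ |a| := fun x => by
    rw [abs_mul]; exact mul_le_of_le_one_right (abs_nonneg _) (hb x)
  constructor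
  · intro x y hxy
    have hxy' : x - y = a * (max 0 (1 - |y - s| / L) - max 0 (1 - |x - s| / L)) := by
      simp only at hxy; linarith
    by_contra hne
    have h1 : |max 0 (1 - |y - s| / L) - max 0 (1 - |x - s| / L)| ≤ |x - y| / L := by
      refine (abs_max_sub_max_le_max _ _ _ _).trans (max_le (by simp; positivity) ?_)
      rw [show (1 - |y - s| / L) - (1 - |x - s| / L) = (|x - s| - |y - s|) / L by ring, abs_div, abs_of_pos hL]
      have := abs_abs_sub_abs_le (x - s) (y - s)
      rw [sub_sub_sub_cancel_right] at this
      exact div_le_div_of_nonneg_right this hL.le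
    have h2 := congrArg abs hxy'
    rw [abs_mul] at h2
    have h3 : 0 < |x - y| := abs_pos.2 (sub_ne_zero.2 hne)
    have h4 : |a| * |max 0 (1 - |y - s| / L) - max 0 (1 - |x - s| / L)| ≤ |a| * (|x - y| / L) := by gcongr
    have h5 : |a| * (|x - y| / L) < |x - y| := by
      rw [mul_div_assoc', div_lt_iff₀ hL, mul_comm]; gcongr
    linarith
  · refine Continuous.surjective (by fun_prop) ?_ ?_
    · exact Filter.tendsto_atTop_mono (f := fun x => x + -|a|) (fun x => by linarith [neg_le_of_abs_le (hb' x)]) (Filter.tendsto_atTop_add_const_right _ _ Filter.tendsto_id)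
    · exact Filter.tendsto_atBot_mono (f := fun x => x + |a|) (fun x => by linarith [le_of_abs_le (hb' x)]) (Filter.tendsto_atBot_add_const_right _ _ Filter.tendsto_id)
theorem push {E : ℝ × Circle → KleinBottle} (hE : IsOpenEmbedding E) (s s' : ℝ) :
    Iso (E '' ({s} ×ˢ univ)) (E '' ({s'} ×ˢ univ)) := by
  classical
  set L := |s' - s| + 1 with hL
  have hL0 : 0 < L := by positivity
  let φ : ℝ → ℝ → ℝ := fun t x => x + (max 0 (min 1 t) * (s' - s)) * max 0 (1 - |x - s| / L)
  have hφb : ∀ t, Function.Bijective (φ t) := fun t => bump_bij (by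
    rw [abs_mul, abs_of_nonneg (le_max_left _ _), hL]
    have : max 0 (min 1 t) ≤ 1 := max_le zero_le_one (min_le_left _ _)
    nlinarith [abs_nonneg (s' - s)])
  have hφc : Continuous (fun q : ℝ × ℝ => φ q.1 q.2) := by fun_prop
  let I := Function.invFun E
  have hI : ∀ p, I (E p) = p := Function.leftInverse_invFun hE.injective
  have hIc : ContinuousOn I (range E) := by
    rintro _ ⟨p, rfl⟩
    refine ContinuousAt.continuousWithinAt ?_
    refine hE.continuousAt_iff.1 (continuousAt_id.congr (Filter.Eventually.of_forall fun q => (hI q).symm))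
  let F : ℝ → KleinBottle → KleinBottle := fun t x => if x ∈ range E then E (φ t (I x).1, (I x).2) else x
  have hFE : ∀ t p, F t (E p) = E (φ t p.1, p.2) := fun t p => by simp [F, hI]
  have hFn : ∀ t x, x ∉ range E → F t x = x := fun t p h => by simp only [F, h, if_false]
  set C := E '' (Icc (s - L) (s + L) ×ˢ univ) with hC
  have hCc : IsClosed C := ((isCompact_Icc.prod isCompact_univ).image hE.continuous).isClosed
  have hFC : ∀ t, ∀ x ∉ C, F t x = x := by
    intro t x hx
    by_cases hr : x ∈ range E
    · obtain ⟨p, rfl⟩ := hr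
      rw [hFE]
      congr 1
      refine Prod.ext ?_ rfl
      have : p.1 ∉ Icc (s - L) (s + L) := fun h => hx ⟨p, ⟨h, mem_univ _⟩, rfl⟩
      have h2 : L ≤ |p.1 - s| := by
        by_contra h3
        push Not at h3
        rw [abs_lt] at h3
        exact this ⟨by linarith, by linarith⟩
      have h3 : 1 - |p.1 - s| / L ≤ 0 := by rw [sub_nonpos, le_div_iff₀ hL0]; linarith
      simp [φ, max_eq_left h3]
    · exact hFn t x hr
  have hFc : Continuous (fun q : ℝ × KleinBottle => F q.1 q.2) := by
    rw [continuous_iff_continuousAt]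
    rintro ⟨t, x⟩
    by_cases hr : x ∈ range E
    · have h1 : ContinuousOn (fun q : ℝ × KleinBottle => E (φ q.1 (I q.2).1, (I q.2).2)) (univ ×ˢ range E) := by
        have h2 : ContinuousOn (fun q : ℝ × KleinBottle => I q.2) (univ ×ˢ range E) :=
          hIc.comp continuousOn_snd fun q h => h.2
        refine hE.continuous.comp_continuousOn (ContinuousOn.prodMk ?_ h2.snd)
        exact hφc.comp_continuousOn (continuousOn_fst.prodMk h2.fst)
      have ho : univ ×ˢ range E ∈ 𝓝 (t, x) := (isOpen_univ.prod hE.isOpen_range).mem_nhds ⟨mem_univ _, hr⟩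
      refine (h1.continuousAt ho).congr ?_
      filter_upwards [ho] with q hq
      simp only [F, if_pos hq.2]
    · have ho : univ ×ˢ Cᶜ ∈ 𝓝 (t, x) := (isOpen_univ.prod hCc.isOpen_compl).mem_nhds
        ⟨mem_univ _, fun ⟨p, _, h⟩ => hr ⟨p, h⟩⟩
      refine (continuous_snd.continuousAt).congr ?_
      filter_upwards [ho] with q hq
      exact (hFC q.1 q.2 hq.2).symm
  refine ⟨F, hFc, fun t => isHomeomorph_iff_continuous_bijective.2 ⟨hFc.comp (by fun_prop : Continuous fun x => (t, x)), ?_, ?_⟩, ?_, ?_⟩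
  · intro x y hxy
    by_cases hx : x ∈ range E <;> by_cases hy : y ∈ range E
    · obtain ⟨p, rfl⟩ := hx
      obtain ⟨q, rfl⟩ := hy
      rw [hFE, hFE] at hxy
      have := hE.injective hxy
      rw [Prod.mk.injEq] at this
      rw [Prod.ext ((hφb t).1 this.1) this.2]
    · obtain ⟨p, rfl⟩ := hx
      rw [hFE, hFn _ _ hy] at hxy
      exact absurd ⟨_, hxy⟩ hy
    · obtain ⟨p, rfl⟩ := hy
      rw [hFE, hFn _ _ hx] at hxy
      exact absurd ⟨_, hxy.symm⟩ hx
    · rwa [hFn _ _ hx, hFn _ _ hy] at hxy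
  · intro y
    by_cases hy : y ∈ range E
    · obtain ⟨⟨a, b⟩, rfl⟩ := hy
      obtain ⟨x, rfl⟩ := (hφb t).2 a
      exact ⟨E (x, b), hFE _ _⟩
    · exact ⟨y, hFn _ _ hy⟩
  · funext x
    by_cases hx : x ∈ range E
    · obtain ⟨p, rfl⟩ := hx
      rw [hFE]; simp [φ]
    · exact hFn _ _ hx
  · rw [image_image]
    have : ∀ θ, F 1 (E (s, θ)) = E (s', θ) := fun θ => by rw [hFE]; simp [φ]
    ext y
    constructor
    · rintro ⟨⟨a, b⟩, ⟨rfl, -⟩, rfl⟩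
      exact ⟨(s', b), ⟨rfl, trivial⟩, (this b).symm⟩
    · rintro ⟨⟨a, b⟩, ⟨rfl, -⟩, rfl⟩
      exact ⟨(s, b), ⟨rfl, trivial⟩, this b⟩

def cdir (z : ℂ) : Circle := Circle.exp (Complex.arg z)

theorem coe_cdir {z : ℂ} (h : z ≠ 0) : (cdir z : ℂ) = z / ‖z‖ := by
  have : (‖z‖ : ℂ) ≠ 0 := by simpa using h
  rw [cdir, Circle.coe_exp, eq_div_iff this, mul_comm, Complex.norm_mul_exp_arg_mul_I]

theorem continuousOn_cdir : ContinuousOn cdir {0}ᶜ := by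
  rw [continuousOn_iff_continuous_domRestrict]
  refine Continuous.subtype_mk (p := fun z => z ∈ Submonoid.unitSphere ℂ) (f := fun y : ({0}ᶜ : Set ℂ) => (cdir y : ℂ)) ?_ _
  have : (fun y : ({0}ᶜ : Set ℂ) => (cdir y : ℂ)) = fun y : ({0}ᶜ : Set ℂ) => (y : ℂ) / ‖(y : ℂ)‖ := funext fun y => coe_cdir y.2
  rw [this]
  exact Continuous.div (by fun_prop) (by fun_prop) fun y => Complex.ofReal_ne_zero.2 (norm_ne_zero_iff.2 y.2)

theorem cdir_mul {r : ℝ} (hr : 0 < r) (θ : Circle) : cdir (r * θ) = θ := by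
  refine Circle.ext ?_
  have : (r : ℂ) ≠ 0 := by exact_mod_cast hr.ne'
  rw [coe_cdir (mul_ne_zero this (Circle.coe_ne_zero _))]
  rw [norm_mul, Circle.norm_coe]
  simp [abs_of_pos hr, this]

theorem norm_mul_cdir {z : ℂ} (h : z ≠ 0) : ‖z‖ * (cdir z : ℂ) = z := by
  rw [coe_cdir h, mul_div_cancel₀]; simpa using h

theorem push2 {Q : ℂ → KleinBottle} {r : ℝ} (hr : 0 < r) (hc : ContinuousOn Q (ball 0 r \ {0}))
    (hi : InjOn Q (ball 0 r \ {0})) (ho : ∀ U ⊆ ball 0 r \ {0}, IsOpen U → IsOpen (Q '' U)) {t t' : ℝ}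
    (ht : 0 < t) (htr : t < r) (ht' : 0 < t') (htr' : t' < r) : Iso (Q '' sphere 0 t) (Q '' sphere 0 t') := by
  let ρ : ℝ → ℝ := fun s => r * Real.exp (-Real.exp (-s))
  have hρ0 : ∀ s, 0 < ρ s := fun s => by positivity
  have hρr : ∀ s, ρ s < r := fun s => mul_lt_of_lt_one_right hr (by rw [Real.exp_lt_one_iff]; simp [exp_pos])
  let ψ : ℝ × Circle → ℂ := fun p => ρ p.1 * p.2
  let σ : ℝ → ℝ := fun x => -Real.log (-Real.log (x / r))
  have hσ : ∀ x, 0 < x → x < r → ρ (σ x) = x := fun x h0 h1 => by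
    have h2 : 0 < x / r := by positivity
    have h3 : 0 < -Real.log (x / r) := neg_pos.2 (Real.log_neg h2 ((div_lt_one hr).2 h1))
    simp only [ρ, σ, neg_neg, Real.exp_log h3, Real.exp_log h2]
    field_simp
  have hσ' : ∀ s, σ (ρ s) = s := fun s => by
    simp only [ρ, σ]
    rw [mul_div_cancel_left₀ _ hr.ne', Real.log_exp, neg_neg, Real.log_exp, neg_neg]
  have hn : ∀ p, ‖ψ p‖ = ρ p.1 := fun p => by
    simp only [ψ]; rw [norm_mul, Circle.norm_coe]; simp [abs_of_pos (hρ0 _)]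
  have hψV : ∀ p, ψ p ∈ ball (0 : ℂ) r \ {0} := fun p => by
    refine ⟨by rw [mem_ball_zero_iff, hn]; exact hρr _, fun h => ?_⟩
    have := hn p
    rw [mem_singleton_iff.1 h, norm_zero] at this
    exact (hρ0 p.1).ne this
  have hψc : Continuous ψ := by fun_prop
  let T : ℂ → ℝ × Circle := fun z => (σ ‖z‖, cdir z)
  have hT : ∀ p, T (ψ p) = p := fun p => by
    refine Prod.ext ?_ (cdir_mul (hρ0 _) _)
    simp only [T, hn, hσ']
  have hT' : ∀ z ∈ ball (0 : ℂ) r \ {0}, ψ (T z) = z := fun z hz => by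
    have h0 : z ≠ 0 := hz.2
    simp only [T, ψ]
    rw [hσ _ (norm_pos_iff.2 h0) (mem_ball_zero_iff.1 hz.1), norm_mul_cdir h0]
  have hVo : IsOpen (ball (0 : ℂ) r \ {0}) := isOpen_ball.sdiff isClosed_singleton
  have hTc : ContinuousOn T (ball (0 : ℂ) r \ {0}) := by
    refine ContinuousOn.prodMk ?_ (continuousOn_cdir.mono fun z h => h.2)
    have h1 : ∀ z ∈ ball (0 : ℂ) r \ {0}, ‖z‖ / r ≠ 0 := fun z hz => div_ne_zero (norm_ne_zero_iff.2 hz.2) hr.ne'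
    refine (ContinuousOn.log (ContinuousOn.log (by fun_prop) h1).neg fun z hz => ?_).neg
    refine (neg_pos.2 (Real.log_neg ?_ ((div_lt_one hr).2 (mem_ball_zero_iff.1 hz.1)))).ne'
    have := norm_pos_iff.2 hz.2
    positivity
  have hE : IsOpenEmbedding (Q ∘ ψ) := by
    refine IsOpenEmbedding.of_continuous_injective_isOpenMap (hc.comp_continuous hψc hψV) ?_ ?_
    · intro p q h
      have := hi (hψV p) (hψV q) h
      rw [← hT p, this, hT]
    · intro U hU
      have : ψ '' U = (ball (0 : ℂ) r \ {0}) ∩ T ⁻¹' U := by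
        ext z
        constructor
        · rintro ⟨p, hp, rfl⟩
          exact ⟨hψV p, by rw [mem_preimage, hT]; exact hp⟩
        · rintro ⟨h1, h2⟩
          exact ⟨T z, h2, hT' z h1⟩
      rw [image_comp, this]
      exact ho _ inter_subset_left (hTc.isOpen_inter_preimage hVo hU)
  have hS : ∀ x, 0 < x → x < r → (Q ∘ ψ) '' ({σ x} ×ˢ univ) = Q '' sphere 0 x := by
    intro x h0 h1
    rw [image_comp]
    congr 1
    ext z
    constructor
    · rintro ⟨⟨a, b⟩, ⟨rfl, -⟩, rfl⟩
      rw [mem_sphere_zero_iff_norm, hn]; exact hσ x h0 h1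
    · intro hz
      rw [mem_sphere_zero_iff_norm] at hz
      have : z ∈ ball (0 : ℂ) r \ {0} := ⟨by rw [mem_ball_zero_iff, hz]; exact h1, fun h => by
        rw [mem_singleton_iff.1 h, norm_zero] at hz; exact h0.ne hz⟩
      exact ⟨T z, ⟨by simp [T, hz], trivial⟩, hT' z this⟩
  rw [← hS t ht htr, ← hS t' ht' htr']
  exact push hE _ _

structure EJ (X : Set ℂ) : Prop where
  j : IsJCurve X
  e : Ess X

theorem IsJCurve.conn {X : Set ℂ} (h : IsJCurve X) : IsConnected X := by
  obtain ⟨γ, hc, -, rfl⟩ := h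
  exact ⟨⟨γ 1, 1, rfl⟩, by
    have : IsPreconnected (univ : Set Circle) := by
      rw [← isQuotientMap_circle_exp.surjective.range_eq]
      exact isPreconnected_range Circle.exp.continuous
    rw [← image_univ]; exact this.image _ hc.continuousOn⟩

namespace EJ
variable {X Y Z : Set ℂ}

theorem ne_zero (h : EJ X) {z : ℂ} (hz : z ∈ X) : z ≠ 0 := fun h0 => h.e.1 (h0 ▸ hz)

theorem not_out {z : ℂ} : z ∉ out X ↔ z ∈ X ∪ inn X := by rw [out, mem_compl_iff, not_not]

theorem irr (h : EJ X) : ¬ X ⊆ inn X := fun hh => by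
  obtain ⟨x, hx⟩ := h.j.conn.nonempty
  exact inn_subset (hh hx) hx

theorem side {S : Set ℂ} (h : EJ X) (hS : IsPreconnected S) (hd : Disjoint S X) : S ⊆ inn X ∨ S ⊆ out X := by
  refine hS.subset_or_subset (inn_open h.j) (out_open h.j h.e) ?_ ?_
  · exact disjoint_left.2 fun z hz hz' => hz' (Or.inr hz)
  · intro z hz
    by_contra hn
    rw [mem_union, not_or, not_out] at hn
    exact hn.2.elim (fun hx => disjoint_left.1 hd hz hx) hn.1

theorem lt_out' (h : EJ X) (h' : EJ Y) (hl : X ⊆ inn Y) : (inn Y)ᶜ ⊆ out X := by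
  refine (h.side (compl_inn_conn h'.j h'.e) ?_).resolve_left fun hh => ?_
  · exact disjoint_left.2 fun z hz hx => hz (hl hx)
  · obtain ⟨R, hR0, hR⟩ := exists_far h.j h.e
    obtain ⟨R', hR0', hR'⟩ := exists_far h'.j h'.e
    have hn : ‖((R + R' : ℝ) : ℂ)‖ = R + R' := by rw [norm_real, Real.norm_of_nonneg (by positivity)]
    exact hR _ (by rw [hn]; linarith) (Or.inr (hh fun h => hR' _ (by rw [hn]; linarith) (Or.inr h)))

theorem lt_out (h : EJ X) (h' : EJ Y) (hl : X ⊆ inn Y) : Y ⊆ out X :=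
  fun _ hy => lt_out' h h' hl fun hh => inn_subset hh hy

theorem lt_full (h : EJ X) (h' : EJ Y) (hl : X ⊆ inn Y) : X ∪ inn X ⊆ inn Y := by
  intro z hz
  by_contra hn
  exact lt_out' h h' hl hn hz

theorem lt_trans (h' : EJ Y) (h'' : EJ Z) (hl : X ⊆ inn Y) (hl' : Y ⊆ inn Z) : X ⊆ inn Z :=
  hl.trans (subset_union_right.trans (lt_full h' h'' hl'))

theorem lt_tri (h : EJ X) (h' : EJ Y) (hd : Disjoint X Y) : X ⊆ inn Y ∨ Y ⊆ inn X := by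
  refine (h'.side h.j.conn.isPreconnected hd).imp_right fun ho => ?_
  have h1 : IsPreconnected (Y ∪ inn Y) := by
    rw [← closure_inn h'.j h'.e]; exact (inn_conn h'.e).isPreconnected.closure
  have h2 : Disjoint (Y ∪ inn Y) X := disjoint_left.2 fun z hz hx => ho hx hz
  refine subset_union_left.trans ((h.side h1 h2).resolve_right fun hh => ?_)
  exact hh (Or.inr (zero_mem_inn h'.e)) (Or.inr (zero_mem_inn h.e))

theorem region_compact (h : EJ X) (h' : EJ Y) : IsCompact ((Y ∪ inn Y) \ inn X) := by
  rw [← closure_inn h'.j h'.e]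
  exact (inn_bdd h'.j h'.e).isCompact_closure.diff (inn_open h.j)

theorem lin (H : ℂ ≃ₜ ℂ) (h0 : H 0 = 0) (hH : ∀ X, HL (H '' X) (fun z => z) → HL X (fun z => z)) (h : EJ X) :
    EJ (H '' X) ∧ inn (H '' X) = H '' inn X ∧ out (H '' X) = H '' out X := by
  have hi : inn (H '' X) = H '' inn X := by
    rw [inn, inn, H.image_connectedComponentIn (by exact h.e.1), h0, image_compl_eq H.bijective]
  refine ⟨⟨h.j.image H.continuous.continuousOn H.injective.injOn, ?_, fun hh => h.e.2 (hH _ hh)⟩, hi, ?_⟩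
  · rintro ⟨x, hx, hx0⟩
    exact h.ne_zero hx (H.injective (hx0.trans h0.symm))
  · rw [out, hi, ← image_union, out, image_compl_eq H.bijective]
end EJ

theorem HL_conj {X : Set ℂ} {g : ℂ → ℂ} (h : HL X g) : HL X (fun z => (starRingEnd ℂ) (g z)) := by
  obtain ⟨l, hl, h⟩ := h
  exact ⟨fun z => (starRingEnd ℂ) (l z), continuous_conj.comp_continuousOn hl, fun z hz => by rw [exp_conj, h z hz]⟩

theorem lin1 {X : Set ℂ} (h : EJ X) {a : ℂ} (ha : a ≠ 0) :
    EJ ((fun z => a * z) '' X) ∧ inn ((fun z => a * z) '' X) = (fun z => a * z) '' inn X ∧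
      out ((fun z => a * z) '' X) = (fun z => a * z) '' out X := by
  refine h.lin (Homeomorph.mulLeft₀ a ha) (by simp) fun X hX => ?_
  have h1 := HL.comp hX (Z := X) (c := fun z => a * z) (by fun_prop) (fun z hz => ⟨z, hz, rfl⟩)
  exact (h1.div (HL.const ha)).congr fun z _ => by field_simp

theorem lin2 {X : Set ℂ} (h : EJ X) :
    EJ ((starRingEnd ℂ) '' X) ∧ inn ((starRingEnd ℂ) '' X) = (starRingEnd ℂ) '' inn X ∧
      out ((starRingEnd ℂ) '' X) = (starRingEnd ℂ) '' out X := by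
  refine h.lin Complex.conjCLE.toHomeomorph (by simp) fun X hX => ?_
  have h1 := HL.comp hX (Z := X) (c := fun z => (starRingEnd ℂ) z) (by fun_prop) (fun z hz => ⟨z, hz, rfl⟩)
  exact (HL_conj h1).congr fun z _ => by simp

theorem lin3 {X : Set ℂ} (h : EJ X) : EJ ((·⁻¹) '' X) ∧ ∀ z ≠ 0, (z ∈ inn X ↔ z⁻¹ ∈ out ((·⁻¹) '' X)) ∧
    (z ∈ out X ↔ z⁻¹ ∈ inn ((·⁻¹) '' X)) := by
  obtain ⟨h1, h2⟩ := inv_curve h.j h.e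
  refine ⟨⟨h1, h2⟩, fun z hz => ⟨?_, inv_out h.j h.e hz⟩⟩
  have h3 := inv_out h1 h2 (inv_ne_zero hz)
  rw [h3, inv_inv, image_image]
  simp

structure Cyl where
  P : ℂ → KleinBottle
  I : Type
  act : I → ℂ → ℂ
  sg : I → ℝ
  n : I → ℤ
  tw : ℂ → ℂ
  c : ℝ
  cont : ContinuousOn P {0}ᶜ
  opn : ∀ U ⊆ {0}ᶜ, IsOpen U → IsOpen (P '' U)
  linj : ∀ z ≠ 0, ∃ u ∈ 𝓝 z, InjOn P u
  fib : ∀ z w, z ≠ 0 → w ≠ 0 → (P z = P w ↔ ∃ i, w = act i z)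
  form : ∀ i, (sg i = 1 ∧ ((∀ z, act i z = (Real.exp (n i) : ℂ) * z) ∨
    ∀ z, act i z = (Real.exp (n i) : ℂ) * (starRingEnd ℂ) z)) ∨
    (sg i = -1 ∧ ∀ z, act i z = -(Real.exp (n i) : ℂ) * ((starRingEnd ℂ) z)⁻¹)
  inv : ∀ i, ∃ j, ∀ z ≠ 0, act j (act i z) = z
  comp : ∀ i j, ∃ k, ∀ z ≠ 0, act i (act j z) = act k z
  free : ∀ i, (∀ z ≠ 0, act i z = z) ∨ ((∀ z ≠ 0, act i z ≠ z) ∧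
    ∀ s ∈ Icc c (c + 1 / 5), ∀ s' ∈ Icc c (c + 1 / 5), sg i * s + n i ≠ s')
  fin : ∀ N : ℝ, {i | |(n i : ℝ)| ≤ N}.Finite
  tw_norm : ∀ z ≠ 0, ‖tw z‖ = 1
  tw_cont : ContinuousOn tw {0}ᶜ
  tw_act : ∀ i, ∀ z ≠ 0, tw (act i z) = sg i * tw z

namespace Cyl
variable (C : Cyl)

theorem exp_ne (r : ℝ) : (Real.exp r : ℂ) ≠ 0 := by exact_mod_cast (exp_pos r).ne'

theorem norm_act (i) {z : ℂ} (hz : z ≠ 0) : C.act i z ≠ 0 ∧ Real.log ‖C.act i z‖ = C.sg i * Real.log ‖z‖ + C.n i := by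
  have he := exp_ne (C.n i)
  have hn := norm_ne_zero_iff.2 hz
  have h1 : Real.exp (C.n i) ≠ 0 := (exp_pos _).ne'
  have hn' : ‖(Real.exp (C.n i) : ℂ)‖ = Real.exp (C.n i) := by rw [norm_real, Real.norm_of_nonneg (exp_pos _).le]
  rcases C.form i with ⟨h, h' | h'⟩ | ⟨h, h'⟩ <;> rw [h', h]
  · refine ⟨mul_ne_zero he hz, ?_⟩
    rw [norm_mul, hn', log_mul h1 hn, Real.log_exp]; ring
  · refine ⟨mul_ne_zero he (by simpa using hz), ?_⟩
    rw [norm_mul, hn', norm_conj, log_mul h1 hn, Real.log_exp]; ring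
  · refine ⟨mul_ne_zero (neg_ne_zero.2 he) (by simpa using hz), ?_⟩
    rw [norm_mul, norm_neg, hn', norm_inv, norm_conj, log_mul h1 (inv_ne_zero hn), Real.log_exp, Real.log_inv]; ring

theorem act_EJ (i) {X : Set ℂ} (h : EJ X) : EJ (C.act i '' X) ∧
    ((∀ z ≠ 0, (z ∈ inn X ↔ C.act i z ∈ inn (C.act i '' X)) ∧ (z ∈ out X ↔ C.act i z ∈ out (C.act i '' X))) ∧ C.sg i = 1 ∨
    (∀ z ≠ 0, (z ∈ inn X ↔ C.act i z ∈ out (C.act i '' X)) ∧ (z ∈ out X ↔ C.act i z ∈ inn (C.act i '' X))) ∧ C.sg i = -1) := by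
  have he := exp_ne (C.n i)
  have hm : ∀ a : ℂ, a ≠ 0 → Function.Injective (fun z : ℂ => a * z) := fun a ha x y h => mul_left_cancel₀ ha h
  have hs : Function.Injective (starRingEnd ℂ) := (starRingEnd ℂ).injective
  rcases C.form i with ⟨h1, h' | h'⟩ | ⟨h1, h'⟩ <;> rw [h1]
  · obtain ⟨g1, g2, g3⟩ := lin1 h he
    rw [show C.act i = fun z => (Real.exp (C.n i) : ℂ) * z from funext h']
    refine ⟨g1, Or.inl ⟨fun z hz => ?_, rfl⟩⟩
    rw [g2, g3, (hm _ he).mem_set_image, (hm _ he).mem_set_image]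
    exact ⟨Iff.rfl, Iff.rfl⟩
  · obtain ⟨g1, g2, g3⟩ := lin2 h
    obtain ⟨k1, k2, k3⟩ := lin1 g1 he
    rw [show C.act i '' X = (fun z => (Real.exp (C.n i) : ℂ) * z) '' ((starRingEnd ℂ) '' X) by
      rw [image_image]; exact image_congr fun z _ => h' z]
    refine ⟨k1, Or.inl ⟨fun z hz => ?_, rfl⟩⟩
    rw [k2, k3, g2, g3, h', (hm _ he).mem_set_image, (hm _ he).mem_set_image, hs.mem_set_image, hs.mem_set_image]
    exact ⟨Iff.rfl, Iff.rfl⟩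
  · obtain ⟨g1, g2, g3⟩ := lin2 h
    obtain ⟨l1, l2⟩ := lin3 g1
    obtain ⟨k1, k2, k3⟩ := lin1 l1 (neg_ne_zero.2 he)
    rw [show C.act i '' X = (fun z => -(Real.exp (C.n i) : ℂ) * z) '' ((·⁻¹) '' ((starRingEnd ℂ) '' X)) by
      rw [image_image, image_image]; exact image_congr fun z _ => h' z]
    refine ⟨k1, Or.inr ⟨fun z hz => ?_, rfl⟩⟩
    have hz' : (starRingEnd ℂ) z ≠ 0 := by simpa using hz
    rw [k2, k3, h', (hm _ (neg_ne_zero.2 he)).mem_set_image, (hm _ (neg_ne_zero.2 he)).mem_set_image,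
      ← (l2 _ hz').1, ← (l2 _ hz').2, g2, g3, hs.mem_set_image, hs.mem_set_image]
    exact ⟨Iff.rfl, Iff.rfl⟩
end Cyl

theorem iso_small {X T : Set ℂ} (h : EJ X) (hT : IsOpen T) (hX : X ∪ inn X ⊆ T) {G : ℂ → KleinBottle}
    (hc : ContinuousOn G (T \ {0})) (hi : InjOn G (T \ {0})) (ho : ∀ U ⊆ T \ {0}, IsOpen U → IsOpen (G '' U)) :
    ∃ τ₀ > 0, ∀ τ, 0 < τ → τ < τ₀ → Iso (G '' X) (G '' sphere 0 τ) := by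
  obtain ⟨F, hFs, hFb, a, ha, δ, hδ, hF⟩ := schoen_norm h.j h.e
  have hF0 : F 0 = 0 := by simpa using hF 0 (by simpa using hδ.le)
  have hsub : closedBall (0 : ℂ) 1 ⊆ F ⁻¹' T := by
    rw [← sphere_union_ball, ← image_subset_iff, image_union, hFs, hFb]; exact hX
  obtain ⟨ε, hε, hsub⟩ := (isCompact_closedBall (0 : ℂ) 1).exists_thickening_subset_open (hT.preimage F.continuous) hsub
  rw [thickening_closedBall hε zero_le_one] at hsub
  have hm : MapsTo F (ball 0 (1 + ε) \ {0}) (T \ {0}) := by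
    refine fun z hz => ⟨hsub (by rw [add_comm]; exact hz.1), fun h => hz.2 (F.injective ?_)⟩
    rw [hF0]; exact h
  have hna : 0 < ‖a‖ := norm_pos_iff.2 ha
  refine ⟨‖a‖ * min δ 1, by positivity, fun τ h0 h1 => ?_⟩
  have ht : τ / ‖a‖ < min δ 1 := by rw [div_lt_iff₀ hna, mul_comm]; exact h1
  have := push2 (Q := G ∘ F) (r := 1 + ε) (t := 1) (t' := τ / ‖a‖) (by positivity)
    (hc.comp F.continuous.continuousOn hm) (hi.comp F.injective.injOn hm)
    (fun U hU hUo => by rw [image_comp]; exact ho _ (image_subset_iff.2 fun z hz => hm (hU hz)) (F.isOpenMap _ hUo))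
    one_pos (by linarith) (by positivity) ((ht.trans_le (min_le_right _ _)).trans (by linarith))
  rw [image_comp, hFs, image_comp] at this
  convert this using 2
  ext z
  rw [mem_sphere_zero_iff_norm]
  constructor
  · intro hz
    have hn : ‖z / a‖ = τ / ‖a‖ := by rw [norm_div, hz]
    refine ⟨z / a, by rw [mem_sphere_zero_iff_norm, hn], ?_⟩
    rw [hF _ (by rw [hn]; exact (ht.trans_le (min_le_left _ _)).le)]
    field_simp
  · rintro ⟨w, hw, rfl⟩
    rw [mem_sphere_zero_iff_norm] at hw
    rw [hF _ (by rw [hw]; exact (ht.trans_le (min_le_left _ _)).le), norm_mul, hw]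
    field_simp

def rad (f : ℝ → ℝ) (z : ℂ) : ℂ := ((f ‖z‖ / ‖z‖ : ℝ) : ℂ) * z

theorem norm_rad {f : ℝ → ℝ} {z : ℂ} (hz : z ≠ 0) (hf : 0 ≤ f ‖z‖) : ‖rad f z‖ = f ‖z‖ := by
  have := norm_pos_iff.2 hz
  rw [rad, norm_mul, norm_real, Real.norm_of_nonneg (by positivity)]
  field_simp

theorem rad_rad {f g : ℝ → ℝ} {z : ℂ} (hz : z ≠ 0) (hf : 0 < f ‖z‖) (h : g (f ‖z‖) = ‖z‖) : rad g (rad f z) = z := by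
  have := norm_pos_iff.2 hz
  have h1 := norm_rad hz hf.le
  rw [rad, h1, h, rad, ← mul_assoc, ← ofReal_mul]
  have : ‖z‖ / f ‖z‖ * (f ‖z‖ / ‖z‖) = 1 := by field_simp
  rw [this]; simp

theorem continuousOn_rad {f : ℝ → ℝ} (hf : Continuous f) : ContinuousOn (rad f) {0}ᶜ := by
  unfold rad
  refine ContinuousOn.mul (continuous_ofReal.comp_continuousOn (ContinuousOn.div (by fun_prop) (by fun_prop) ?_)) continuousOn_id
  exact fun z hz => norm_ne_zero_iff.2 hz

theorem squeeze {Y U : Set ℂ} (h : EJ Y) (hU : IsOpen U) (hY : Y ⊆ U) : ∃ q : ℂ → ℂ, ContinuousOn q {0}ᶜ ∧ InjOn q {0}ᶜ ∧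
    (∀ V ⊆ {0}ᶜ, IsOpen V → IsOpen (q '' V)) ∧ (∀ z ∉ inn Y, q z = z) ∧ (∀ z ∈ inn Y, z ≠ 0 → q z ∈ U) ∧ ∀ z ≠ 0, q z ≠ 0 := by
  obtain ⟨F, hFs, hFb, hF0⟩ : ∃ F : ℂ ≃ₜ ℂ, F '' sphere 0 1 = Y ∧ F '' ball 0 1 = inn Y ∧ F 0 = 0 := by
    obtain ⟨F, hF0, hFs, hFb, -⟩ := schoen h.j h.e
    exact ⟨F, hFs, hFb, hF0⟩
  have hsub : sphere (0 : ℂ) 1 ⊆ F ⁻¹' U := by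
    rw [← image_subset_iff, hFs]; exact hY
  obtain ⟨ε, hε, hsub⟩ := (isCompact_sphere (0 : ℂ) 1).exists_thickening_subset_open (hU.preimage F.continuous) hsub
  set r := 1 - min ε 1 / 2 with hr
  have hm := min_le_left ε 1
  have hm' := min_le_right ε 1
  have hm0 : 0 < min ε 1 := by positivity
  have hr0 : 0 < r := by rw [hr]; linarith
  have hr1 : r < 1 := by rw [hr]; linarith
  let k : ℝ → ℝ := fun ρ => max ρ (r + (1 - r) * ρ)
  let m : ℝ → ℝ := fun ρ => min ρ ((ρ - r) / (1 - r))
  have h1r : 0 < 1 - r := by linarith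
  have hk0 : ∀ ρ, 0 < ρ → r < k ρ := fun ρ h => lt_max_of_lt_right (by nlinarith)
  have hmk : ∀ ρ, m (k ρ) = ρ := by
    intro ρ
    have e2 : (ρ - r) / (1 - r) = ρ - r * (1 - ρ) / (1 - r) := by field_simp; ring
    rcases le_total ρ 1 with hρ | hρ
    · have : k ρ = r + (1 - r) * ρ := max_eq_right (by nlinarith)
      rw [this]
      simp only [m]
      rw [show (r + (1 - r) * ρ - r) / (1 - r) = ρ by field_simp; ring]
      exact min_eq_right (by nlinarith)
    · have : k ρ = ρ := max_eq_left (by nlinarith)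
      rw [this]
      refine min_eq_left ?_
      rw [le_div_iff₀ h1r]; nlinarith
  have hkm : ∀ ρ, r < ρ → k (m ρ) = ρ := by
    intro ρ h
    rcases le_total ρ 1 with hρ | hρ
    · have : m ρ = (ρ - r) / (1 - r) := min_eq_right (by rw [div_le_iff₀ h1r]; nlinarith)
      rw [this]
      simp only [k]
      rw [show r + (1 - r) * ((ρ - r) / (1 - r)) = ρ by field_simp; ring]
      exact max_eq_right (by rw [div_le_iff₀ h1r]; nlinarith)
    · have : m ρ = ρ := min_eq_left (by rw [le_div_iff₀ h1r]; nlinarith)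
      rw [this]
      exact max_eq_left (by nlinarith)
  have hm0' : ∀ ρ, r < ρ → 0 < m ρ := fun ρ h => lt_min (by linarith) (div_pos (by linarith) h1r)
  have hkc : Continuous k := by fun_prop
  have hmc : Continuous m := by fun_prop
  have hn : ∀ z : ℂ, z ≠ 0 → ‖rad k z‖ = k ‖z‖ := fun z hz => norm_rad hz (hr0.trans (hk0 _ (norm_pos_iff.2 hz))).le
  have hmr : ∀ z : ℂ, z ≠ 0 → rad m (rad k z) = z := fun z hz => rad_rad hz (hr0.trans (hk0 _ (norm_pos_iff.2 hz))) (hmk _)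
  have hne : ∀ z : ℂ, z ≠ 0 → rad k z ≠ 0 := fun z hz h => by
    have h2 := hn z hz
    rw [h, norm_zero] at h2
    linarith [hk0 _ (norm_pos_iff.2 hz)]
  have hFne : ∀ z : ℂ, z ≠ 0 → F.symm z ≠ 0 := fun z hz h => hz (by rw [← F.apply_symm_apply z, h, hF0])
  have hFne' : ∀ z : ℂ, z ≠ 0 → F z ≠ 0 := fun z hz h => hz (F.injective (h.trans hF0.symm))
  have hop : ∀ V ⊆ ({0}ᶜ : Set ℂ), IsOpen V → IsOpen (rad k '' V) := by
    intro V hV hVo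
    have : rad k '' V = {z | r < ‖z‖} ∩ rad m ⁻¹' V := by
      ext w
      constructor
      · rintro ⟨z, hz, rfl⟩
        have hz0 : z ≠ 0 := hV hz
        refine ⟨?_, ?_⟩
        · show r < ‖rad k z‖
          rw [hn z hz0]; exact hk0 _ (norm_pos_iff.2 hz0)
        · rw [mem_preimage, hmr z hz0]; exact hz
      · rintro ⟨h1, h2⟩
        have h1' : r < ‖w‖ := h1
        have hw : w ≠ 0 := norm_pos_iff.1 (hr0.trans h1')
        exact ⟨rad m w, h2, rad_rad hw (hm0' _ h1') (hkm _ h1')⟩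
    rw [this]
    refine ((continuousOn_rad hmc).mono ?_).isOpen_inter_preimage (isOpen_lt continuous_const continuous_norm) hVo
    exact fun z hz => norm_pos_iff.1 (hr0.trans (show r < ‖z‖ from hz))
  have hin : ∀ z, z ∈ inn Y ↔ ‖F.symm z‖ < 1 := by
    intro z
    rw [← hFb, ← mem_ball_zero_iff]
    constructor
    · rintro ⟨w, hw, rfl⟩; simpa using hw
    · intro hw; exact ⟨_, hw, by simp⟩
  refine ⟨fun z => F (rad k (F.symm z)), ?_, ?_, ?_, ?_, ?_, fun z hz => hFne' _ (hne _ (hFne _ hz))⟩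
  · exact F.continuous.comp_continuousOn ((continuousOn_rad hkc).comp F.symm.continuous.continuousOn fun z hz => hFne z hz)
  · intro z hz w hw hzw
    have := congrArg (rad m) (F.injective hzw)
    rw [hmr _ (hFne _ hz), hmr _ (hFne _ hw)] at this
    exact F.symm.injective this
  · intro V hV hVo
    rw [show (fun z => F (rad k (F.symm z))) '' V = F '' (rad k '' (F.symm '' V)) by simp only [image_image]]
    refine F.isOpenMap _ (hop _ ?_ (F.symm.isOpenMap _ hVo))
    rintro _ ⟨z, hz, rfl⟩
    exact hFne z (hV hz)
  · intro z hz
    rw [hin, not_lt] at hz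
    have h1 : k ‖F.symm z‖ = ‖F.symm z‖ := max_eq_left (by nlinarith)
    have h2 : ‖F.symm z‖ ≠ 0 := by linarith
    simp only [rad, h1, div_self h2]
    simp
  · intro z hz hz0
    rw [hin] at hz
    apply hsub
    have hz0' := hFne z hz0
    set w := F.symm z
    have hw := norm_pos_iff.2 hz0'
    rw [mem_thickening_iff]
    have h3 : k ‖w‖ ≤ 1 := max_le hz.le (by nlinarith)
    refine ⟨((1 / ‖w‖ : ℝ) : ℂ) * w, ?_, ?_⟩
    · rw [mem_sphere_zero_iff_norm, norm_mul, norm_real, Real.norm_of_nonneg (by positivity)]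
      field_simp
    · rw [dist_eq_norm, rad, ← sub_mul, norm_mul, ← Complex.ofReal_sub, norm_real, ← sub_div, norm_div,
        Real.norm_of_nonneg hw.le, div_mul_cancel₀ _ hw.ne', norm_eq_abs, abs_sub_comm, abs_of_nonneg (by linarith)]
      have := hk0 _ hw
      linarith

theorem Cyl.ann (C : Cyl) {Y Z : Set ℂ} (hY : EJ Y) (hZ : EJ Z) (hl : Y ⊆ inn Z)
    (hi : InjOn C.P ((Z ∪ inn Z) \ inn Y)) : Iso (C.P '' Y) (C.P '' Z) := by
  set R := (Z ∪ inn Z) \ inn Y with hR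
  have hR0 : ∀ z ∈ R, z ≠ 0 := fun z hz h => hz.2 (h ▸ zero_mem_inn hY.e)
  obtain ⟨t, ht, hti⟩ := hi.exists_mem_nhdsSet (hY.region_compact hZ)
    (fun z hz => C.cont.continuousAt (isOpen_compl_singleton.mem_nhds (hR0 z hz))) fun z hz => C.linj z (hR0 z hz)
  obtain ⟨U, hUo, hRU, hUt⟩ := mem_nhdsSet_iff_exists.1 ht
  set U' := U \ {0} with hU'
  have hUo' : IsOpen U' := hUo.sdiff isClosed_singleton
  have hRU' : R ⊆ U' := fun z hz => ⟨hRU hz, hR0 z hz⟩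
  have hUi : InjOn C.P U' := hti.mono (sdiff_subset.trans hUt)
  have hYR : Y ⊆ R := fun y hy => ⟨Or.inr (hl hy), fun h => inn_subset h hy⟩
  have hZR : Z ⊆ R := fun y hy => ⟨Or.inl hy, fun h => inn_subset (hY.lt_full hZ hl (Or.inr h)) hy⟩
  obtain ⟨q, qc, qi, qo, q1, q2, q3⟩ := squeeze hY hUo' (hYR.trans hRU')
  set T := U' ∪ inn Z
  have hTo : IsOpen T := hUo'.union (inn_open hZ.j)
  have hqT : MapsTo q (T \ {0}) U' := by
    rintro z ⟨hz, hz0⟩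
    by_cases hzY : z ∈ inn Y
    · exact q2 z hzY hz0
    · rw [q1 z hzY]
      exact hz.elim id fun h => hRU' ⟨Or.inr h, hzY⟩
  have hT0 : T \ {0} ⊆ {0}ᶜ := fun z hz => hz.2
  have hGc : ContinuousOn (C.P ∘ q) (T \ {0}) := C.cont.comp (qc.mono hT0) fun z hz => (hqT hz).2
  have hGi : InjOn (C.P ∘ q) (T \ {0}) := hUi.comp (qi.mono hT0) hqT
  have hGo : ∀ V ⊆ T \ {0}, IsOpen V → IsOpen ((C.P ∘ q) '' V) := fun V hV hVo => by
    rw [image_comp]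
    refine C.opn _ ?_ (qo V (hV.trans hT0) hVo)
    rintro _ ⟨z, hz, rfl⟩
    exact (hqT (hV hz)).2
  have key : ∀ X, Disjoint X (inn Y) → (C.P ∘ q) '' X = C.P '' X := fun X hX =>
    image_congr fun z hz => by rw [Function.comp, q1 z (disjoint_left.1 hX hz)]
  obtain ⟨τ, hτ, h1⟩ := iso_small hY hTo ((hY.lt_full hZ hl).trans subset_union_right) hGc hGi hGo
  obtain ⟨τ', hτ', h2⟩ := iso_small hZ hTo (union_subset_union_left _ (hZR.trans hRU')) hGc hGi hGo
  have hm : 0 < min τ τ' := by positivity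
  have k1 := h1 (min τ τ' / 2) (by positivity) (by linarith [min_le_left τ τ'])
  have k2 := h2 (min τ τ' / 2) (by positivity) (by linarith [min_le_right τ τ'])
  rw [key _ (disjoint_left.2 fun z hz => (hYR hz).2)] at k1
  rw [key _ (disjoint_left.2 fun z hz => (hZR hz).2)] at k2
  exact k1.trans k2.symm

namespace Cyl
variable (C : Cyl) {X Y : Set ℂ}

theorem act_lt (i) (hX : EJ X) (hY : EJ Y) (hl : X ⊆ inn Y) : ∃ A B, (A = C.act i '' X ∧ B = C.act i '' Y ∧ C.sg i = 1 ∨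
    A = C.act i '' Y ∧ B = C.act i '' X ∧ C.sg i = -1) ∧ EJ A ∧ EJ B ∧ A ⊆ inn B ∧
    ∀ z ∈ (Y ∪ inn Y) \ inn X, C.act i z ∈ (B ∪ inn B) \ inn A := by
  obtain ⟨hX', h1⟩ := C.act_EJ i hX
  obtain ⟨hY', h2⟩ := C.act_EJ i hY
  have h0 : ∀ z ∈ (Y ∪ inn Y) \ inn X, z ≠ 0 := fun z hz h => hz.2 (h ▸ zero_mem_inn hX.e)
  rcases h1 with ⟨h1, hs⟩ | ⟨h1, hs⟩ <;> rcases h2 with ⟨h2, hs'⟩ | ⟨h2, hs'⟩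
  · refine ⟨_, _, Or.inl ⟨rfl, rfl, hs⟩, hX', hY', ?_, fun z hz => ?_⟩
    · rintro _ ⟨x, hx, rfl⟩
      exact (h2 x (hX.ne_zero hx)).1.1 (hl hx)
    · refine ⟨?_, fun h => hz.2 ((h1 z (h0 z hz)).1.2 h)⟩
      rw [← EJ.not_out, ← (h2 z (h0 z hz)).2, EJ.not_out]; exact hz.1
  · rw [hs] at hs'; norm_num at hs'
  · rw [hs] at hs'; norm_num at hs'
  · refine ⟨_, _, Or.inr ⟨rfl, rfl, hs⟩, hY', hX', ?_, fun z hz => ?_⟩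
    · rintro _ ⟨y, hy, rfl⟩
      exact (h1 y (hY.ne_zero hy)).2.1 (hX.lt_out hY hl hy)
    · refine ⟨?_, fun h => ?_⟩
      · rw [← EJ.not_out, ← (h1 z (h0 z hz)).1]; exact hz.2
      · exact (h2 z (h0 z hz)).2.2 h hz.1

theorem P_act (i) {z : ℂ} (hz : z ≠ 0) : C.P (C.act i z) = C.P z :=
  ((C.fib _ _ hz (C.norm_act i hz).1).2 ⟨i, rfl⟩).symm

theorem P_image (i) (hX : EJ X) : C.P '' (C.act i '' X) = C.P '' X := by
  rw [image_image]; exact image_congr fun z hz => C.P_act i (hX.ne_zero hz)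

theorem P_inj (i) (hX : EJ X) (h : InjOn C.P X) : InjOn C.P (C.act i '' X) := by
  rintro _ ⟨x, hx, rfl⟩ _ ⟨y, hy, rfl⟩ hxy
  rw [C.P_act i (hX.ne_zero hx), C.P_act i (hX.ne_zero hy)] at hxy
  rw [h hx hy hxy]

theorem base (hX : EJ X) (hY : EJ Y) (iX : InjOn C.P X) (iY : InjOn C.P Y) (hd : Disjoint (C.P '' X) (C.P '' Y))
    (hl : X ⊆ inn Y) (hno : ∀ i W, (W = C.act i '' X ∨ W = C.act i '' Y) → X ⊆ inn W → ¬ W ⊆ inn Y) :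
    InjOn C.P ((Y ∪ inn Y) \ inn X) := by
  have h0 : ∀ z ∈ (Y ∪ inn Y) \ inn X, z ≠ 0 := fun z hz h => hz.2 (h ▸ zero_mem_inn hX.e)
  intro z hz w hw hzw
  obtain ⟨i, rfl⟩ := (C.fib _ _ (h0 z hz) (h0 w hw)).1 hzw
  rcases C.free i with hid | ⟨hfr, -⟩
  · rw [hid z (h0 z hz)]
  exfalso
  have dis : ∀ S T, (S = X ∨ S = Y) → (T = X ∨ T = Y) → Disjoint (C.act i '' S) T := by
    intro S T hS hT
    rw [disjoint_left]
    rintro _ ⟨s, hs, rfl⟩ ht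
    have hs0 : s ≠ 0 := by rcases hS with rfl | rfl; exacts [hX.ne_zero hs, hY.ne_zero hs]
    have hP := C.P_act i hs0
    rcases hS with rfl | rfl <;> rcases hT with rfl | rfl
    · exact hfr s hs0 (iX ht hs hP)
    · exact disjoint_left.1 hd ⟨s, hs, rfl⟩ ⟨_, ht, hP⟩
    · exact disjoint_left.1 hd ⟨_, ht, hP⟩ ⟨s, hs, rfl⟩
    · exact hfr s hs0 (iY ht hs hP)
  obtain ⟨A, B, hAB, hA, hB, hABl, hreg⟩ := C.act_lt i hX hY hl
  have hz' := hreg z hz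
  have pos : ∀ W, EJ W → (W = C.act i '' X ∨ W = C.act i '' Y) → W ⊆ inn X ∨ Y ⊆ inn W := by
    intro W hW hWe
    have d1 : Disjoint W X := by rcases hWe with rfl | rfl <;> exact dis _ _ (by simp) (by simp)
    have d2 : Disjoint W Y := by rcases hWe with rfl | rfl <;> exact dis _ _ (by simp) (by simp)
    rcases hW.lt_tri hX d1 with h | h
    · exact Or.inl h
    · exact Or.inr ((hW.lt_tri hY d2).resolve_left (hno i W hWe h))
  have pA : A ⊆ inn X := by
    refine (pos A hA (by rcases hAB with ⟨h, -⟩ | ⟨h, -⟩ <;> simp [h])).resolve_right fun h => ?_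
    exact hz'.2 (hY.lt_full hA h hw.1)
  have pB : Y ⊆ inn B := by
    refine (pos B hB (by rcases hAB with ⟨-, h, -⟩ | ⟨-, h, -⟩ <;> simp [h])).resolve_left fun h => ?_
    exact hw.2 (hB.lt_full hX h hz'.1)
  obtain ⟨j, hj⟩ := C.inv i
  have hjj : ∀ {S}, EJ S → C.act j '' (C.act i '' S) = S := fun {S} hS => by
    rw [image_image]
    exact (image_congr fun z hz => hj z (hS.ne_zero hz)).trans (image_id _)
  obtain ⟨A1, B1, e1, hA1, hB1, l1, -⟩ := C.act_lt j hA hX pA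
  obtain ⟨A2, B2, e2, hA2, hB2, l2, -⟩ := C.act_lt j hY hB pB
  obtain ⟨A3, B3, e3, hA3, hB3, l3, -⟩ := C.act_lt j hX hY hl
  rcases e1 with ⟨rfl, rfl, s1⟩ | ⟨rfl, rfl, s1⟩ <;> rcases e2 with ⟨rfl, rfl, s2⟩ | ⟨rfl, rfl, s2⟩ <;>
    rcases e3 with ⟨rfl, rfl, s3⟩ | ⟨rfl, rfl, s3⟩ <;> first | (exfalso; linarith) | skip
  · rcases hAB with ⟨rfl, rfl, -⟩ | ⟨rfl, rfl, -⟩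
    · rw [hjj hX] at l1
      rw [hjj hY] at l2
      exact hno j _ (Or.inl rfl) l1 (EJ.lt_trans hB3 hY l3 l2)
    · rw [hjj hY] at l1
      rw [hjj hX] at l2
      exact hY.irr (EJ.lt_trans hX hY (EJ.lt_trans hB3 hX (EJ.lt_trans hA3 hB3 l1 l3) l2) hl)
  · rcases hAB with ⟨rfl, rfl, -⟩ | ⟨rfl, rfl, -⟩
    · rw [hjj hX] at l1
      rw [hjj hY] at l2
      exact hY.irr (EJ.lt_trans hX hY (EJ.lt_trans hB3 hX (EJ.lt_trans hA3 hB3 l2 l3) l1) hl)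
    · rw [hjj hY] at l1
      rw [hjj hX] at l2
      exact hno j _ (Or.inr rfl) l2 (EJ.lt_trans hB3 hY l3 l1)

def between (X Y : Set ℂ) : Set (Set ℂ) :=
  {W | (∃ i, W = C.act i '' X ∨ W = C.act i '' Y) ∧ X ⊆ inn W ∧ W ⊆ inn Y}

theorem between_finite (hX : EJ X) (hY : EJ Y) : (C.between X Y).Finite := by
  have key : ∀ S, EJ S → ∃ N : ℝ, ∀ i, X ⊆ inn (C.act i '' S) → C.act i '' S ⊆ inn Y → |(C.n i : ℝ)| ≤ N := by
    intro S hS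
    have hK := hX.region_compact hY
    have hc : ∀ K : Set ℂ, IsCompact K → (∀ z ∈ K, z ≠ 0) → ∃ M, ∀ z ∈ K, |Real.log ‖z‖| ≤ M := fun K hK h0 =>
      hK.exists_bound_of_continuousOn (f := fun z : ℂ => Real.log ‖z‖) (ContinuousOn.log (by fun_prop) fun z hz => norm_ne_zero_iff.2 (h0 z hz))
    obtain ⟨M, hM⟩ := hc _ hK fun z hz h => hz.2 (h ▸ zero_mem_inn hX.e)
    obtain ⟨M', hM'⟩ := hc S hS.j.isCompact fun z hz => hS.ne_zero hz
    refine ⟨M + M', fun i h1 h2 => ?_⟩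
    obtain ⟨s, hs⟩ := hS.j.conn.nonempty
    have hEJ := (C.act_EJ i hS).1
    have h3 := hM (C.act i s) ⟨Or.inr (h2 ⟨s, hs, rfl⟩), fun h => (hX.lt_out hEJ h1) ⟨s, hs, rfl⟩ (Or.inr h)⟩
    have h4 := hM' s hs
    rw [(C.norm_act i (hS.ne_zero hs)).2] at h3
    rw [abs_le] at *
    rcases C.form i with ⟨h, -⟩ | ⟨h, -⟩ <;> rw [h] at h3 <;> constructor <;> linarith
  obtain ⟨N, hN⟩ := key X hX
  obtain ⟨N', hN'⟩ := key Y hY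
  refine (((C.fin N).image (fun i => C.act i '' X)).union ((C.fin N').image (fun i => C.act i '' Y))).subset ?_
  rintro W ⟨⟨i, rfl | rfl⟩, h1, h2⟩
  · exact Or.inl ⟨i, hN i h1 h2, rfl⟩
  · exact Or.inr ⟨i, hN' i h1 h2, rfl⟩

theorem adj_aux (k : ℕ) : ∀ {X Y : Set ℂ}, EJ X → EJ Y → InjOn C.P X → InjOn C.P Y →
    Disjoint (C.P '' X) (C.P '' Y) → X ⊆ inn Y → (C.between X Y).ncard < k → Iso (C.P '' X) (C.P '' Y) := by
  induction k with
  | zero => intro X Y _ _ _ _ _ _ h; omega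
  | succ k ih =>
    intro X Y hX hY iX iY hd hl hk
    have hcomp : ∀ i j, ∃ k, ∀ S, EJ S → C.act i '' (C.act j '' S) = C.act k '' S := by
      intro i j
      obtain ⟨k, hk⟩ := C.comp i j
      exact ⟨k, fun S hS => by rw [image_image]; exact image_congr fun z hz => hk z (hS.ne_zero hz)⟩
    have hfin := C.between_finite hX hY
    have hcard : ∀ W A B, W ∈ C.between X Y → C.between A B ⊆ C.between X Y \ {W} → (C.between A B).ncard < k :=
      fun W A B hW hs => by
        have h1 := ncard_le_ncard hs (hfin.subset sdiff_subset)
        have h2 := ncard_sdiff_singleton_lt_of_mem hW hfin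
        omega
    by_cases hno : ∀ i W, (W = C.act i '' X ∨ W = C.act i '' Y) → X ⊆ inn W → ¬ W ⊆ inn Y
    · exact C.ann hX hY hl (C.base hX hY iX iY hd hl hno)
    · push Not at hno
      obtain ⟨i, W, hW, h1, h2⟩ := hno
      have hWb : W ∈ C.between X Y := ⟨⟨i, hW⟩, h1, h2⟩
      rcases hW with rfl | rfl
      · have hE := (C.act_EJ i hX).1
        rw [← C.P_image i hX]
        refine ih hE hY (C.P_inj i hX iX) iY (by rwa [C.P_image i hX]) h2 (hcard _ _ _ hWb ?_)
        rintro V ⟨⟨j, hV⟩, v1, v2⟩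
        have hV' : ∃ j, V = C.act j '' X ∨ V = C.act j '' Y := by
          rcases hV with hV | hV
          · obtain ⟨k, hk⟩ := hcomp j i
            exact ⟨k, Or.inl (by rw [hV, hk X hX])⟩
          · exact ⟨j, Or.inr hV⟩
        have hVE : EJ V := by obtain ⟨j, rfl | rfl⟩ := hV'; exacts [(C.act_EJ j hX).1, (C.act_EJ j hY).1]
        refine ⟨⟨hV', EJ.lt_trans hE hVE h1 v1, v2⟩, fun h => ?_⟩
        rw [mem_singleton_iff] at h
        rw [h] at v1
        exact hE.irr v1
      · have hE := (C.act_EJ i hY).1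
        rw [← C.P_image i hY]
        refine ih hX hE iX (C.P_inj i hY iY) (by rwa [C.P_image i hY]) h1 (hcard _ _ _ hWb ?_)
        rintro V ⟨⟨j, hV⟩, v1, v2⟩
        have hV' : ∃ j, V = C.act j '' X ∨ V = C.act j '' Y := by
          rcases hV with hV | hV
          · exact ⟨j, Or.inl hV⟩
          · obtain ⟨k, hk⟩ := hcomp j i
            exact ⟨k, Or.inr (by rw [hV, hk Y hY])⟩
        refine ⟨⟨hV', v1, EJ.lt_trans hE hY v2 h2⟩, fun h => ?_⟩
        rw [mem_singleton_iff] at h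
        rw [h] at v2
        exact hE.irr v2

theorem adj (hX : EJ X) (hY : EJ Y) (iX : InjOn C.P X) (iY : InjOn C.P Y)
    (hd : Disjoint (C.P '' X) (C.P '' Y)) : Iso (C.P '' X) (C.P '' Y) := by
  have : Disjoint X Y := disjoint_left.2 fun z hx hy => disjoint_left.1 hd ⟨z, hx, rfl⟩ ⟨z, hy, rfl⟩
  rcases hX.lt_tri hY this with h | h
  · exact C.adj_aux _ hX hY iX iY hd h (Nat.lt_succ_self _)
  · exact (C.adj_aux _ hY hX iY iX hd.symm h (Nat.lt_succ_self _)).symm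
end Cyl

theorem sphere_EJ {r : ℝ} (hr0 : 0 < r) : EJ (sphere (0:ℂ) r) := by
  refine ⟨⟨fun z => r * z, by fun_prop, fun z w h => ?_, ?_⟩, by simp [hr0.ne], fun h => ?_⟩
  · exact Circle.ext (mul_left_cancel₀ (by exact_mod_cast hr0.ne') h)
  · ext z
    rw [mem_sphere_zero_iff_norm]
    constructor
    · rintro ⟨w, rfl⟩
      rw [norm_mul, Circle.norm_coe, norm_of_nonneg hr0.le, mul_one]
    · intro hz
      refine ⟨cdir z, ?_⟩
      change (r : ℂ) * cdir z = z
      rw [← hz, norm_mul_cdir (norm_pos_iff.1 (hz ▸ hr0))]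
  · exact not_HL_sphere (a := 0) hr0 one_ne_zero (h.congr fun z _ => by simp)

theorem compl_comp_preconn {T : Set ℂ} (hT : IsClosed T) (hc : IsPreconnected T) {p x0 : ℂ} (hx0 : x0 ∈ T) :
    IsPreconnected (connectedComponentIn Tᶜ p)ᶜ := by
  have hTG : T ⊆ (connectedComponentIn Tᶜ p)ᶜ := fun z hz h => connectedComponentIn_subset _ _ h hz
  have ho : IsOpen (connectedComponentIn Tᶜ p) := hT.isOpen_compl.connectedComponentIn
  refine isPreconnected_of_forall x0 fun y hy => ?_
  by_cases hyT : y ∈ T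
  · exact ⟨T, hTG, hx0, hyT, hc⟩
  have hyC : y ∈ connectedComponentIn Tᶜ y := mem_connectedComponentIn hyT
  obtain ⟨x, hx⟩ : (frontier (connectedComponentIn Tᶜ y)).Nonempty := by
    refine nonempty_frontier_iff.2 ⟨⟨y, hyC⟩, fun h => ?_⟩
    exact connectedComponentIn_subset Tᶜ y (h ▸ mem_univ x0) hx0
  refine ⟨T ∪ closure (connectedComponentIn Tᶜ y), union_subset hTG ?_, Or.inl hx0, Or.inr (subset_closure hyC),
    hc.union x (frontier_comp_subset hT y hx) (frontier_subset_closure hx) isPreconnected_connectedComponentIn.closure⟩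
  rw [← ho.isClosed_compl.closure_eq]
  refine closure_mono fun z hz hz' => hy ?_
  rw [connectedComponentIn_eq hz', ← connectedComponentIn_eq hz]
  exact hyC

theorem Band {f : ℂ → ℝ} (hf : ContinuousOn f {0}ᶜ) {M : ℝ} (hM : ∀ z ≠ 0, |f z - Real.log ‖z‖| ≤ M)
    {v v' : ℝ} (hv : v < v') : ∃ L, EJ L ∧ ∀ z ∈ L, f z ∈ Ioo v v' := by
  obtain ⟨v0, h1, h2⟩ := exists_between hv
  set ρ := Real.exp (v0 - M)
  have hρ : 0 < ρ := exp_pos _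
  set S := {z : ℂ | ρ ≤ ‖z‖} ∩ f ⁻¹' Ici v0
  have hne : ∀ z : ℂ, ρ ≤ ‖z‖ → z ≠ 0 := fun z hz => norm_pos_iff.1 (hρ.trans_le hz)
  have hSc : IsClosed S := (hf.mono fun z hz => hne z hz).preimage_isClosed_of_isClosed
    (isClosed_le continuous_const continuous_norm) isClosed_Ici
  have hS : ∀ z ≠ 0, v0 ≤ f z → z ∈ S := fun z hz h => by
    refine ⟨?_, h⟩
    have := (abs_le.1 (hM z hz)).2
    change ρ ≤ ‖z‖
    rw [← Real.exp_log (norm_pos_iff.2 hz)]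
    exact Real.exp_le_exp.2 (by linarith)
  set R := Real.exp (v0 + M)
  have hR : 0 < R := exp_pos _
  have hRS : {z : ℂ | R < ‖z‖} ⊆ S := fun z (hz : R < ‖z‖) => by
    have hz0 : z ≠ 0 := norm_pos_iff.1 (hR.trans hz)
    refine hS z hz0 ?_
    have h1 : v0 + M < Real.log ‖z‖ := (Real.lt_log_iff_exp_lt (norm_pos_iff.2 hz0)).2 hz
    linarith [(abs_le.1 (hM z hz0)).1]
  set x0 : ℂ := ((R + 1 : ℝ) : ℂ)
  have hx0 : x0 ∈ {z : ℂ | R < ‖z‖} := by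
    change R < ‖x0‖
    rw [norm_of_nonneg (by positivity)]; linarith
  set T := connectedComponentIn S x0 with hTdef
  have hTS : T ⊆ S := connectedComponentIn_subset _ _
  have hTp : IsPreconnected T := isPreconnected_connectedComponentIn
  have hx0T : x0 ∈ T := mem_connectedComponentIn (hRS hx0)
  have hTc : IsClosed T := by
    rw [← closure_subset_iff_isClosed]
    exact hTp.closure.subset_connectedComponentIn (subset_closure hx0T) (hSc.closure_subset_iff.2 hTS)
  have hRT : {z : ℂ | R < ‖z‖} ⊆ T := (isPreconnected_norm_gt hR).subset_connectedComponentIn hx0 hRS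
  have h0T : (0:ℂ) ∉ T := fun h => hne 0 (hTS h).1 rfl
  set G := connectedComponentIn Tᶜ 0
  have hGo : IsOpen G := hTc.isOpen_compl.connectedComponentIn
  have hGT : G ⊆ Tᶜ := connectedComponentIn_subset _ _
  have hGb : Bornology.IsBounded G := (isBounded_closedBall (x := (0:ℂ)) (r := R)).subset fun z hz => by
    rw [mem_closedBall_zero_iff]
    by_contra h
    exact hGT hz (hRT (not_le.1 h))
  have h0G : (0:ℂ) ∈ G := mem_connectedComponentIn h0T
  obtain ⟨g, g1, g2, g3, g4⟩ := rmt hGo hGb isPreconnected_connectedComponentIn h0G (compl_comp_preconn hTc hTp hx0T)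
  have hfr : ∀ x ∈ frontier G, x ≠ 0 ∧ f x ∈ Ioo v v' := by
    intro x hx
    have hxT := frontier_comp_subset hTc 0 hx
    have hxS := hTS hxT
    have hx0 := hne x hxS.1
    have hxf : v0 ≤ f x := hxS.2
    refine ⟨hx0, h1.trans_le hxf, ?_⟩
    by_contra hcon
    have hc : ContinuousAt f x := hf.continuousAt (isOpen_compl_singleton.mem_nhds hx0)
    have hev : ∀ᶠ z in 𝓝 x, z ∈ S := by
      filter_upwards [hc.eventually (lt_mem_nhds (h2.trans_le (not_lt.1 hcon))), isOpen_compl_singleton.mem_nhds hx0] with z a b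
      exact hS z b a.le
    obtain ⟨ε, hε, hb⟩ := Metric.eventually_nhds_iff_ball.1 hev
    have hbT : ball x ε ⊆ T := by
      rw [hTdef, connectedComponentIn_eq hxT]
      exact (convex_ball x ε).isPreconnected.subset_connectedComponentIn (mem_ball_self hε) hb
    obtain ⟨z, hz, hz'⟩ := mem_closure_iff.1 (frontier_subset_closure hx) _ isOpen_ball (mem_ball_self hε)
    exact hGT hz' (hbT hz)
  set U := {z : ℂ | z ≠ 0} ∩ f ⁻¹' Ioo v v'
  have hU : IsOpen U := hf.isOpen_inter_preimage isOpen_compl_singleton isOpen_Ioo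
  have hK : IsCompact (closure G \ U) := (hGb.isCompact_closure).diff hU
  have hKG : closure G \ U ⊆ G := fun z hz => by
    by_contra h
    exact hz.2 (hfr z ⟨hz.1, by rwa [hGo.interior_eq]⟩)
  obtain ⟨-, k, k1, k2⟩ := inj_holo_inverse isOpen_ball g1 g2
  rw [g3] at k1
  have hk3 : ∀ z ∈ G, k z ∈ ball (0:ℂ) 1 ∧ g (k z) = z := by
    rintro z hz
    rw [← g3] at hz
    obtain ⟨w, hw, rfl⟩ := hz
    rw [k2 w hw]; exact ⟨hw, rfl⟩
  obtain ⟨r, hr0, hr1, hr⟩ : ∃ r : ℝ, 0 < r ∧ r < 1 ∧ ∀ z ∈ closure G \ U, ‖k z‖ < r := by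
    have hc : IsCompact (k '' (closure G \ U)) := hK.image_of_continuousOn (k1.continuousOn.mono hKG)
    obtain ⟨δ, hδ, hδ'⟩ := hc.exists_thickening_subset_open isOpen_ball (by rintro _ ⟨z, hz, rfl⟩; exact (hk3 z (hKG hz)).1)
    rcases (closure G \ U).eq_empty_or_nonempty with he | hne
    · exact ⟨1/2, by norm_num, by norm_num, by simp [he]⟩
    · obtain ⟨w, hw, hm⟩ := hK.exists_isMaxOn hne ((k1.continuousOn.mono hKG).norm)
      have := mem_ball_zero_iff.1 (hk3 w (hKG hw)).1
      refine ⟨(‖k w‖ + 1) / 2, by positivity, by linarith, fun z hz => ?_⟩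
      have : ‖k z‖ ≤ ‖k w‖ := hm hz
      linarith
  have hsb : sphere (0:ℂ) r ⊆ ball 0 1 := fun z hz => by
    rw [mem_ball_zero_iff, mem_sphere_zero_iff_norm.1 hz]; exact hr1
  have hcb : closedBall (0:ℂ) r ⊆ ball 0 1 := closedBall_subset_ball hr1
  have hgc := g1.continuousOn
  have hJ : IsJCurve (g '' sphere 0 r) := (sphere_EJ hr0).j.image (hgc.mono hsb) (g2.mono hsb)
  have h0b : (0:ℂ) ∈ ball (0:ℂ) 1 := by simp
  have h0L : (0:ℂ) ∉ g '' sphere 0 r := by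
    rintro ⟨z, hz, h⟩
    rw [← g4] at h
    rw [g2 (hsb hz) h0b h] at hz
    simp [hr0.ne] at hz
  refine ⟨g '' sphere 0 r, ⟨hJ, h0L, fun hHL => ?_⟩, ?_⟩
  · refine unbdd_of_HL hJ.isCompact h0L (by simpa using hHL) ?_
    have hbb : ball (0:ℂ) r ⊆ ball 0 1 := ball_subset_ball hr1.le
    obtain ⟨ho, -⟩ := inj_holo_inverse isOpen_ball (g1.mono hbb) (g2.mono hbb)
    have hcc : IsCompact (g '' closedBall 0 r) := (isCompact_closedBall _ _).image_of_continuousOn (hgc.mono hcb)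
    refine hcc.isBounded.subset (Subset.trans ?_ (image_mono ball_subset_closedBall))
    refine isPreconnected_connectedComponentIn.subset_of_closure_inter_subset ho
      ⟨0, mem_connectedComponentIn h0L, 0, by simpa using hr0, g4⟩ ?_
    rintro z ⟨hz, hz'⟩
    obtain ⟨w, hw, rfl⟩ := closure_minimal (image_mono ball_subset_closedBall) hcc.isClosed hz
    refine ⟨w, ?_, rfl⟩
    rcases (mem_closedBall_zero_iff.1 hw).lt_or_eq with h | h
    · simpa using h
    · exact (connectedComponentIn_subset _ _ hz' ⟨w, by simpa using h, rfl⟩).elim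
  · rintro _ ⟨z, hz, rfl⟩
    have hgz : g z ∈ G := g3 ▸ ⟨z, hsb hz, rfl⟩
    by_contra hcon
    have := hr (g z) ⟨subset_closure hgz, fun h => hcon h.2⟩
    rw [k2 z (hsb hz), mem_sphere_zero_iff_norm.1 hz] at this
    exact lt_irrefl _ this
namespace Cyl
variable (C : Cyl) {f : ℂ → ℝ} {X L L' : Set ℂ}

theorem sep (fe : ∀ i, ∀ z ≠ 0, f (C.act i z) = C.sg i * f z + C.n i) {z w : ℂ} (hz : z ≠ 0) (hw : w ≠ 0)
    (h1 : f z ∈ Icc C.c (C.c + 1 / 5)) (h2 : f w ∈ Icc C.c (C.c + 1 / 5)) (h : C.P z = C.P w) : z = w := by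
  obtain ⟨i, rfl⟩ := (C.fib z w hz hw).1 h
  rcases C.free i with hi | ⟨-, hi⟩
  · exact (hi z hz).symm
  · exact (hi _ h1 _ h2 (fe i z hz).symm).elim

theorem step (fe : ∀ i, ∀ z ≠ 0, f (C.act i z) = C.sg i * f z + C.n i) (hL : EJ L) (hL' : EJ L') {A B : Set ℝ}
    (hA : A ⊆ Icc C.c (C.c + 1 / 5)) (hB : B ⊆ Icc C.c (C.c + 1 / 5)) (hd : Disjoint A B)
    (h1 : ∀ z ∈ L, f z ∈ A) (h2 : ∀ z ∈ L', f z ∈ B) : Iso (C.P '' L) (C.P '' L') := by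
  refine C.adj hL hL' (fun z hz w hw h => C.sep fe (hL.ne_zero hz) (hL.ne_zero hw) (hA (h1 z hz)) (hA (h1 w hw)) h)
    (fun z hz w hw h => C.sep fe (hL'.ne_zero hz) (hL'.ne_zero hw) (hB (h2 z hz)) (hB (h2 w hw)) h) (disjoint_left.2 ?_)
  rintro _ ⟨z, hz, rfl⟩ ⟨w, hw, h⟩
  have := C.sep fe (hL'.ne_zero hw) (hL.ne_zero hz) (hB (h2 w hw)) (hA (h1 z hz)) h
  exact disjoint_left.1 hd (h1 z hz) (this ▸ h2 w hw)

theorem exists_phi (hX : EJ X) (iX : InjOn C.P X) : ∃ φ : ℂ → ℝ, ContinuousOn φ {0}ᶜ ∧ (∃ M > 0, ∀ z ≠ 0, |φ z| ≤ M) ∧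
    (∀ i, ∀ z ≠ 0, φ (C.act i z) = C.sg i * φ z) ∧ ∀ z ∈ X, φ z = C.c - Real.log ‖z‖ := by
  have hX0 : X ⊆ {0}ᶜ := fun z hz => hX.ne_zero hz
  have hc := hX.j.isCompact
  have : CompactSpace X := isCompact_iff_compactSpace.1 hc
  have he : IsClosedEmbedding (fun z : X => C.P z) :=
    Continuous.isClosedEmbedding (continuousOn_iff_continuous_domRestrict.1 (C.cont.mono hX0)) fun z w h => Subtype.ext (iX z.2 w.2 h)
  have hg : ContinuousOn (fun z : ℂ => ((C.c - Real.log ‖z‖ : ℝ) : ℂ) * C.tw z) X := by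
    refine ContinuousOn.mul ?_ (C.tw_cont.mono hX0)
    refine continuous_ofReal.comp_continuousOn (continuousOn_const.sub (ContinuousOn.log continuous_norm.continuousOn ?_))
    exact fun z hz => norm_ne_zero_iff.2 (hX0 hz)
  obtain ⟨ψ, hψ⟩ := ContinuousMap.exists_extension' he ⟨_, continuousOn_iff_continuous_domRestrict.1 hg⟩
  obtain ⟨M, hM⟩ := isCompact_univ.exists_bound_of_continuousOn ψ.continuous.continuousOn
  refine ⟨fun z => (ψ (C.P z) * (starRingEnd ℂ) (C.tw z)).re, ?_, ⟨max M 1, by positivity, fun z hz => ?_⟩, fun i z hz => ?_, fun z hz => ?_⟩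
  · exact continuous_re.comp_continuousOn ((ψ.continuous.comp_continuousOn C.cont).mul
      (continuous_conj.comp_continuousOn C.tw_cont))
  · refine (abs_re_le_norm _).trans ?_
    rw [norm_mul, RCLike.norm_conj, C.tw_norm z hz, mul_one]
    exact (hM _ trivial).trans (le_max_left _ _)
  · simp only [C.P_act i hz, C.tw_act i z hz, map_mul, conj_ofReal]
    rw [← Complex.re_ofReal_mul]; congr 1; ring
  · have h1 : ψ (C.P z) = ((C.c - Real.log ‖z‖ : ℝ) : ℂ) * C.tw z := congrFun hψ ⟨z, hz⟩
    simp only [h1]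
    rw [mul_assoc, mul_conj, normSq_eq_norm_sq, C.tw_norm z (hX0 hz)]
    norm_num [log_re]

theorem mainIso (hX : EJ X) (iX : InjOn C.P X) : Iso (C.P '' X) (C.P '' sphere 0 (Real.exp C.c)) := by
  obtain ⟨φ, hφ, ⟨M, hM0, hM⟩, he, hφX⟩ := C.exists_phi hX iX
  obtain ⟨N, hN⟩ := exists_nat_gt (25 * M)
  have hN0 : (0:ℝ) < N := by linarith
  set F : ℕ → ℂ → ℝ := fun k z => Real.log ‖z‖ + (1 - k / N) * φ z with hF
  have hFe : ∀ k i, ∀ z ≠ 0, F k (C.act i z) = C.sg i * F k z + C.n i := fun k i z hz => by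
    simp only [hF, he i z hz, (C.norm_act i hz).2]; ring
  have hFc : ∀ k, ContinuousOn (F k) {0}ᶜ := fun k =>
    (ContinuousOn.log continuous_norm.continuousOn fun z hz => norm_ne_zero_iff.2 hz).add (continuousOn_const.mul hφ)
  have hB : ∀ k, ∀ v v' : ℝ, v < v' → ∃ L, EJ L ∧ ∀ z ∈ L, F k z ∈ Ioo v v' := fun k v v' h =>
    Band (hFc k) (M := |1 - (k:ℝ) / N| * M) (fun z hz => by
      simp only [hF, add_sub_cancel_left, abs_mul]
      exact mul_le_mul_of_nonneg_left (hM z hz) (abs_nonneg _)) h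
  have hFF : ∀ k, ∀ z ≠ 0, |F (k+1) z - F k z| < 1 / 25 := fun k z hz => by
    have : F (k+1) z - F k z = - (φ z / N) := by simp only [hF]; push_cast; ring
    rw [this, abs_neg, abs_div, abs_of_pos hN0, div_lt_iff₀ hN0]
    linarith [hM z hz]
  have key : ∀ k, ∃ L, EJ L ∧ Iso (C.P '' X) (C.P '' L) ∧ ((∀ z ∈ L, F k z ∈ Ioo (C.c + 1/25) (C.c + 2/25)) ∨
      (∀ z ∈ L, F k z ∈ Ioo (C.c + 3/25) (C.c + 4/25))) := by
    intro k
    induction k with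
    | zero =>
      obtain ⟨L, hL, hL'⟩ := hB 0 (C.c + 1/25) (C.c + 2/25) (by linarith)
      refine ⟨L, hL, C.step (hFe 0) hX hL (A := {C.c}) (B := Ioo (C.c + 1/25) (C.c + 2/25)) ?_ ?_ ?_ ?_ hL', Or.inl hL'⟩
      · rintro _ rfl; constructor <;> linarith
      · rintro x ⟨h1, h2⟩; constructor <;> linarith
      · refine disjoint_left.2 ?_
        rintro _ rfl ⟨h1, h2⟩; linarith
      · intro z hz
        simp [hF, hφX z hz]
    | succ k ih =>
      obtain ⟨L, hL, hi, h | h⟩ := ih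
      · obtain ⟨L', hL', h'⟩ := hB (k+1) (C.c + 3/25) (C.c + 4/25) (by linarith)
        refine ⟨L', hL', hi.trans (C.step (hFe k) hL hL' (A := Ioo (C.c + 1/25) (C.c + 2/25))
          (B := Ioo (C.c + 2/25) (C.c + 5/25)) ?_ ?_ ?_ h fun z hz => ?_), Or.inr h'⟩
        · rintro x ⟨h1, h2⟩; constructor <;> linarith
        · rintro x ⟨h1, h2⟩; constructor <;> linarith
        · refine disjoint_left.2 ?_
          rintro x ⟨-, h1⟩ ⟨h2, -⟩; linarith
        · have := abs_lt.1 (hFF k z (hL'.ne_zero hz))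
          have := h' z hz
          constructor <;> linarith [this.1, this.2]
      · obtain ⟨L', hL', h'⟩ := hB (k+1) (C.c + 1/25) (C.c + 2/25) (by linarith)
        refine ⟨L', hL', hi.trans (C.step (hFe k) hL hL' (A := Ioo (C.c + 3/25) (C.c + 4/25))
          (B := Ioo C.c (C.c + 3/25)) ?_ ?_ ?_ h fun z hz => ?_), Or.inl h'⟩
        · rintro x ⟨h1, h2⟩; constructor <;> linarith
        · rintro x ⟨h1, h2⟩; constructor <;> linarith
        · refine disjoint_left.2 ?_
          rintro x ⟨h1, -⟩ ⟨-, h2⟩; linarith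
        · have := abs_lt.1 (hFF k z (hL'.ne_zero hz))
          have := h' z hz
          constructor <;> linarith [this.1, this.2]
  obtain ⟨L, hL, hi, h⟩ := key N
  refine hi.trans (C.step (hFe N) hL (sphere_EJ (exp_pos _)) (A := Ioo C.c (C.c + 1/5)) (B := {C.c}) Ioo_subset_Icc_self ?_ ?_ ?_ ?_)
  · rintro _ rfl; constructor <;> linarith
  · refine disjoint_left.2 ?_
    rintro _ ⟨h1, -⟩ rfl; linarith
  · intro z hz
    rcases h with h | h <;> constructor <;> linarith [(h z hz).1, (h z hz).2]
  · intro z hz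
    rw [mem_sphere_zero_iff_norm] at hz
    simp [hF, hz, hN0.ne']
end Cyl

def ks (n : ℤ) : ℝ := if Even n then 1 else -1

theorem ks_or (n : ℤ) : (Even n ∧ ks n = 1) ∨ (¬ Even n ∧ ks n = -1) := by
  unfold ks; by_cases h : Even n <;> simp [h]

theorem kp_eq {z w : ℂ} : kp z = kp w ↔ ∃ n m : ℤ, w.re = z.re + n ∧ w.im = ks n * z.im + m * (2 * π) := by
  rw [kp, kp, kmk_eq']
  refine exists_congr fun n => ?_
  rw [kshift, Prod.mk.injEq, exists_and_left]
  refine and_congr_right fun _ => ?_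
  unfold ks
  split_ifs
  · rw [Circle.exp_eq_exp]; simp
  · rw [← Circle.exp_neg, Circle.exp_eq_exp]; simp

theorem isOpenMap_kp : IsOpenMap kp := by
  have h : IsOpenMap (fun z : ℂ => (z.re, Circle.exp z.im)) :=
    (IsOpenMap.prodMap IsOpenMap.id Circle.isCoveringMap_exp.isLocalHomeomorph.isOpenMap).comp
      equivRealProdCLM.toHomeomorph.isOpenMap
  exact isOpenMap_kmk.comp h

theorem continuous_cmk {α : Type*} [TopologicalSpace α] {f g : α → ℝ} (hf : Continuous f) (hg : Continuous g) :
    Continuous fun x => (⟨f x, g x⟩ : ℂ) :=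
  equivRealProdCLM.symm.continuous.comp (hf.prodMk hg)

def CylK (K : ℂ → KleinBottle) : Prop := (∀ w, K (Complex.log (Complex.exp w)) = K w) ∧
    ContinuousOn (K ∘ Complex.log) {0}ᶜ ∧ (∀ U ⊆ {0}ᶜ, IsOpen U → IsOpen ((K ∘ Complex.log) '' U)) ∧
    ∀ z ≠ 0, ∃ u ∈ 𝓝 z, InjOn (K ∘ Complex.log) u

theorem cyl_aux {K : ℂ → KleinBottle} (hK : Continuous K) (ho : IsOpenMap K)
    (hl : ∀ w w', K w = K w' → ‖w - w'‖ < 1 / 2 → w = w') (hp : ∀ w w', Complex.exp w = Complex.exp w' → K w = K w') :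
    CylK K := by
  have h1 : ∀ w, K (Complex.log (Complex.exp w)) = K w := fun w => hp _ _ (exp_log (exp_ne_zero w))
  refine ⟨h1, ?_, fun U hU hUo => ?_, fun z hz => ?_⟩
  · rw [continuousOn_open_iff isOpen_compl_singleton]
    intro t ht
    convert Complex.isOpenMap_exp _ (ht.preimage hK) using 1
    ext z
    constructor
    · rintro ⟨h, h'⟩
      exact ⟨Complex.log z, h', exp_log h⟩
    · rintro ⟨w, hw, rfl⟩
      exact ⟨exp_ne_zero w, by rw [mem_preimage, Function.comp, h1]; exact hw⟩
  · convert ho _ (hUo.preimage continuous_exp) using 1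
    ext k
    constructor
    · rintro ⟨z, hz, rfl⟩
      exact ⟨Complex.log z, by rw [mem_preimage, exp_log (hU hz)]; exact hz, rfl⟩
    · rintro ⟨w, hw, rfl⟩
      exact ⟨_, hw, h1 w⟩
  · refine ⟨Complex.exp '' ball (Complex.log z) (1/4), (Complex.isOpenMap_exp _ isOpen_ball).mem_nhds
      ⟨_, mem_ball_self (by norm_num), exp_log hz⟩, ?_⟩
    rintro _ ⟨a, ha, rfl⟩ _ ⟨b, hb, rfl⟩ h
    simp only [Function.comp, h1] at h
    rw [hl a b h ?_]
    rw [← dist_eq_norm]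
    linarith [dist_triangle_right a b (Complex.log z), mem_ball.1 ha, mem_ball.1 hb]

theorem int_zero {n : ℤ} {a : ℝ} (h : |a| < 1) (h' : a = n) : n = 0 := by
  rw [h'] at h; exact Int.abs_lt_one_iff.1 (by exact_mod_cast h)

theorem kp_loc {z w : ℂ} (h : kp z = kp w) (h1 : |z.re - w.re| < 1) (h2 : |z.im - w.im| < 2 * π) : z = w := by
  obtain ⟨n, m, e1, e2⟩ := kp_eq.1 h
  have hn : n = 0 := int_zero (a := w.re - z.re) (by rwa [abs_sub_comm]) (by linarith)
  subst hn
  simp only [ks, Int.cast_zero, Even.zero, if_true, one_mul, add_zero] at e1 e2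
  have hm : m = 0 := int_zero (a := (w.im - z.im) / (2 * π)) (by
    rw [abs_div, abs_of_pos two_pi_pos, div_lt_one two_pi_pos, abs_sub_comm]; exact h2) (by
    rw [e2]; field_simp; ring)
  subst hm
  exact Complex.ext e1.symm (by rw [e2]; simp)

def Kb (w : ℂ) : KleinBottle := kp ⟨w.im / π, 2 * π * w.re⟩

def hbE : ℂ ≃ₜ ℂ where
  toFun w := ⟨w.im / π, 2 * π * w.re⟩
  invFun w := ⟨w.im / (2 * π), π * w.re⟩
  left_inv w := Complex.ext (by field_simp) (by field_simp)
  right_inv w := Complex.ext (by field_simp) (by field_simp)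
  continuous_toFun := continuous_cmk (by fun_prop) (by fun_prop)
  continuous_invFun := continuous_cmk (by fun_prop) (by fun_prop)

theorem cauxa : CylK kp := cyl_aux (K := kp) continuous_kp isOpenMap_kp
  (fun w w' h h' => kp_loc h ((abs_re_le_norm (w - w')).trans_lt (by linarith))
    ((abs_im_le_norm (w - w')).trans_lt (by linarith [pi_gt_three]))) (fun w w' h => by
    obtain ⟨m, hm⟩ := exp_eq_exp_iff_exists_int.1 h.symm
    exact kp_eq.2 ⟨0, m, by simp [hm], by simp [hm, ks]⟩)

theorem cauxb : CylK Kb := cyl_aux (K := Kb) (continuous_kp.comp hbE.continuous) (isOpenMap_kp.comp hbE.isOpenMap)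
  (fun w w' h h' => by
    have h1 := (abs_re_le_norm (w - w')).trans_lt h'
    have h2 := (abs_im_le_norm (w - w')).trans_lt h'
    rw [sub_re] at h1
    rw [sub_im] at h2
    have hpi := pi_gt_three
    have := kp_loc h (by
      change |w.im / π - w'.im / π| < 1
      rw [← sub_div, abs_div, abs_of_pos pi_pos, div_lt_one pi_pos]; linarith) (by
      change |2 * π * w.re - 2 * π * w'.re| < _
      rw [← mul_sub, abs_mul, abs_of_pos two_pi_pos]
      nlinarith)
    have e1 := congrArg Complex.re this
    have e2 := congrArg Complex.im this
    simp only at e1 e2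
    refine Complex.ext ?_ ?_
    · exact mul_left_cancel₀ two_pi_pos.ne' e2
    · field_simp at e1; exact e1) (fun w w' h => by
    obtain ⟨m, hm⟩ := exp_eq_exp_iff_exists_int.1 h.symm
    refine kp_eq.2 ⟨2 * m, 0, ?_, ?_⟩
    · simp [hm]; field_simp
    · simp [hm, ks])
theorem fin_int (N : ℝ) : {n : ℤ | |(n : ℝ)| ≤ N}.Finite := by
  refine (finite_Icc (-⌊N⌋) ⌊N⌋).subset fun n hn => ?_
  have hn' : |(n : ℝ)| ≤ N := hn
  rw [← Int.cast_abs, ← Int.le_floor, abs_le] at hn'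
  exact hn'

theorem cE (r : ℝ) (w : ℂ) : (Real.exp r : ℂ) * Complex.exp w = Complex.exp (r + w) := by
  rw [exp_add, ofReal_exp]

theorem norm_free {n : ℤ} (hn : n ≠ 0) {z : ℂ} (hz : z ≠ 0) {w : ℂ} (hw : ‖w‖ = ‖z‖) : (Real.exp n : ℂ) * w ≠ z := fun h => by
  have h1 := congrArg norm h
  rw [norm_mul, hw, norm_of_nonneg (exp_pos _).le] at h1
  have h2 : Real.exp n = 1 := mul_right_cancel₀ (norm_ne_zero_iff.2 hz) (by rw [h1, one_mul])
  exact hn (by exact_mod_cast Real.exp_eq_one_iff _ |>.1 h2)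

theorem int_free {n : ℤ} (hn : n ≠ 0) {c s s' : ℝ} (h : s ∈ Icc c (c + 1/5)) (h' : s' ∈ Icc c (c + 1/5)) : 1 * s + n ≠ s' := fun e =>
  hn (int_zero (a := s' - s) (abs_lt.2 ⟨by linarith [h.1, h.2, h'.1, h'.2], by linarith [h.1, h.2, h'.1, h'.2]⟩) (by linarith))

def aact (n : ℤ) (z : ℂ) : ℂ := if Even n then (Real.exp n : ℂ) * z else (Real.exp n : ℂ) * (starRingEnd ℂ) z

theorem aact_comp (n m : ℤ) (z : ℂ) : aact n (aact m z) = aact (n + m) z := by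
  have : (Real.exp ((n + m : ℤ) : ℝ) : ℂ) = Real.exp n * Real.exp m := by
    rw [Int.cast_add, Real.exp_add, ofReal_mul]
  unfold aact
  by_cases h1 : Even n <;> by_cases h2 : Even m <;> simp only [h1, h2, Int.even_add, this, if_true, if_false, iff_true, iff_false,
    not_true, map_mul, conj_ofReal, Complex.conj_conj, mul_assoc]

theorem aact_zero (z : ℂ) : aact 0 z = z := by simp [aact]

def CA : Cyl where
  P := kp ∘ Complex.log
  I := ℤ
  act := aact
  sg _ := 1
  n := id
  tw _ := 1
  c := 0
  cont := cauxa.2.1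
  opn := cauxa.2.2.1
  linj := cauxa.2.2.2
  fib z w hz hw := by
    obtain ⟨a, rfl⟩ : ∃ a, Complex.exp a = z := ⟨_, exp_log hz⟩
    obtain ⟨b, rfl⟩ : ∃ b, Complex.exp b = w := ⟨_, exp_log hw⟩
    simp only [Function.comp, cauxa.1]
    rw [kp_eq]
    refine exists_congr fun n => ?_
    unfold aact ks
    split_ifs
    · rw [cE, exp_eq_exp_iff_exists_int]
      refine exists_congr fun m => ?_
      rw [Complex.ext_iff]
      simp [add_comm]
    · rw [← exp_conj, cE, exp_eq_exp_iff_exists_int]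
      refine exists_congr fun m => ?_
      rw [Complex.ext_iff]
      simp [add_comm]
  form i := Or.inl ⟨rfl, by
    unfold aact
    by_cases h : Even i
    · left; intro z; simp [h]
    · right; intro z; simp [h]⟩
  inv i := ⟨-i, fun z _ => by rw [aact_comp, neg_add_cancel, aact_zero]⟩
  comp i j := ⟨i + j, fun z _ => aact_comp i j z⟩
  free i := by
    by_cases h : i = 0
    · exact Or.inl fun z _ => by rw [h, aact_zero]
    · refine Or.inr ⟨fun z hz => ?_, fun s hs s' hs' => int_free h hs hs'⟩
      unfold aact
      split_ifs
      · exact norm_free h hz rfl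
      · exact norm_free h hz (RCLike.norm_conj z)
  fin := fin_int
  tw_norm z _ := by simp
  tw_cont := continuousOn_const
  tw_act i z _ := by simp

def bact (i : ℤ × Bool) (z : ℂ) : ℂ := if i.2 then (Real.exp i.1 : ℂ) * z else -(Real.exp i.1 : ℂ) * ((starRingEnd ℂ) z)⁻¹

theorem bact_comp (i j : ℤ × Bool) : ∃ k : ℤ × Bool, (k.1 = if i.2 then i.1 + j.1 else i.1 - j.1) ∧ (k.2 = (i.2 == j.2)) ∧
    ∀ z, bact i (bact j z) = bact k z := by
  obtain ⟨n, b⟩ := i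
  obtain ⟨m, b'⟩ := j
  refine ⟨⟨if b then n + m else n - m, b == b'⟩, rfl, rfl, fun z => ?_⟩
  have h1 : (Real.exp ((n : ℝ) + m) : ℂ) = Real.exp n * Real.exp m := by
    rw [Real.exp_add, ofReal_mul]
  have h2 : (Real.exp ((n : ℝ) - m) : ℂ) = Real.exp n * (Real.exp m : ℂ)⁻¹ := by
    rw [Real.exp_sub, ofReal_div, div_eq_mul_inv]
  cases b <;> cases b' <;> simp [bact, h1, h2, -ofReal_exp, conj_ofReal] <;> ring

def CB : Cyl where
  P := Kb ∘ Complex.log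
  I := ℤ × Bool
  act := bact
  sg i := if i.2 then 1 else -1
  n := Prod.fst
  tw z := z / ‖z‖
  c := 1 / 4
  cont := cauxb.2.1
  opn := cauxb.2.2.1
  linj := cauxb.2.2.2
  fib z w hz hw := by
    obtain ⟨a, rfl⟩ : ∃ a, Complex.exp a = z := ⟨_, exp_log hz⟩
    obtain ⟨b, rfl⟩ : ∃ b, Complex.exp b = w := ⟨_, exp_log hw⟩
    simp only [Function.comp, cauxb.1]
    have hpi := Real.pi_ne_zero
    rw [Kb, Kb, kp_eq]
    have hE : ∀ m : ℤ, -(Real.exp m : ℂ) * ((starRingEnd ℂ) (Complex.exp a))⁻¹ =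
        Complex.exp (m - (starRingEnd ℂ) a + π * Complex.I) := fun m => by
      rw [← exp_conj, ← Complex.exp_neg, exp_add, exp_pi_mul_I, sub_eq_add_neg,
        ← Complex.ofReal_intCast, ← cE]; ring
    constructor
    · rintro ⟨n, m, h1, h2⟩
      simp only at h1 h2
      field_simp at h1 h2
      rcases ks_or n with ⟨⟨k, hk⟩, hs⟩ | ⟨hn, hs⟩
      · refine ⟨⟨m, true⟩, ?_⟩
        simp only [bact, if_true]
        rw [cE, exp_eq_exp_iff_exists_int]
        refine ⟨k, Complex.ext ?_ ?_⟩
        · simp; rw [h2, hs]; ring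
        · simp; rw [h1, hk]; push_cast; ring
      · obtain ⟨k, hk⟩ := Int.not_even_iff_odd.1 hn
        refine ⟨⟨m, false⟩, ?_⟩
        simp only [bact, Bool.false_eq_true, if_false]
        rw [hE, exp_eq_exp_iff_exists_int]
        refine ⟨k, Complex.ext ?_ ?_⟩
        · simp; rw [h2, hs]; ring
        · simp; rw [h1, hk]; push_cast; ring
    · rintro ⟨⟨m, t⟩, h⟩
      cases t
      · simp only [bact, Bool.false_eq_true, if_false] at h
        rw [hE, exp_eq_exp_iff_exists_int] at h
        obtain ⟨k, hk⟩ := h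
        refine ⟨2 * k + 1, m, ?_, ?_⟩
        · simp [hk]; field_simp; ring
        · have : ks (2 * k + 1) = -1 := by simp [ks]
          rw [this]; simp [hk]; ring
      · simp only [bact, if_true] at h
        rw [cE, exp_eq_exp_iff_exists_int] at h
        obtain ⟨k, hk⟩ := h
        refine ⟨2 * k, m, ?_, ?_⟩
        · simp [hk]; field_simp
        · simp [hk, ks]; ring
  form i := by
    obtain ⟨n, b⟩ := i
    cases b
    · exact Or.inr ⟨by simp, fun z => by simp [bact]⟩
    · exact Or.inl ⟨by simp, Or.inl fun z => by simp [bact]⟩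
  inv i := by
    obtain ⟨k, h1, h2, h3⟩ := bact_comp ⟨if i.2 then -i.1 else i.1, i.2⟩ i
    refine ⟨_, fun z _ => (h3 z).trans ?_⟩
    have e1 : k.1 = 0 := by rw [h1]; cases i.2 <;> simp
    have e2 : k.2 = true := by rw [h2]; simp
    simp [bact, e1, e2]
  comp i j := by
    obtain ⟨k, -, -, h⟩ := bact_comp i j
    exact ⟨k, fun z _ => h z⟩
  free i := by
    obtain ⟨n, b⟩ := i
    cases b
    · refine Or.inr ⟨fun z hz h => ?_, fun s hs s' hs' h => ?_⟩
      · simp only [bact, Bool.false_eq_true, if_false] at h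
        have hz' : (starRingEnd ℂ) z ≠ 0 := by simpa using hz
        rw [mul_inv_eq_iff_eq_mul₀ hz', mul_conj] at h
        have h' : -(Real.exp n) = Complex.normSq z := by exact_mod_cast h
        linarith [exp_pos n, Complex.normSq_nonneg z]
      · simp only [Bool.false_eq_true, if_false] at h
        have h1 : (0:ℝ) < n := by linarith [hs.1, hs'.1]
        have h2 : (n:ℝ) < 1 := by linarith [hs.2, hs'.2]
        have h3 : 0 < n := by exact_mod_cast h1
        have h4 : n < 1 := by exact_mod_cast h2
        omega
    · by_cases h : n = 0
      · exact Or.inl fun z _ => by simp [bact, h]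
      · refine Or.inr ⟨fun z hz => ?_, fun s hs s' hs' => ?_⟩
        · simp only [bact, if_true]
          exact norm_free h hz rfl
        · simpa using int_free h hs hs'
  fin N := ((fin_int N).prod (finite_univ (α := Bool))).subset fun i hi => ⟨hi, trivial⟩
  tw_norm z hz := by simp [hz]
  tw_cont := continuousOn_id.div (by fun_prop) fun z hz => by simpa using hz
  tw_act i z hz := by
    obtain ⟨n, b⟩ := i
    have hz' : (starRingEnd ℂ) z ≠ 0 := by simpa using hz
    have hn : (‖z‖ : ℂ) ≠ 0 := by simpa using hz
    have he : (Real.exp n : ℂ) ≠ 0 := by exact_mod_cast (exp_pos n).ne'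
    cases b
    · simp only [bact, Bool.false_eq_true, if_false, norm_mul, norm_neg, norm_inv, RCLike.norm_conj,
        norm_of_nonneg (exp_pos n).le]
      push_cast [-ofReal_exp]
      field_simp
      rw [mul_comm, Complex.mul_conj']
    · simp only [bact, if_true, norm_mul, norm_of_nonneg (exp_pos n).le]
      push_cast [-ofReal_exp]
      field_simp

def kt (n m : ℤ) (z : ℂ) : ℂ := ⟨z.re + n, ks n * z.im + m * (2 * π)⟩

theorem kp_kt (n m : ℤ) (z : ℂ) : kp (kt n m z) = kp z := (kp_eq.2 ⟨n, m, rfl, rfl⟩).symm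

theorem kp_eq_kt {z w : ℂ} (h : kp z = kp w) : ∃ n m, w = kt n m z := by
  obtain ⟨n, m, h1, h2⟩ := kp_eq.1 h
  exact ⟨n, m, Complex.ext h1 h2⟩

theorem kt_zero (z : ℂ) : kt 0 0 z = z := by apply Complex.ext <;> simp [kt, ks]

theorem int_const {α : Type*} [TopologicalSpace α] {X : Set α} (hX : IsPreconnected X) {f : α → ℝ} (hf : ContinuousOn f X)
    (h : ∀ x ∈ X, ∃ n : ℤ, f x = n) : ∃ n : ℤ, ∀ x ∈ X, f x = n := by
  obtain ⟨n, hn⟩ := log_diff_const hX (l := fun x => f x * (2 * π * I)) (l' := fun _ => 0)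
    (by exact (continuous_ofReal.comp_continuousOn hf).mul continuousOn_const) continuousOn_const (fun x hx => by
      obtain ⟨n, hn⟩ := h x hx
      rw [hn, Complex.ofReal_intCast, exp_int_mul_two_pi_mul_I, Complex.exp_zero])
  refine ⟨n, fun x hx => ?_⟩
  have := hn x hx
  rw [zero_add] at this
  exact_mod_cast mul_right_cancel₀ two_pi_I_ne_zero this

theorem deck {α : Type*} [TopologicalSpace α] {X : Set α} (hX : IsPreconnected X) {L L' : α → ℂ} (hL : ContinuousOn L X)
    (hL' : ContinuousOn L' X) (h : ∀ x ∈ X, kp (L x) = kp (L' x)) : ∃ n m : ℤ, ∀ x ∈ X, L' x = kt n m (L x) := by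
  have r1 := continuous_re.comp_continuousOn hL
  have r2 := continuous_re.comp_continuousOn hL'
  have i1 := continuous_im.comp_continuousOn hL
  have i2 := continuous_im.comp_continuousOn hL'
  obtain ⟨n, hn⟩ := int_const hX (f := fun x => (L' x).re - (L x).re) (r2.sub r1) (fun x hx => by
    obtain ⟨n, m, h1, h2⟩ := kp_eq.1 (h x hx)
    exact ⟨n, by linarith⟩)
  obtain ⟨m, hm⟩ := int_const hX (f := fun x => ((L' x).im - ks n * (L x).im) / (2 * π))
    ((i2.sub (continuousOn_const.mul i1)).div_const _) (fun x hx => by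
    obtain ⟨n', m, h1, h2⟩ := kp_eq.1 (h x hx)
    have : n' = n := by
      have := hn x hx
      have h3 : (n' : ℝ) = n := by linarith
      exact_mod_cast h3
    subst this
    exact ⟨m, by rw [h2]; field_simp; ring⟩)
  refine ⟨n, m, fun x hx => Complex.ext ?_ ?_⟩
  · simp only [kt]; linarith [hn x hx]
  · have := hm x hx
    rw [div_eq_iff two_pi_pos.ne'] at this
    simp only [kt]; linarith

structure Lf (γ : Circle → KleinBottle) (L : ℝ → ℂ) (n m : ℤ) : Prop where
  c : Continuous L
  e : ∀ s, γ (Circle.exp s) = kp (L s)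
  p : ∀ s, L (s + 2 * π) = kt n m (L s)

theorem cexp_2pi (s : ℝ) : Circle.exp (s + 2 * π) = Circle.exp s := Circle.periodic_exp s

theorem exists_Lf' {γ : Circle → KleinBottle} {L : ℝ → ℂ} (c : Continuous L) (e : ∀ s, γ (Circle.exp s) = kp (L s)) :
    ∃ n m, Lf γ L n m := by
  obtain ⟨n, m, h⟩ := deck (X := univ) isPreconnected_univ c.continuousOn
    (L' := fun s => L (s + 2 * π)) (by fun_prop) (fun s _ => by rw [← e, ← e, cexp_2pi])
  exact ⟨n, m, c, e, fun s => h s trivial⟩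

theorem exists_Lf {γ : Circle → KleinBottle} (hγ : Continuous γ) : ∃ L n m, Lf γ L n m := by
  obtain ⟨L, h1, h2⟩ := kp_lift (X := (univ : Set ℝ)) (Γ := fun s => γ (Circle.exp s)) convex_univ (by fun_prop)
  exact ⟨L, exists_Lf' (continuousOn_univ.1 h1) fun s => h2 s trivial⟩

theorem cyl_curve (C : Cyl) {K : ℂ → KleinBottle} (hK : ∀ w, C.P (Complex.exp w) = K w) {γ : Circle → KleinBottle}
    (hi : Function.Injective γ) {M : ℝ → ℂ} (hM : Continuous M) {k : ℤ} (hk : k ≠ 0)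
    (hp : ∀ s, M (s + 2 * π) = M s + k * (2 * π * I)) (he : ∀ s, γ (Circle.exp s) = K (M s)) :
    Iso (range γ) (C.P '' sphere 0 (Real.exp C.c)) := by
  obtain ⟨g, g1, g2⟩ := descend_circle (F := fun s => Complex.exp (M s)) (by fun_prop) (fun s => by
    rw [hp, exp_add, exp_int_mul_two_pi_mul_I, mul_one])
  have hg : ∀ u, C.P (g u) = γ u := fun u => by
    obtain ⟨s, rfl⟩ := Circle.exp_surjective u
    rw [g2, hK, he]
  have hgi : Function.Injective g := fun u v h => hi (by rw [← hg, ← hg, h])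
  have : range γ = C.P '' range g := by rw [← range_comp]; congr 1; ext u; exact (hg u).symm
  rw [this]
  refine C.mainIso ⟨⟨g, g1, hgi, rfl⟩, ?_, ?_⟩ ?_
  · rintro ⟨u, hu⟩
    obtain ⟨s, rfl⟩ := Circle.exp_surjective u
    rw [g2] at hu
    exact exp_ne_zero _ hu
  · rintro ⟨l, lc, le⟩
    have le' : ∀ z ∈ range g, Complex.exp (l z) = z := le
    obtain ⟨n, hn⟩ := log_diff_const (X := (univ : Set ℝ)) isPreconnected_univ (l := M) (l' := fun s => l (g (Circle.exp s)))
      hM.continuousOn (lc.comp (by fun_prop) fun s _ => ⟨_, rfl⟩) (fun s _ => by rw [le' _ ⟨_, rfl⟩, g2])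
    have h1 := hn (0 + 2 * π) trivial
    rw [hp, cexp_2pi, hn 0 trivial, add_eq_left] at h1
    exact hk (by exact_mod_cast (mul_eq_zero.1 h1).resolve_right two_pi_I_ne_zero)
  · rintro _ ⟨u, rfl⟩ _ ⟨v, rfl⟩ h
    rw [hg, hg] at h
    rw [hi h]

theorem case_a {γ : Circle → KleinBottle} (hi : Function.Injective γ) {L : ℝ → ℂ} {m : ℤ} (h : Lf γ L 0 m) (hm : m ≠ 0) :
    Iso (range γ) (CA.P '' sphere 0 (Real.exp CA.c)) :=
  cyl_curve CA (K := kp) cauxa.1 hi h.c hm (fun s => by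
    rw [h.p]; apply Complex.ext <;> simp [kt, ks]) h.e

theorem case_b {γ : Circle → KleinBottle} (hi : Function.Injective γ) {L : ℝ → ℂ} {k : ℤ} (h : Lf γ L (2 * k) 0) (hk : k ≠ 0) :
    Iso (range γ) (CB.P '' sphere 0 (Real.exp CB.c)) :=
  cyl_curve CB (K := Kb) cauxb.1 hi (M := fun s => hbE.symm (L s)) (hbE.symm.continuous.comp h.c) hk (fun s => by
    rw [h.p]; apply Complex.ext <;> simp [kt, ks, hbE]; ring) (fun s => by
    rw [h.e]; exact congrArg kp (hbE.apply_symm_apply _).symm)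

theorem surj_near {F : ℂ → ℂ} (hF : Continuous F) {M : ℝ} (hM : ∀ z, ‖F z - z‖ ≤ M) : ∃ z, F z = 0 := by
  by_contra! h
  have hp : 0 < 2 * |M| + 1 := by positivity
  refine not_HL_sphere (a := (0:ℂ)) hp one_ne_zero (((HL.of_convex (X := (univ : Set ℂ)) convex_univ hF.continuousOn
    fun z _ => h z).mono (subset_univ _)).of_near (by simp only [zpow_one]; fun_prop) fun z hz => ?_)
  rw [mem_sphere_zero_iff_norm] at hz
  rw [sub_zero, zpow_one, norm_sub_rev]
  have h1 := hM z
  have h2 := norm_sub_norm_le z (F z)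
  rw [norm_sub_rev] at h2
  linarith [le_abs_self M]

theorem case_c {γ : Circle → KleinBottle} (hi : Function.Injective γ) {L : ℝ → ℂ} {k m : ℤ} (h : Lf γ L (2 * k) m) (hk : k ≠ 0)
    (hm : m ≠ 0) : False := by
  have hpi := pi_pos
  have hkr : (k:ℝ) ≠ 0 := by exact_mod_cast hk
  have hmr : (m:ℝ) ≠ 0 := by exact_mod_cast hm
  set A : ℝ → ℂ := fun s => L s - ⟨k / π * s, m * s⟩ with hA
  have hAc : Continuous A := h.c.sub (continuous_cmk (by fun_prop) (by fun_prop))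
  have hAp : ∀ s, A (s + 2 * π) = A s := fun s => by
    simp only [hA]; rw [h.p]
    apply Complex.ext <;> simp [kt, ks] <;> field_simp <;> ring
  obtain ⟨B, hB, hBA⟩ := descend_circle hAc hAp
  obtain ⟨M, hM⟩ := isCompact_univ.exists_bound_of_continuousOn hB.continuousOn
  have hMA : ∀ s, ‖A s‖ ≤ M := fun s => hBA s ▸ hM _ trivial
  have hLA : ∀ s, L s = A s + ⟨k / π * s, m * s⟩ := fun s => by simp [hA]
  set p : ℂ → ℝ := fun z => (π / k * z.re + z.im / m) / 2
  set q : ℂ → ℝ := fun z => (z.im / m - π / k * z.re) / 2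
  obtain ⟨z, hz⟩ := surj_near (F := fun z => ⟨(L (p z)).re - (L (q z)).re - 1, (L (p z)).im + (L (q z)).im⟩)
    (continuous_cmk ((continuous_re.comp (h.c.comp (by fun_prop))).sub (continuous_re.comp (h.c.comp (by fun_prop))) |>.sub
      continuous_const) ((continuous_im.comp (h.c.comp (by fun_prop))).add (continuous_im.comp (h.c.comp (by fun_prop)))))
    (M := 4 * M + 1) (fun z => by
      refine (Complex.norm_le_abs_re_add_abs_im _).trans ?_
      have e1 : (L (p z)).re - (L (q z)).re - 1 - z.re = (A (p z)).re - (A (q z)).re - 1 := by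
        rw [hLA, hLA]; simp [p, q]; field_simp; ring
      have e2 : (L (p z)).im + (L (q z)).im - z.im = (A (p z)).im + (A (q z)).im := by
        rw [hLA, hLA]; simp [p, q]; field_simp; ring
      simp only [sub_re, sub_im, e1, e2]
      have b1 := abs_le.1 ((abs_re_le_norm (A (p z))).trans (hMA _))
      have b2 := abs_le.1 ((abs_re_le_norm (A (q z))).trans (hMA _))
      have b3 := abs_le.1 ((abs_im_le_norm (A (p z))).trans (hMA _))
      have b4 := abs_le.1 ((abs_im_le_norm (A (q z))).trans (hMA _))
      have c1 : |(A (p z)).re - (A (q z)).re - 1| ≤ 2 * M + 1 := abs_le.2 ⟨by linarith, by linarith⟩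
      have c2 : |(A (p z)).im + (A (q z)).im| ≤ 2 * M := abs_le.2 ⟨by linarith, by linarith⟩
      linarith)
  have z1 := congrArg Complex.re hz
  have z2 := congrArg Complex.im hz
  simp only [Complex.zero_re, Complex.zero_im] at z1 z2
  have hkp : kp (L (q z)) = kp (L (p z)) := kp_eq.2 ⟨1, 0, by push_cast; linarith, by simp [ks]; linarith⟩
  rw [← h.e, ← h.e] at hkp
  obtain ⟨j, hj⟩ := Circle.exp_eq_exp.1 (hi hkp)
  have hAj : A (q z) = A (p z) := by rw [hj]; exact (show Function.Periodic A (2 * π) from hAp).int_mul j _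
  rw [hLA, hLA, hAj, hj] at z1
  simp at z1
  field_simp at z1
  have : (k:ℝ) * j * 2 = -1 := mul_left_cancel₀ hpi.ne' (by linear_combination -z1)
  have : k * j * 2 = -1 := by exact_mod_cast this
  omega

theorem not_disc {γ : Circle → KleinBottle} {L : ℝ → ℂ} (hγ : Continuous γ) {n m : ℤ} (h : Lf γ L n m) (hne : L (0 + 2 * π) ≠ L 0) :
    ¬ BoundsDisc γ := by
  rintro ⟨d, hd, hr⟩
  classical
  set D : ℂ → KleinBottle := fun z => if hz : z ∈ closedBall (0:ℂ) 1 then d ⟨z, hz⟩ else kp 0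
  have hDd : ∀ z : closedBall (0:ℂ) 1, D z = d z := fun z => by simp only [D]; rw [dif_pos z.2]
  obtain ⟨l, l1, l2⟩ := kp_lift (X := closedBall (0:ℂ) 1) (Γ := D) (convex_closedBall _ _) (by
    rw [continuousOn_iff_continuous_domRestrict]
    exact hd.continuous.congr fun z => (hDd z).symm)
  let e := hd.toHomeomorph
  have hmem : ∀ s, γ (Circle.exp s) ∈ range d := fun s => by
    have : γ (Circle.exp s) ∈ range γ := ⟨_, rfl⟩
    rw [hr] at this
    exact image_subset_range _ _ this
  set σ : ℝ → ℂ := fun s => l (e.symm ⟨γ (Circle.exp s), hmem s⟩) with hσ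
  have hσc : Continuous σ := l1.comp_continuous (continuous_subtype_val.comp (e.symm.continuous.comp
    ((hγ.comp Circle.exp.continuous).subtype_mk _))) fun s => Subtype.coe_prop _
  obtain ⟨a, b, hab⟩ := deck (X := univ) isPreconnected_univ hσc.continuousOn h.c.continuousOn (fun s _ => by
    rw [← h.e, hσ, ← l2 _ (Subtype.coe_prop _), hDd]
    exact congrArg Subtype.val (e.apply_symm_apply ⟨γ (Circle.exp s), hmem s⟩))
  refine hne ?_
  have : σ (0 + 2 * π) = σ 0 := by simp only [hσ, cexp_2pi]
  rw [hab _ trivial, hab _ trivial, this]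

theorem case_odd {γ : Circle → KleinBottle} {L : ℝ → ℂ} {n m : ℤ} (h : Lf γ L n m) (hn : ¬ Even n) : ¬ HasAnnularNbhd γ := by
  rintro ⟨e, he, heγ⟩
  obtain ⟨E, hE, hEe⟩ := kp_lift (X := (univ : Set ℂ)) (Γ := fun z : ℂ => e (Circle.exp z.re, z.im)) convex_univ
    (he.continuous.comp (by fun_prop)).continuousOn
  rw [continuousOn_univ] at hE
  have hEe' : ∀ z : ℂ, e (Circle.exp z.re, z.im) = kp (E z) := fun z => hEe z trivial
  have hpi := pi_pos
  set T : ℂ := ((2 * π : ℝ) : ℂ)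
  obtain ⟨n', m', hd⟩ := deck (X := univ) isPreconnected_univ hE.continuousOn (L' := fun z => E (z + T)) (by fun_prop)
    (fun z _ => by rw [← hEe', ← hEe', add_re, ofReal_re, cexp_2pi, add_im, ofReal_im, add_zero])
  have hd' : ∀ z, E (z + T) = kt n' m' (E z) := fun z => hd z trivial
  obtain ⟨a, b, hab⟩ := deck (X := univ) isPreconnected_univ h.c.continuousOn (L' := fun s : ℝ => E s) (by fun_prop)
    (fun s _ => by rw [← h.e, ← hEe', ← heγ, ofReal_re, ofReal_im])
  have hnn : n' = n := by
    have h1 := congrArg Complex.re (hd' ((0:ℝ):ℂ))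
    have h2 := congrArg Complex.re (hab (0 + 2 * π) trivial)
    have h3 := congrArg Complex.re (hab 0 trivial)
    rw [h.p] at h2
    rw [Complex.ofReal_add] at h2
    simp only [kt] at h1 h2 h3
    have : (n' : ℝ) = n := by linarith
    exact_mod_cast this
  subst hnn
  have hn0 : (n':ℝ) ≠ 0 := fun h0 => hn (by rw [show n' = 0 by exact_mod_cast h0]; exact Even.zero)
  have hks : ks n' = -1 := by simp [ks, hn]
  have hre : ∀ z (j : ℤ), (E (z + j * T)).re = (E z).re + j * n' := by
    intro z j
    have hP : Function.Periodic (fun x : ℝ => (E (z + (x * (2 * π) : ℝ))).re - x * n') 1 := fun x => by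
      have := congrArg Complex.re (hd' (z + (x * (2 * π) : ℝ)))
      simp only [kt] at this
      beta_reduce
      rw [show z + ((x + 1) * (2 * π) : ℝ) = z + (x * (2 * π) : ℝ) + T by simp [T]; ring, this]; ring
    have := hP.int_mul j 0
    simp [T] at this ⊢
    linarith
  have hinj : ∀ z w, E z = E w → z = w := fun z w hzw => by
    have h1 : e (Circle.exp z.re, z.im) = e (Circle.exp w.re, w.im) := by rw [hEe', hEe', hzw]
    have h2 := he.injective h1
    rw [Prod.mk.injEq] at h2
    obtain ⟨j, hj⟩ := Circle.exp_eq_exp.1 h2.1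
    have h3 : z = w + j * T := Complex.ext (by simp [hj, T]) (by simp [h2.2, T])
    have h4 := hre w j
    rw [← h3, hzw] at h4
    have h5 : (j:ℝ) = 0 := by
      have : (j:ℝ) * n' = 0 := by linarith
      exact (mul_eq_zero.1 this).resolve_right hn0
    rw [h3, show j = 0 by exact_mod_cast h5]; simp
  set c : ℝ → ℂ := fun θ => Complex.exp (θ * I) with hc
  have hcc : Continuous c := by fun_prop
  have c0 : ∀ θ, c θ ≠ 0 := fun θ => exp_ne_zero _
  have c1 : ∀ θ, c (θ + π) = - c θ := fun θ => by
    simp only [hc]; push_cast; rw [add_mul, exp_add, exp_pi_mul_I]; ring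
  have c2 : ∀ θ, c (θ + 2 * π) = c θ := fun θ => by
    rw [show θ + 2 * π = θ + π + π by ring, c1, c1, neg_neg]
  obtain ⟨l, l1, l2⟩ := HL.of_convex (X := (univ : Set (ℂ × ℝ))) (g := fun p => E (p.1 + c p.2) - E p.1) convex_univ
    (Continuous.continuousOn (by fun_prop)) (fun p _ h0 => c0 p.2 (by
      have := hinj _ _ (sub_eq_zero.1 h0)
      simpa using this))
  rw [continuousOn_univ] at l1
  have l2' : ∀ z θ, Complex.exp (l (z, θ)) = E (z + c θ) - E z := fun z θ => l2 (z, θ) trivial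
  obtain ⟨d, hdd⟩ := log_diff_const (X := (univ : Set (ℂ × ℝ))) isPreconnected_univ (l := fun p => l (p.1, p.2 + 2 * π))
    (l' := l) (by fun_prop) l1.continuousOn (fun p _ => by rw [l2', c2, ← l2'])
  have hdd' : ∀ z θ, l (z, θ + 2 * π) = l (z, θ) + d * (2 * π * I) := fun z θ => hdd (z, θ) trivial
  obtain ⟨q, hq⟩ := log_diff_const (X := (univ : Set ℝ)) isPreconnected_univ (l := fun θ => l (T, θ))
    (l' := fun θ => (starRingEnd ℂ) (l (0, θ))) (by fun_prop) (continuous_conj.comp (by fun_prop)).continuousOn (fun θ _ => by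
      rw [exp_conj, l2', l2', add_comm T, hd', show E T = _ from zero_add T ▸ hd' 0]
      apply Complex.ext <;> simp [kt, hks])
  have hd0 : d = 0 := by
    have e1 := hq 0 trivial
    have e2 := hq (0 + 2 * π) trivial
    simp only [hdd'] at e2
    rw [e1] at e2
    have e3 := congrArg Complex.im e2
    simp at e3
    have : (d:ℝ) * (4 * π) = 0 := by linarith
    exact_mod_cast (mul_eq_zero.1 this).resolve_right (by positivity)
  obtain ⟨k, hk⟩ := log_diff_const (X := (univ : Set ℝ)) isPreconnected_univ (l := fun θ => l (- c (θ + π) / 2, θ + π))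
    (l' := fun θ => l (- c θ / 2, θ) + π * I) (by fun_prop) (by fun_prop) (fun θ _ => by
      rw [exp_add, exp_pi_mul_I, l2', l2', c1]; ring_nf)
  have e1 := hk 0 trivial
  have e2 := hk (0 + π) trivial
  rw [e1, show (0:ℝ) + π + π = 0 + 2 * π by ring, hdd', c2, hd0] at e2
  have e3 := congrArg Complex.im e2
  simp at e3
  have h4 : π * (2 * (2 * k + 1)) = 0 := by linarith
  have h5 := (mul_eq_zero.1 h4).resolve_left hpi.ne'
  have h6 : 2 * (2 * k + 1) = 0 := by exact_mod_cast h5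
  omega

def ktH (n m : ℤ) : ℂ ≃ₜ ℂ where
  toFun := kt n m
  invFun z := ⟨z.re - n, ks n * (z.im - m * (2 * π))⟩
  left_inv z := by apply Complex.ext <;> rcases ks_or n with h | h <;> simp [kt, h]
  right_inv z := by apply Complex.ext <;> rcases ks_or n with h | h <;> simp [kt, h]
  continuous_toFun := continuous_cmk (by fun_prop) (by fun_prop)
  continuous_invFun := continuous_cmk (by fun_prop) (by fun_prop)

theorem conn_side {C : Set ℂ} (hC : IsPreconnected C) (h : ∀ z ∈ C, ‖z‖ ≠ 1) : (∀ z ∈ C, ‖z‖ < 1) ∨ ∀ z ∈ C, 1 < ‖z‖ := by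
  by_contra! hh
  obtain ⟨⟨a, ha, ha'⟩, b, hb, hb'⟩ := hh
  obtain ⟨c, hc, hc'⟩ := hC.intermediate_value hb ha continuous_norm.continuousOn ⟨hb', ha'⟩
  exact h c hc hc'

theorem tri (H : ℂ ≃ₜ ℂ) (h : ∀ z, ‖z‖ = 1 → ‖H z‖ ≠ 1) : (∀ z, ‖z‖ ≤ 1 → ‖H z‖ ≤ 1) ∨ (∀ z, ‖z‖ ≤ 1 → ‖H.symm z‖ ≤ 1) ∨
    ∀ z, ‖z‖ ≤ 1 → 1 < ‖H z‖ := by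
  have hS : IsPreconnected (sphere (0:ℂ) 1) := by
    have := isPreconnected_univ.image (fun u : Circle => (u : ℂ)) (by fun_prop)
    convert this using 1
    ext z
    simp only [image_univ, mem_range, mem_sphere_zero_iff_norm]
    exact ⟨fun hz => ⟨⟨z, by simpa [Submonoid.unitSphere] using hz⟩, rfl⟩, by rintro ⟨u, rfl⟩; exact Circle.norm_coe u⟩
  rcases conn_side (hS.image H H.continuous.continuousOn) (by
    rintro _ ⟨z, hz, rfl⟩; exact h z (mem_sphere_zero_iff_norm.1 hz)) with h1 | h1
  · left
    have hA : IsPreconnected (H.symm '' (closedBall (0:ℂ) 1)ᶜ) := (isPreconnected_compl_closedBall 0 one_pos).image _ H.symm.continuous.continuousOn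
    have key : ∀ w, ‖w‖ = 1 → ‖H w‖ < 1 := fun w hw => h1 _ ⟨w, mem_sphere_zero_iff_norm.2 hw, rfl⟩
    rcases conn_side hA (by
      rintro _ ⟨z, hz, rfl⟩ h2
      have := key _ h2
      rw [H.apply_symm_apply] at this
      exact hz (mem_closedBall_zero_iff.2 this.le)) with h2 | h2
    · exfalso
      obtain ⟨M, hM⟩ := (isCompact_closedBall (0:ℂ) 1).exists_bound_of_continuousOn H.continuous.continuousOn
      have hx : 1 < ‖((|M| + 2 : ℝ) : ℂ)‖ := by
        rw [norm_real, norm_eq_abs, abs_of_pos (by positivity)]; linarith [abs_nonneg M]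
      have h3 := h2 _ ⟨((|M| + 2 : ℝ) : ℂ), fun hx' => absurd (mem_closedBall_zero_iff.1 hx') (not_le.2 hx), rfl⟩
      have h4 := hM _ (mem_closedBall_zero_iff.2 h3.le)
      rw [H.apply_symm_apply, norm_real, norm_eq_abs, abs_of_pos (by positivity)] at h4
      linarith [le_abs_self M]
    · intro z hz
      by_contra h3
      have := h2 _ ⟨H z, fun hx' => h3 (mem_closedBall_zero_iff.1 hx'), rfl⟩
      rw [H.symm_apply_apply] at this
      linarith
  · right
    have key : ∀ w, ‖w‖ = 1 → 1 < ‖H w‖ := fun w hw => h1 _ ⟨w, mem_sphere_zero_iff_norm.2 hw, rfl⟩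
    rcases conn_side ((convex_closedBall (0:ℂ) 1).isPreconnected.image _ H.symm.continuous.continuousOn) (by
      rintro _ ⟨z, hz, rfl⟩ h2
      have := key _ h2
      rw [H.apply_symm_apply] at this
      exact absurd (mem_closedBall_zero_iff.1 hz) (not_le.2 this)) with h2 | h2
    · exact Or.inl fun z hz => (h2 _ ⟨z, mem_closedBall_zero_iff.2 hz, rfl⟩).le
    · refine Or.inr fun z hz => ?_
      by_contra! h3
      have := h2 _ ⟨H z, mem_closedBall_zero_iff.2 h3, rfl⟩
      rw [H.symm_apply_apply] at this
      linarith

theorem no_shift {D : Set ℂ} (hD : IsCompact D) (hn : D.Nonempty) {f : ℂ → ℝ} (hf : Continuous f) {a : ℝ}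
    (h : ∀ x ∈ D, ∃ y ∈ D, f y = f x + a) : a = 0 := by
  obtain ⟨x, hx, hx'⟩ := hD.exists_isMaxOn hn hf.continuousOn
  obtain ⟨y, hy, hy'⟩ := hD.exists_isMinOn hn hf.continuousOn
  obtain ⟨x', h1, h2⟩ := h x hx
  obtain ⟨y', h3, h4⟩ := h y hy
  have h5 : f x' ≤ f x := hx' h1
  have h6 : f y ≤ f y' := hy' h3
  linarith

theorem no_kt {D : Set ℂ} (hD : IsCompact D) (hn : D.Nonempty) {n m : ℤ}
    (h : (∀ x ∈ D, kt n m x ∈ D) ∨ ∀ x ∈ D, (ktH n m).symm x ∈ D) : n = 0 ∧ m = 0 := by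
  rcases h with h | h
  · have h1 : (n:ℝ) = 0 := no_shift hD hn continuous_re fun x hx => ⟨_, h x hx, rfl⟩
    have h1' : n = 0 := by exact_mod_cast h1
    subst h1'
    have h2 : (m * (2 * π) : ℝ) = 0 := no_shift hD hn continuous_im fun x hx => ⟨_, h x hx, by simp [kt, ks]⟩
    exact ⟨rfl, by exact_mod_cast (mul_eq_zero.1 h2).resolve_right two_pi_pos.ne'⟩
  · have h1 : (-n:ℝ) = 0 := no_shift hD hn continuous_re fun x hx => ⟨_, h x hx, rfl⟩
    have h1' : n = 0 := by exact_mod_cast neg_eq_zero.1 h1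
    subst h1'
    have h2 : (-(m * (2 * π)) : ℝ) = 0 := no_shift hD hn continuous_im fun x hx => ⟨_, h x hx, by simp [ktH, ks]; ring⟩
    exact ⟨rfl, by exact_mod_cast (mul_eq_zero.1 (neg_eq_zero.1 h2)).resolve_right two_pi_pos.ne'⟩

theorem case_disc {γ : Circle → KleinBottle} (hi : Function.Injective γ) {L : ℝ → ℂ} (h : Lf γ L 0 0) : BoundsDisc γ := by
  obtain ⟨l, l1, l2⟩ := descend_circle h.c (fun s => by rw [h.p, kt_zero])
  have hl : ∀ u, kp (l u) = γ u := fun u => by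
    obtain ⟨s, rfl⟩ := Circle.exp_surjective u
    rw [l2, h.e]
  have li : Function.Injective l := fun u v huv => hi (by rw [← hl, ← hl, huv])
  have hJ : IsJCurve (range l) := ⟨l, l1, li, rfl⟩
  obtain ⟨p, hp, hp'⟩ := hJ.exists_ess
  have hJ' : IsJCurve ((fun z => z - p) '' range l) := hJ.image (by fun_prop) fun x _ y _ hxy => by simpa using hxy
  obtain ⟨F, -, hF, -⟩ := schoen hJ' ⟨by
    rintro ⟨x, hx, hx'⟩
    exact hp (by rwa [← sub_eq_zero.1 hx']), fun ⟨g, g1, g2⟩ => hp' ⟨fun z => g (z - p), g1.comp (by fun_prop) fun z hz => ⟨z, hz, rfl⟩,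
      fun z hz => g2 _ ⟨z, hz, rfl⟩⟩⟩
  set G : ℂ ≃ₜ ℂ := F.trans (Homeomorph.addRight p) with hG
  have hGF : ∀ z, G z = F z + p := fun z => rfl
  have hGs : G '' sphere 0 1 = range l := by
    rw [show (G : ℂ → ℂ) = (fun z => z + p) ∘ F from rfl, image_comp, hF, ← image_comp]
    convert image_id _ using 2
    ext z; simp
  have hinj : ∀ x y, ‖x‖ ≤ 1 → ‖y‖ ≤ 1 → kp (G x) = kp (G y) → x = y := by
    intro x y hx hy hxy
    obtain ⟨n, m, hnm⟩ := kp_eq_kt hxy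
    by_cases h0 : n = 0 ∧ m = 0
    · rw [h0.1, h0.2, kt_zero] at hnm
      exact (G.injective hnm).symm
    exfalso
    set H : ℂ ≃ₜ ℂ := (G.trans (ktH n m)).trans G.symm with hH
    have hHz : ∀ z, G (H z) = kt n m (G z) := fun z => G.apply_symm_apply _
    have hHz' : ∀ z, G (H.symm z) = (ktH n m).symm (G z) := fun z => G.apply_symm_apply _
    have hD : IsCompact (G '' closedBall 0 1) := (isCompact_closedBall _ _).image G.continuous
    have hDn : (G '' closedBall 0 1).Nonempty := ⟨_, 0, by simp, rfl⟩
    rcases tri H (fun z hz hz' => by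
      obtain ⟨u, hu⟩ : G z ∈ range l := hGs ▸ ⟨z, by simpa using hz, rfl⟩
      obtain ⟨v, hv⟩ : G (H z) ∈ range l := hGs ▸ ⟨H z, by simpa using hz', rfl⟩
      have huv : u = v := hi (by rw [← hl, ← hl, hu, hv, hHz, kp_kt])
      have hk : kt n m (G z) = G z := by rw [← hHz, ← hv, ← hu, huv]
      refine h0 (no_kt (D := {G z}) isCompact_singleton (singleton_nonempty _) (Or.inl ?_))
      rintro _ rfl
      exact hk) with h1 | h1 | h1
    · refine h0 (no_kt hD hDn (Or.inl ?_))
      rintro _ ⟨z, hz, rfl⟩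
      exact ⟨H z, mem_closedBall_zero_iff.2 (h1 z (mem_closedBall_zero_iff.1 hz)), hHz z⟩
    · refine h0 (no_kt hD hDn (Or.inr ?_))
      rintro _ ⟨z, hz, rfl⟩
      exact ⟨H.symm z, mem_closedBall_zero_iff.2 (h1 z (mem_closedBall_zero_iff.1 hz)), hHz' z⟩
    · have h2 := h1 x hx
      rw [← hHz] at hnm
      rw [← G.injective hnm] at h2
      linarith
  refine ⟨fun z => kp (G z), (Continuous.isClosedEmbedding (by
    have := continuous_kp; fun_prop) fun x y hxy => Subtype.ext (hinj x y (mem_closedBall_zero_iff.1 x.2)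
      (mem_closedBall_zero_iff.1 y.2) hxy)).isEmbedding, ?_⟩
  have : range γ = kp '' range l := by rw [← range_comp]; congr 1; ext u; exact (hl u).symm
  rw [this, ← hGs]
  ext k
  constructor
  · rintro ⟨_, ⟨z, hz, rfl⟩, rfl⟩
    exact ⟨⟨z, sphere_subset_closedBall hz⟩, mem_sphere_zero_iff_norm.1 hz, rfl⟩
  · rintro ⟨z, hz, rfl⟩
    exact ⟨_, ⟨z, mem_sphere_zero_iff_norm.2 hz, rfl⟩, rfl⟩

theorem mk_ann {h : ℝ × ℝ → ℂ} (hc : Continuous h) (ho : IsOpenMap h)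
    (hiff : ∀ p q : ℝ × ℝ, kp (h p) = kp (h q) ↔ Circle.exp p.1 = Circle.exp q.1 ∧ p.2 = q.2) :
    ∃ e : Circle × ℝ → KleinBottle, IsEmbedding e ∧ ∀ s t, e (Circle.exp s, t) = kp (h (s, t)) := by
  set q : ℝ × ℝ → Circle × ℝ := Prod.map Circle.exp id with hq
  have qo : IsOpenMap q := IsOpenMap.prodMap Circle.isCoveringMap_exp.isLocalHomeomorph.isOpenMap IsOpenMap.id
  have qs : Function.Surjective q := Circle.exp_surjective.prodMap Function.surjective_id
  have qc : Continuous q := by fun_prop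
  obtain ⟨r, hr⟩ := qs.hasRightInverse
  have key : ∀ p, kp (h (r (q p))) = kp (h p) := fun p => by
    rw [hiff]
    have := hr (q p)
    exact ⟨congrArg Prod.fst this, (congrArg Prod.snd this : (q (r (q p))).2 = (q p).2)⟩
  refine ⟨fun x => kp (h (r x)), (IsOpenEmbedding.of_continuous_injective_isOpenMap ?_ ?_ ?_).isEmbedding, fun s t => key (s, t)⟩
  · rw [(qo.isQuotientMap qc qs).continuous_iff]
    exact (continuous_kp.comp hc).congr fun p => (key p).symm
  · intro x y hxy
    obtain ⟨x, rfl⟩ := qs x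
    obtain ⟨y, rfl⟩ := qs y
    simp only [key, hiff] at hxy
    exact Prod.ext hxy.1 hxy.2
  · intro U hU
    have : (fun x => kp (h (r x))) '' U = kp '' (h '' (q ⁻¹' U)) := by
      ext k
      constructor
      · rintro ⟨x, hx, rfl⟩
        exact ⟨_, ⟨r x, by rw [mem_preimage, hr]; exact hx, rfl⟩, rfl⟩
      · rintro ⟨_, ⟨p, hp, rfl⟩, rfl⟩
        exact ⟨q p, hp, key p⟩
    rw [this]
    exact isOpenMap_kp _ (ho _ (hU.preimage qc))

theorem kp_surj (x : KleinBottle) : ∃ z, kp z = x := by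
  obtain ⟨⟨t, u⟩, rfl⟩ := kmk_surj x
  obtain ⟨s, rfl⟩ := Circle.exp_surjective u
  exact ⟨⟨t, s⟩, rfl⟩

theorem kX_kp (z : ℂ) : kX (kp z) = Real.cos z.im := by
  change ((Circle.exp z.im : Circle) : ℂ).re = _
  rw [Circle.coe_exp, Complex.exp_ofReal_mul_I_re]

def kg (t : ℝ) : ℝ := Real.arctan t / 4

theorem kg_cont : Continuous kg := Real.continuous_arctan.div_const _

theorem kg_inj {t t' : ℝ} (h : kg t = kg t') : t = t' := Real.arctan_injective (by unfold kg at h; linarith)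

theorem kg_lt (t : ℝ) : |kg t| < 1 / 2 := by
  unfold kg
  rw [abs_lt]
  constructor <;> linarith [Real.neg_pi_div_two_lt_arctan t, Real.arctan_lt_pi_div_two t, Real.pi_lt_four]

theorem kg_open : IsOpenMap kg :=
  (Homeomorph.mulRight₀ (4:ℝ)⁻¹ (by norm_num)).isOpenMap.comp (Real.tanPartialHomeomorph.symm.isOpenEmbedding rfl).isOpenMap

theorem cmk_open : IsOpenMap fun p : ℝ × ℝ => (⟨p.1, p.2⟩ : ℂ) := equivRealProdCLM.symm.toHomeomorph.isOpenMap

theorem exists_ga : ∃ e : Circle × ℝ → KleinBottle, IsEmbedding e ∧ ∀ s t, e (Circle.exp s, t) = kp ⟨kg t, s⟩ := by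
  refine mk_ann (h := fun p => ⟨kg p.2, p.1⟩) (continuous_cmk (kg_cont.comp continuous_snd) continuous_fst)
    (cmk_open.comp ((kg_open.prodMap IsOpenMap.id).comp (Homeomorph.prodComm ℝ ℝ).isOpenMap)) fun p q => ?_
  rw [kp_eq, Circle.exp_eq_exp]
  constructor
  · rintro ⟨n, m, h1, h2⟩
    have hn : n = 0 := int_zero (a := kg q.2 - kg p.2) (by
      have a1 := abs_lt.1 (kg_lt q.2)
      have a2 := abs_lt.1 (kg_lt p.2)
      rw [abs_lt]; constructor <;> linarith [a1.1, a1.2, a2.1, a2.2]) (by simp only at h1; linarith)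
    subst hn
    simp [ks] at h1 h2
    exact ⟨⟨-m, by rw [h2]; push_cast; ring⟩, (kg_inj h1).symm⟩
  · rintro ⟨⟨m, h1⟩, h2⟩
    exact ⟨0, -m, by simp [h2], by simp [ks, h1]⟩

theorem exists_gb : ∃ e : Circle × ℝ → KleinBottle, IsEmbedding e ∧
    ∀ s t, e (Circle.exp s, t) = kp ⟨s / π, π / 2 + kg t⟩ := by
  have hpi := pi_pos
  refine mk_ann (h := fun p => ⟨p.1 / π, π / 2 + kg p.2⟩) (continuous_cmk (by fun_prop) (continuous_const.add (kg_cont.comp continuous_snd)))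
    (cmk_open.comp (IsOpenMap.prodMap (f := fun s : ℝ => s / π) (g := fun t => π / 2 + kg t)
      (Homeomorph.mulRight₀ (π)⁻¹ (by positivity)).isOpenMap ((Homeomorph.addLeft (π / 2)).isOpenMap.comp kg_open))) fun p q => ?_
  rw [kp_eq, Circle.exp_eq_exp]
  have a1 := abs_lt.1 (kg_lt q.2)
  have a2 := abs_lt.1 (kg_lt p.2)
  have hp3 := pi_gt_three
  constructor
  · rintro ⟨n, m, h1, h2⟩
    simp only at h1 h2
    rcases ks_or n with ⟨⟨k, rfl⟩, h⟩ | ⟨-, h⟩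
    · rw [h] at h2
      have hm : m = 0 := int_zero (a := (kg q.2 - kg p.2) / (2 * π)) (by
        rw [abs_lt, div_lt_iff₀ (by positivity), lt_div_iff₀ (by positivity)]
        constructor <;> linarith [a1.1, a1.2, a2.1, a2.2]) (by field_simp; linarith)
      subst hm
      refine ⟨⟨-k, ?_⟩, (kg_inj (by push_cast at h2; linarith)).symm⟩
      push_cast at h1 ⊢
      field_simp at h1
      linarith
    · rw [h] at h2
      have hm : 2 * m - 1 = 0 := int_zero (a := (kg q.2 + kg p.2) / π) (by
        rw [abs_lt, div_lt_iff₀ (by positivity), lt_div_iff₀ (by positivity)]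
        constructor <;> linarith [a1.1, a1.2, a2.1, a2.2]) (by push_cast; field_simp; linarith)
      omega
  · rintro ⟨⟨m, h1⟩, h2⟩
    refine ⟨2 * (-m), 0, ?_, by simp [ks, h2]⟩
    rw [h1]; push_cast; field_simp; ring

theorem not_iso {γ γ' : Circle → KleinBottle} (ha : ∀ s, γ (Circle.exp s) = kp ⟨0, s⟩)
    (hb : ∀ s, γ' (Circle.exp s) = kp ⟨s / π, π / 2⟩) : ¬ Iso (range γ) (range γ') := by
  rintro ⟨F, -, hF, -, h⟩
  have hpi := pi_pos
  have h1 : IsPreconnected (range γ)ᶜ := by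
    have : (range γ)ᶜ = kp '' (Complex.re ⁻¹' Ioo 0 1) := by
      ext x
      constructor
      · intro hx
        obtain ⟨z, rfl⟩ := kp_surj x
        refine ⟨kt (-⌊z.re⌋) 0 z, ⟨?_, ?_⟩, kp_kt _ _ _⟩
        · simp only [kt]; push_cast
          refine lt_of_le_of_ne (by linarith [Int.floor_le z.re]) fun h0 => hx ⟨Circle.exp (kt (-⌊z.re⌋) 0 z).im, ?_⟩
          rw [ha, ← kp_kt (-⌊z.re⌋) 0 z]
          congr 1
          exact Complex.ext (by simp only [kt]; push_cast; exact h0) rfl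
        · simp only [kt]; push_cast; linarith [Int.lt_floor_add_one z.re]
      · rintro ⟨z, hz, rfl⟩ ⟨u, hu⟩
        obtain ⟨s, rfl⟩ := Circle.exp_surjective u
        rw [ha, kp_eq] at hu
        obtain ⟨n, m, h2, -⟩ := hu
        simp only [zero_add] at h2
        have h3 : z.re ∈ Ioo 0 1 := hz
        rw [h2] at h3
        have h4 : 0 < n := by exact_mod_cast h3.1
        have h5 : n < 1 := by exact_mod_cast h3.2
        omega
    rw [this]
    exact ((convex_Ioo 0 1).is_linear_preimage Complex.reLm.isLinear).isPreconnected.image _ continuous_kp.continuousOn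
  have h2 := h1.image (F 1) (hF 1).continuous.continuousOn
  rw [image_compl_eq (hF 1).bijective, h] at h2
  have h3 : ∀ z : ℂ, kp z ∈ range γ' ↔ Real.cos z.im = 0 := by
    intro z
    constructor
    · rintro ⟨u, hu⟩
      obtain ⟨s, rfl⟩ := Circle.exp_surjective u
      rw [← kX_kp, ← hu, hb, kX_kp, Real.cos_pi_div_two]
    · intro hz
      obtain ⟨k, hk⟩ := Real.cos_eq_zero_iff.1 hz
      obtain ⟨j, rfl | rfl⟩ := Int.even_or_odd' k
      · refine ⟨Circle.exp (z.re * π), ?_⟩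
        rw [hb, eq_comm, kp_eq]
        refine ⟨0, -j, by simp [hpi.ne'], ?_⟩
        simp [ks, hk]; ring
      · refine ⟨Circle.exp ((z.re + 1) * π), ?_⟩
        rw [hb, eq_comm, kp_eq]
        refine ⟨1, j + 1, by simp [hpi.ne'], ?_⟩
        simp [ks, hk]; ring
  obtain ⟨x, hx, hx'⟩ := h2.intermediate_value (a := kp ⟨0, π⟩) (b := kp 0) (by
    rw [mem_compl_iff, h3]; simp) (by rw [mem_compl_iff, h3]; simp) continuous_kX.continuousOn
    (show (0:ℝ) ∈ _ by rw [kX_kp, kX_kp]; simp)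
  obtain ⟨z, rfl⟩ := kp_surj x
  rw [mem_compl_iff, h3, ← kX_kp] at hx
  exact hx hx'

theorem runs_two {γ : Circle → KleinBottle} (hγ : IsEmbedding γ) (h : RunsAround γ 2) :
    Iso (range γ) (CB.P '' sphere 0 (Real.exp CB.c)) := by
  obtain ⟨L, n, m, hL⟩ := exists_Lf hγ.continuous
  obtain ⟨c, u, hc, hu, h1, h2⟩ := h
  obtain ⟨j, hj⟩ := int_const (X := (univ : Set ℝ)) isPreconnected_univ (f := fun s => c s - (L s).re)
    (hc.sub (continuous_re.comp hL.c)).continuousOn (fun s _ => by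
      have h3 : kmk ((L s).re, Circle.exp (L s).im) = kmk (c s, u s) := (hL.e s).symm.trans (h1 s)
      obtain ⟨n, hn⟩ := kmk_eq'.1 h3
      have h4 : c s = (L s).re + n := congrArg Prod.fst hn
      exact ⟨n, by rw [h4]; ring⟩)
  have e1 := hj 0 trivial
  have e2 := hj (0 + 2 * π) trivial
  rw [hL.p] at e2
  rw [zero_add] at e2
  simp only [kt] at e2
  have hn : ∃ k : ℤ, k ≠ 0 ∧ n = 2 * k := by
    rcases h2 with h2 | h2
    · exact ⟨1, one_ne_zero, by have : (n:ℝ) = 2 := by push_cast at h2; linarith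
                                exact_mod_cast this⟩
    · exact ⟨-1, by norm_num, by have : (n:ℝ) = -2 := by push_cast at h2; linarith
                                 exact_mod_cast this⟩
  obtain ⟨k, hk, rfl⟩ := hn
  by_cases hm : m = 0
  · subst hm; exact case_b hγ.injective hL hk
  · exact (case_c hγ.injective hL hk hm).elim

/-- Lickorish.  There are exactly two non-trivial isotopy classes of
unoriented, orientation-preserving simple closed curves on the Klein bottle; and any
two simple closed curves running twice around the `S¹` direction are isotopic — in
particular "the" doubled curve on `∂(S¹ ×̃ B²)` is unique up to isotopy. -/
theorem klein_bottle_curves_classification :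
    (∃ γ₁ γ₂ : Circle → KleinBottle,
      (IsEmbedding γ₁ ∧ HasAnnularNbhd γ₁ ∧ ¬ BoundsDisc γ₁) ∧
      (IsEmbedding γ₂ ∧ HasAnnularNbhd γ₂ ∧ ¬ BoundsDisc γ₂) ∧
      ¬ CurveIsotopic γ₁ γ₂ ∧
      (∀ γ : Circle → KleinBottle,
        IsEmbedding γ → HasAnnularNbhd γ → ¬ BoundsDisc γ →
        CurveIsotopic γ γ₁ ∨ CurveIsotopic γ γ₂)) ∧
    (∀ γ γ' : Circle → KleinBottle,
      IsEmbedding γ → RunsAround γ 2 → IsEmbedding γ' → RunsAround γ' 2 →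
      CurveIsotopic γ γ') := by
  refine ⟨?_, fun γ γ' h1 h2 h3 h4 => (runs_two h1 h2).trans (runs_two h3 h4).symm⟩
  have hpi := pi_pos
  obtain ⟨ea, ha1, ha2⟩ := exists_ga
  obtain ⟨eb, hb1, hb2⟩ := exists_gb
  have emb : ∀ e : Circle × ℝ → KleinBottle, IsEmbedding e → IsEmbedding fun u => e (u, 0) := fun e he =>
    (Continuous.isClosedEmbedding (he.continuous.comp (by fun_prop)) fun u v huv => congrArg Prod.fst (he.injective huv)).isEmbedding
  have kg0 : kg 0 = 0 := by simp [kg]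
  have la : ∀ s, ea (Circle.exp s, 0) = kp ⟨0, s⟩ := fun s => by rw [ha2, kg0]
  have lb : ∀ s, eb (Circle.exp s, 0) = kp ⟨s / π, π / 2⟩ := fun s => by rw [hb2, kg0, add_zero]
  have La : Lf (fun u => ea (u, 0)) (fun s => ⟨0, s⟩) 0 1 := ⟨continuous_cmk continuous_const continuous_id, la, fun s => by
    apply Complex.ext <;> simp [kt, ks]⟩
  have Lb : Lf (fun u => eb (u, 0)) (fun s => ⟨s / π, π / 2⟩) (2 * 1) 0 :=
    ⟨continuous_cmk (by fun_prop) continuous_const, lb, fun s => by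
      apply Complex.ext <;> simp [kt, ks]; field_simp⟩
  refine ⟨fun u => ea (u, 0), fun u => eb (u, 0), ⟨emb _ ha1, ⟨ea, ha1, fun _ => rfl⟩, not_disc (emb _ ha1).continuous La ?_⟩,
    ⟨emb _ hb1, ⟨eb, hb1, fun _ => rfl⟩, not_disc (emb _ hb1).continuous Lb ?_⟩, not_iso la lb, fun γ h1 h2 h3 => ?_⟩
  · intro h
    have := congrArg Complex.im h
    simp at this
  · intro h
    have := congrArg Complex.re h
    simp at this
  · obtain ⟨L, n, m, hL⟩ := exists_Lf h1.continuous
    by_cases hn : Even n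
    · obtain ⟨k, rfl⟩ := hn.exists_two_nsmul
      simp only [nsmul_eq_mul, Nat.cast_ofNat] at hL
      by_cases hk : k = 0
      · subst hk
        rw [mul_zero] at hL
        by_cases hm : m = 0
        · subst hm; exact (h3 (case_disc h1.injective hL)).elim
        · exact Or.inl ((case_a h1.injective hL hm).trans (case_a (emb _ ha1).injective La one_ne_zero).symm)
      · by_cases hm : m = 0
        · subst hm
          exact Or.inr ((case_b h1.injective hL hk).trans (case_b (emb _ hb1).injective Lb one_ne_zero).symm)
        · exact (case_c h1.injective hL hk hm).elim
    · exact (case_odd hL hn h2).elim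

end
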